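/- Let G be a triconed graph with no coloops (every edge of G lies outside some spanning tree), with the total edge order fixed as specified and B0 its minimum spanning tree. Then there exists an injective map φ from the set of spanning trees of G into the set of monomials in the variables E(G) \ B0 (finitely supported functions from E(G) \ B0 to ℕ) such that: (i) for every spanning tree B, the total degree of φ(B) equals the passivity of B; (ii) the image of φ is closed under divisibility; (iii) all elements of the image that are maximal under divisibility have the same total degree. -/

import Mathlib

open scoped Classical

variable {V : Type} [Fintype V] [LinearOrder V] [LinearOrder (Sym2 V)]

/-- `T` is a spanning tree of the graph `G`, viewed as a set of edges. -/
def IsSpanningTree (G : SimpleGraph V) (T : Set (Sym2 V)) : Prop :=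
  T ⊆ G.edgeSet ∧ (SimpleGraph.fromEdgeSet T).IsTree

/-- An edge `e` of the spanning tree `T` is internally passive (w.r.t. the edge order). -/
def InternallyPassive (G : SimpleGraph V) (T : Set (Sym2 V)) (e : Sym2 V) : Prop :=
  e ∈ T ∧ ∃ f ∈ G.edgeSet, f ∉ T ∧ f < e ∧ IsSpanningTree G (insert f (T \ {e}))

/-- The passivity of a spanning tree: the number of internally passive edges. -/
noncomputable def passivity (G : SimpleGraph V) (T : Set (Sym2 V)) : ℕ :=
  {e : Sym2 V | InternallyPassive G T e}.ncard

/-- `A` is lexicographically smaller than `B` as (sorted lists of) sets of edges: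
the minimum of the symmetric difference lies in `A`. -/
def EdgeSetLexLt (A B : Set (Sym2 V)) : Prop :=
  ∃ e, e ∈ A ∧ e ∉ B ∧ ∀ f, (f ∈ A ∧ f ∉ B) ∨ (f ∈ B ∧ f ∉ A) → f ≠ e → e < f

/-- `B0` is the minimum spanning tree of `G`: the spanning tree whose sorted edge
list is lexicographically smallest. -/
def IsMinSpanningTree (G : SimpleGraph V) (B0 : Set (Sym2 V)) : Prop :=
  IsSpanningTree G B0 ∧ ∀ T, IsSpanningTree G T → T ≠ B0 → EdgeSetLexLt B0 T

/-- `G` has no coloops: every edge lies outside some spanning tree. -/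
def NoColoops (G : SimpleGraph V) : Prop :=
  ∀ e ∈ G.edgeSet, ∃ T, IsSpanningTree G T ∧ e ∉ T

/-- `G` is a triconed graph with distinguished path `v1 - v0 - v2`. -/
def IsTriconed (G : SimpleGraph V) (v0 v1 v2 : V) : Prop :=
  G.Connected ∧ v0 ≠ v1 ∧ v0 ≠ v2 ∧ v1 ≠ v2 ∧ G.Adj v0 v1 ∧ G.Adj v0 v2 ∧
    ∀ v, v ≠ v0 → v ≠ v1 → v ≠ v2 → G.Adj v0 v ∨ G.Adj v1 v ∨ G.Adj v2 v

/-- The vertex order puts `v0 < v1 < v2` first, then the remaining neighbors of `v0`,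
then the remaining vertices adjacent to `v1`, then the rest. -/
def VertexOrderSpec (G : SimpleGraph V) (v0 v1 v2 : V) : Prop :=
  v0 < v1 ∧ v1 < v2 ∧
  (∀ v, v ≠ v0 → v ≠ v1 → v ≠ v2 → v2 < v) ∧
  (∀ u u', u ≠ v0 → u ≠ v1 → u ≠ v2 → u' ≠ v0 → u' ≠ v1 → u' ≠ v2 →
    G.Adj v0 u → ¬G.Adj v0 u' → u < u') ∧
  (∀ u u', u ≠ v0 → u ≠ v1 → u ≠ v2 → u' ≠ v0 → u' ≠ v1 → u' ≠ v2 →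
    ¬G.Adj v0 u → ¬G.Adj v0 u' → G.Adj v1 u → ¬G.Adj v1 u' → u < u')

/-- Smaller endpoint of an edge. -/
def sym2Min (e : Sym2 V) : V :=
  Sym2.lift ⟨fun a b => min a b, fun a b => min_comm a b⟩ e

/-- Larger endpoint of an edge. -/
def sym2Max (e : Sym2 V) : V :=
  Sym2.lift ⟨fun a b => max a b, fun a b => max_comm a b⟩ e

/-- Lexicographic comparison of edges by their endpoints. -/
def Sym2Lex (e f : Sym2 V) : Prop :=
  sym2Min e < sym2Min f ∨ (sym2Min e = sym2Min f ∧ sym2Max e < sym2Max f)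

/-- The block of an edge in the specified edge ordering: edges at `v0` first, then edges
joining `v1` to height-2 vertices, then edges joining `v2` to height-2 vertices not
adjacent to `v1`, then the remaining edges. -/
noncomputable def edgeBlock (G : SimpleGraph V) (v0 v1 v2 : V) (e : Sym2 V) : ℕ :=
  if v0 ∈ e then 0
  else if ∃ x, e = s(v1, x) ∧ ¬G.Adj v0 x then 1
  else if ∃ x, e = s(v2, x) ∧ ¬G.Adj v0 x ∧ ¬G.Adj v1 x then 2
  else 3

/-- The edge order respects the blocks, and is lexicographic within the first three blocks. -/
def EdgeOrderSpec (G : SimpleGraph V) (v0 v1 v2 : V) : Prop :=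
  (∀ e ∈ G.edgeSet, ∀ f ∈ G.edgeSet,
      edgeBlock G v0 v1 v2 e < edgeBlock G v0 v1 v2 f → e < f) ∧
  (∀ e ∈ G.edgeSet, ∀ f ∈ G.edgeSet,
      edgeBlock G v0 v1 v2 e = edgeBlock G v0 v1 v2 f → edgeBlock G v0 v1 v2 e ≤ 2 →
      Sym2Lex e f → e < f)

/-- The edges of `G_red`: edges of `G` not in `B0` and not incident to `v0`. -/
def GredEdges (G : SimpleGraph V) (v0 : V) (B0 : Set (Sym2 V)) : Set (Sym2 V) :=
  {e | e ∈ G.edgeSet ∧ e ∉ B0 ∧ v0 ∉ e}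

/-- `u` is a child of `p` in the spanning tree `B0` rooted at `v0`:
`s(u,p) ∈ B0` and removing this edge disconnects `u` from the root. -/
def IsChildOf (B0 : Set (Sym2 V)) (v0 : V) (u p : V) : Prop :=
  s(u, p) ∈ B0 ∧ ¬(SimpleGraph.fromEdgeSet (B0 \ {s(u, p)})).Reachable u v0

/-- The type of a vertex: `1` if it is `v1` or a child of `v1`, `2` if it is `v2` or a
child of `v2`, and `0` otherwise. -/
noncomputable def vType (B0 : Set (Sym2 V)) (v0 v1 v2 : V) (u : V) : ℕ :=
  if u = v1 ∨ IsChildOf B0 v0 u v1 then 1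
  else if u = v2 ∨ IsChildOf B0 v0 u v2 then 2
  else 0

/-- The height of a vertex other than `v0`: `1` if adjacent to `v0`, `2` otherwise. -/
noncomputable def vHeight (G : SimpleGraph V) (v0 : V) (u : V) : ℕ :=
  if G.Adj v0 u then 1 else 2

/-- `(E, m)` is a marked spanning forest of `G_red`: an acyclic set of `G_red`-edges
with marks on vertices, each vertex carrying at most one mark except type-2 vertices
which may carry two. -/
def IsMarkedForest (G : SimpleGraph V) (v0 v1 v2 : V) (B0 : Set (Sym2 V))
    (E : Set (Sym2 V)) (m : V → ℕ) : Prop :=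
  E ⊆ GredEdges G v0 B0 ∧ (SimpleGraph.fromEdgeSet E).IsAcyclic ∧ m v0 = 0 ∧
  ∀ v, m v ≤ if vType B0 v0 v1 v2 v = 2 then 2 else 1

/-- Total number of marks in the component of `u`. -/
noncomputable def compMarks (E : Set (Sym2 V)) (m : V → ℕ) (u : V) : ℕ :=
  ∑ x : V, if (SimpleGraph.fromEdgeSet E).Reachable u x then m x else 0

/-- Number of marks of type `t` in the component of `u` (the extra mark of a doubly
marked vertex counting as a mark of type `0`). -/
noncomputable def markTypeCount (B0 : Set (Sym2 V)) (v0 v1 v2 : V)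
    (E : Set (Sym2 V)) (m : V → ℕ) (u : V) (t : ℕ) : ℕ :=
  ∑ x : V, if (SimpleGraph.fromEdgeSet E).Reachable u x then
      ((if 1 ≤ m x ∧ vType B0 v0 v1 v2 x = t then 1 else 0) +
        (if m x = 2 ∧ t = 0 then 1 else 0))
    else 0

/-- The component of `u` in `(E, m)` is correctly marked. -/
def CorrectlyMarkedComp (B0 : Set (Sym2 V)) (v0 v1 v2 : V)
    (E : Set (Sym2 V)) (m : V → ℕ) (u : V) : Prop :=
  1 ≤ compMarks E m u ∧
  ((SimpleGraph.fromEdgeSet E).Reachable u v1 → 1 ≤ m v1) ∧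
  ((SimpleGraph.fromEdgeSet E).Reachable u v2 → 1 ≤ m v2) ∧
  (∀ t, markTypeCount B0 v0 v1 v2 E m u t ≤ 1) ∧
  (∀ x, (SimpleGraph.fromEdgeSet E).Reachable u x → m x = 2 →
    ∃ x', (SimpleGraph.fromEdgeSet E).Reachable u x' ∧ x' ≠ x ∧ 1 ≤ m x')

/-- The multiplicity of the blueprint edge `{a, b}`: the number of 2-components whose
marks have types `a` and `b`, plus (for `{a,b} ∈ {{0,1},{0,2}}`) the number of
3-components. -/
noncomputable def bpMult (B0 : Set (Sym2 V)) (v0 v1 v2 : V)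
    (E : Set (Sym2 V)) (m : V → ℕ) (a b : ℕ) : ℕ :=
  {c : (SimpleGraph.fromEdgeSet E).ConnectedComponent |
    ∃ u, u ≠ v0 ∧ (SimpleGraph.fromEdgeSet E).connectedComponentMk u = c ∧
      ((compMarks E m u = 2 ∧ a ≠ b ∧
          1 ≤ markTypeCount B0 v0 v1 v2 E m u a ∧ 1 ≤ markTypeCount B0 v0 v1 v2 E m u b) ∨
        (compMarks E m u = 3 ∧
          (({a, b} : Set ℕ) = {0, 1} ∨ ({a, b} : Set ℕ) = {0, 2})))}.ncard

/-- The blueprint (a multigraph on `{0,1,2}`) is acyclic. -/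
def bpAcyclic (B0 : Set (Sym2 V)) (v0 v1 v2 : V) (E : Set (Sym2 V)) (m : V → ℕ) : Prop :=
  bpMult B0 v0 v1 v2 E m 0 1 ≤ 1 ∧ bpMult B0 v0 v1 v2 E m 0 2 ≤ 1 ∧
  bpMult B0 v0 v1 v2 E m 1 2 ≤ 1 ∧
  ¬(1 ≤ bpMult B0 v0 v1 v2 E m 0 1 ∧ 1 ≤ bpMult B0 v0 v1 v2 E m 0 2 ∧
      1 ≤ bpMult B0 v0 v1 v2 E m 1 2)

/-- The vertices `a` and `b` of the blueprint lie in the same connected component. -/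
def bpConnected (B0 : Set (Sym2 V)) (v0 v1 v2 : V) (E : Set (Sym2 V)) (m : V → ℕ)
    (a b : ℕ) : Prop :=
  a = b ∨ 1 ≤ bpMult B0 v0 v1 v2 E m a b ∨
    ∃ c, c ∈ ({0, 1, 2} : Set ℕ) ∧ c ≠ a ∧ c ≠ b ∧
      1 ≤ bpMult B0 v0 v1 v2 E m a c ∧ 1 ≤ bpMult B0 v0 v1 v2 E m c b

/-- `(E, m)` is a trirooted forest of `G_red`. -/
def IsTriRootedForest (G : SimpleGraph V) (v0 v1 v2 : V) (B0 : Set (Sym2 V))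
    (E : Set (Sym2 V)) (m : V → ℕ) : Prop :=
  IsMarkedForest G v0 v1 v2 B0 E m ∧
  (∀ u, u ≠ v0 → CorrectlyMarkedComp B0 v0 v1 v2 E m u) ∧
  bpAcyclic B0 v0 v1 v2 E m

/-- `v` receives the extra mark coming from the edge `02`: `02 ∈ B`, there is a path
from `v2` to `v1` in `B` avoiding `02`, and `v` is the endpoint closer to `v2` of the
first edge of this path not in `B0`. -/
def DoublyMarkedAt (B0 B : Set (Sym2 V)) (v0 v1 v2 : V) (v : V) : Prop :=
  s(v0, v2) ∈ B ∧
  ∃ p : (SimpleGraph.fromEdgeSet B).Walk v2 v1, p.IsPath ∧ s(v0, v2) ∉ p.edges ∧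
    ∃ i : ℕ, (∀ j < i, ∀ e, p.edges[j]? = some e → e ∈ B0) ∧
      (∃ e, p.edges[i]? = some e ∧ e ∉ B0) ∧ v = p.getVert i

/-- `(E, m)` is the marked spanning forest `φ₁(B)` associated to the spanning tree `B`. -/
def IsPhi1 (G : SimpleGraph V) (v0 v1 v2 : V) (B0 B : Set (Sym2 V))
    (E : Set (Sym2 V)) (m : V → ℕ) : Prop :=
  E = B ∩ GredEdges G v0 B0 ∧
  (∀ v, m v ≤ 2) ∧
  (∀ v, 1 ≤ m v ↔ (v = v1 ∨ v = v2 ∨ ∃ p, IsChildOf B0 v0 v p ∧ s(v, p) ∈ B)) ∧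
  (∀ v, m v = 2 ↔ DoublyMarkedAt B0 B v0 v1 v2 v)

/-- `(S, E)` is a (sub)tree of `G_red` with vertex set `S` and edge set `E`. -/
def IsSubTree (G : SimpleGraph V) (v0 : V) (B0 : Set (Sym2 V))
    (S : Set V) (E : Set (Sym2 V)) : Prop :=
  S.Nonempty ∧ v0 ∉ S ∧ E ⊆ GredEdges G v0 B0 ∧
  (∀ e ∈ E, ∀ x ∈ e, x ∈ S) ∧
  (∀ u ∈ S, ∀ x ∈ S, (SimpleGraph.fromEdgeSet E).Reachable u x) ∧
  (SimpleGraph.fromEdgeSet E).IsAcyclic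

/-- Total number of marks of the marked tree `(S, m)`. -/
noncomputable def treeTotalMarks (S : Set V) (m : V → ℕ) : ℕ :=
  ∑ x : V, if x ∈ S then m x else 0

/-- Number of marks of type `t` of the marked tree `(S, m)`. -/
noncomputable def treeMarkTypeCount (B0 : Set (Sym2 V)) (v0 v1 v2 : V)
    (S : Set V) (m : V → ℕ) (t : ℕ) : ℕ :=
  ∑ x : V, if x ∈ S then
      ((if 1 ≤ m x ∧ vType B0 v0 v1 v2 x = t then 1 else 0) +
        (if m x = 2 ∧ t = 0 then 1 else 0))
    else 0

/-- `(S, E, m)` is a correctly marked tree of `G_red`. -/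
def IsCorrectlyMarkedTree (G : SimpleGraph V) (v0 v1 v2 : V) (B0 : Set (Sym2 V))
    (S : Set V) (E : Set (Sym2 V)) (m : V → ℕ) : Prop :=
  IsSubTree G v0 B0 S E ∧
  (∀ v, v ∉ S → m v = 0) ∧
  (∀ v, m v ≤ if vType B0 v0 v1 v2 v = 2 then 2 else 1) ∧
  1 ≤ treeTotalMarks S m ∧
  (v1 ∈ S → 1 ≤ m v1) ∧ (v2 ∈ S → 1 ≤ m v2) ∧
  (∀ t, treeMarkTypeCount B0 v0 v1 v2 S m t ≤ 1) ∧
  (∀ x ∈ S, m x = 2 → ∃ x' ∈ S, x' ≠ x ∧ 1 ≤ m x')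

/-- Number of effective marks: marks at normal vertices together with the extra marks
of doubly marked vertices. -/
noncomputable def effMarks (v1 v2 : V) (S : Set V) (m : V → ℕ) : ℕ :=
  treeTotalMarks S m -
    ((if v1 ∈ S ∧ 1 ≤ m v1 then 1 else 0) + (if v2 ∈ S ∧ 1 ≤ m v2 then 1 else 0))

/-- Number of passive effective marks: an effective mark is passive unless it is the
unique mark of the tree and lies at the smallest vertex of the tree. -/
noncomputable def passiveEffMarks (v1 v2 : V) (S : Set V) (m : V → ℕ) : ℕ :=
  effMarks v1 v2 S m -
    (if ∃ v ∈ S, v ≠ v1 ∧ v ≠ v2 ∧ 1 ≤ m v ∧ treeTotalMarks S m = 1 ∧ ∀ u ∈ S, v ≤ u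
      then 1 else 0)

/-- Total excess `Σ_{e ∈ E} (w e - 1)` of the edge weights. -/
noncomputable def excessWeightSum (E : Set (Sym2 V)) (w : Sym2 V → ℕ) : ℕ :=
  ∑ e : Sym2 V, if e ∈ E then w e - 1 else 0

/-- Excess weight of the weighted tree `(S, E, w)`. -/
noncomputable def excessWeight (v1 v2 : V) (S : Set V) (E : Set (Sym2 V))
    (w : Sym2 V → ℕ) : ℕ :=
  (if v1 ∈ S then 1 else 0) + (if v2 ∈ S then 1 else 0) + excessWeightSum E w

/-- Total weight `Σ_{e ∈ E} w e`, i.e. the total degree of the associated monomial. -/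
noncomputable def totalWeight (E : Set (Sym2 V)) (w : Sym2 V → ℕ) : ℕ :=
  ∑ e : Sym2 V, if e ∈ E then w e else 0

/-- All pairs of weighted objects of the weighted tree `(S, E, w)` are compatible:
the endpoints of the smallest path containing any two weighted objects have
different types. -/
def WeightedObjectsCompatible (B0 : Set (Sym2 V)) (v0 v1 v2 : V)
    (S : Set V) (E : Set (Sym2 V)) (w : Sym2 V → ℕ) : Prop :=
  (∀ vsp ∈ ({v1, v2} : Set V), vsp ∈ S → ∀ x y, s(x, y) ∈ E → 2 ≤ w s(x, y) →
      (SimpleGraph.fromEdgeSet (E \ {s(x, y)})).Reachable vsp x →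
      vType B0 v0 v1 v2 vsp ≠ vType B0 v0 v1 v2 y) ∧
  (∀ x y p q, s(x, y) ∈ E → s(p, q) ∈ E → s(x, y) ≠ s(p, q) →
      2 ≤ w s(x, y) → 2 ≤ w s(p, q) →
      (SimpleGraph.fromEdgeSet (E \ {s(x, y)})).Reachable x p →
      (SimpleGraph.fromEdgeSet (E \ {s(p, q)})).Reachable p x →
      vType B0 v0 v1 v2 y ≠ vType B0 v0 v1 v2 q) ∧
  (∀ x y, s(x, y) ∈ E → 3 ≤ w s(x, y) → vType B0 v0 v1 v2 x ≠ vType B0 v0 v1 v2 y)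

/-- `(S, E, w)` is a correctly weighted tree of `G_red`. -/
def IsCorrectlyWeightedTree (G : SimpleGraph V) (v0 v1 v2 : V) (B0 : Set (Sym2 V))
    (S : Set V) (E : Set (Sym2 V)) (w : Sym2 V → ℕ) : Prop :=
  IsSubTree G v0 B0 S E ∧
  (∀ e ∈ E, 1 ≤ w e) ∧
  excessWeight v1 v2 S E w ≤ 3 ∧
  (2 ≤ excessWeight v1 v2 S E w → WeightedObjectsCompatible B0 v0 v1 v2 S E w) ∧
  (∀ x y, s(x, y) ∈ E → w s(x, y) ≤ vHeight G v0 x + vHeight G v0 y) ∧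
  (∀ x y, s(x, y) ∈ E → w s(x, y) = vHeight G v0 x + vHeight G v0 y →
    ∀ e ∈ E, e ≠ s(x, y) → w e ≤ 2)

/-- `s(v, x)` is the edge incident to `v` on the unique path from `v` to `u` in the
tree with edge set `E`. -/
def PathFirstEdge (E : Set (Sym2 V)) (v u : V) (x : V) : Prop :=
  s(v, x) ∈ E ∧ ¬(SimpleGraph.fromEdgeSet (E \ {s(v, x)})).Reachable v u

/-- `z` lies on the (unique) path between `a` and `b` in the forest with edge set `E`. -/
def OnPathBetween (E : Set (Sym2 V)) (a b z : V) : Prop :=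
  ∃ p : (SimpleGraph.fromEdgeSet E).Walk a b, p.IsPath ∧ z ∈ p.support

/-- `s(x, y)` (with `x` nearer `z`, `y` nearer `v`) is the first edge along the path
from the sandwiched mark `z` towards `v` whose endpoint closer to `v` has type
different from that of `wv` and whose endpoint closer to `wv` has type different
from that of `v`. -/
def SandwichEdge (B0 : Set (Sym2 V)) (v0 v1 v2 : V) (E : Set (Sym2 V))
    (z v wv : V) (x y : V) : Prop :=
  s(x, y) ∈ E ∧
  ¬(SimpleGraph.fromEdgeSet (E \ {s(x, y)})).Reachable z v ∧
  (SimpleGraph.fromEdgeSet (E \ {s(x, y)})).Reachable z x ∧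
  vType B0 v0 v1 v2 y ≠ vType B0 v0 v1 v2 wv ∧
  vType B0 v0 v1 v2 x ≠ vType B0 v0 v1 v2 v ∧
  ∀ x' y', s(x', y') ∈ E →
    ¬(SimpleGraph.fromEdgeSet (E \ {s(x', y')})).Reachable z x →
    (SimpleGraph.fromEdgeSet (E \ {s(x', y')})).Reachable z x' →
    (vType B0 v0 v1 v2 y' = vType B0 v0 v1 v2 wv ∨ vType B0 v0 v1 v2 x' = vType B0 v0 v1 v2 v)

/-- `w` is the weighting `φ₂(S, E, m)` produced by the empowerment algorithm applied
to the correctly marked tree `(S, E, m)` (only the weights of edges of `E` are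
constrained). -/
def IsPhi2 (B0 : Set (Sym2 V)) (v0 v1 v2 : V)
    (S : Set V) (E : Set (Sym2 V)) (m : V → ℕ) (w : Sym2 V → ℕ) : Prop :=
  (treeTotalMarks S m = 1 →
    ∃ v ∈ S, m v = 1 ∧
      (((∀ u ∈ S, v ≤ u) ∧ ∀ e ∈ E, w e = 1) ∨
        (¬(∀ u ∈ S, v ≤ u) ∧ ∃ u0 ∈ S, (∀ u ∈ S, u0 ≤ u) ∧
          ∃ x, PathFirstEdge E v u0 x ∧ ∀ e ∈ E, w e = if e = s(v, x) then 2 else 1))) ∧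
  (treeTotalMarks S m = 2 →
    ∃ v ∈ S, ∃ u ∈ S, v ≠ u ∧ m v = 1 ∧ m u = 1 ∧
      ∃ x y, PathFirstEdge E v u x ∧ PathFirstEdge E u v y ∧
        ∀ e ∈ E, w e = 1 + (if v ≠ v1 ∧ v ≠ v2 ∧ e = s(v, x) then 1 else 0)
                        + (if u ≠ v1 ∧ u ≠ v2 ∧ e = s(u, y) then 1 else 0)) ∧
  (treeTotalMarks S m = 3 →
    ((∃ a ∈ S, ∃ b ∈ S, ∃ c ∈ S, a ≠ b ∧ a ≠ c ∧ b ≠ c ∧ m a = 1 ∧ m b = 1 ∧ m c = 1 ∧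
        ¬OnPathBetween E b c a ∧ ¬OnPathBetween E a c b ∧ ¬OnPathBetween E a b c ∧
        ∃ xa xb xc, PathFirstEdge E a b xa ∧ PathFirstEdge E b a xb ∧
          PathFirstEdge E c a xc ∧
          ∀ e ∈ E, w e = 1 + (if a ≠ v1 ∧ a ≠ v2 ∧ e = s(a, xa) then 1 else 0)
                          + (if b ≠ v1 ∧ b ≠ v2 ∧ e = s(b, xb) then 1 else 0)
                          + (if c ≠ v1 ∧ c ≠ v2 ∧ e = s(c, xc) then 1 else 0)) ∨
      (∃ v ∈ S, ∃ wv ∈ S, ∃ z ∈ S, v ≠ wv ∧ v ≠ z ∧ 1 ≤ m v ∧ 1 ≤ m wv ∧ 1 ≤ m z ∧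
        OnPathBetween E v wv z ∧ (z = wv → m wv = 2) ∧
        (z ≠ wv → m v = 1 ∧ m wv = 1 ∧ m z = 1) ∧
        vType B0 v0 v1 v2 v < vType B0 v0 v1 v2 wv ∧
        ∃ xv xw xz yz, PathFirstEdge E v wv xv ∧ PathFirstEdge E wv v xw ∧
          SandwichEdge B0 v0 v1 v2 E z v wv xz yz ∧
          ∀ e ∈ E, w e = 1 + (if v ≠ v1 ∧ v ≠ v2 ∧ e = s(v, xv) then 1 else 0)
                          + (if wv ≠ v1 ∧ wv ≠ v2 ∧ e = s(wv, xw) then 1 else 0)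
                          + (if e = s(xz, yz) then 1 else 0))))

/-- The vertex set of the component of `u` in the forest with edge set `E`. -/
def compVerts (E : Set (Sym2 V)) (u : V) : Set V :=
  {x | (SimpleGraph.fromEdgeSet E).Reachable u x}

/-- The edge set of the component of `u` in the forest with edge set `E`. -/
def compEdges (E : Set (Sym2 V)) (u : V) : Set (Sym2 V) :=
  {e | e ∈ E ∧ ∀ x ∈ e, (SimpleGraph.fromEdgeSet E).Reachable u x}

/-- `w` is the weighting `φ₂(E, m)` of the marked forest `(E, m)`, obtained by applying
the empowerment algorithm to every component. -/
def IsPhi2Forest (B0 : Set (Sym2 V)) (v0 v1 v2 : V)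
    (E : Set (Sym2 V)) (m : V → ℕ) (w : Sym2 V → ℕ) : Prop :=
  ∀ u, u ≠ v0 → IsPhi2 B0 v0 v1 v2 (compVerts E u) (compEdges E u)
      (fun v => if v ∈ compVerts E u then m v else 0) w

/-- `(h_0, …, h_r)` is a pure O-sequence. -/
def IsPureOSeq (r : ℕ) (h : ℕ → ℕ) : Prop :=
  ∃ (σ : Type) (_ : Finite σ) (X : Set (σ →₀ ℕ)),
    X.Finite ∧
    (∀ μ ∈ X, ∀ ν : σ →₀ ℕ, ν ≤ μ → ν ∈ X) ∧
    (∀ μ ∈ X, ∀ ν ∈ X, (∀ ρ ∈ X, μ ≤ ρ → ρ = μ) → (∀ ρ ∈ X, ν ≤ ρ → ρ = ν) →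
        μ.sum (fun _ n => n) = ν.sum (fun _ n => n)) ∧
    (∀ i, {μ ∈ X | μ.sum (fun _ n => n) = i}.ncard = if i ≤ r then h i else 0)

namespace TC
section toolkit
variable {W : Type} {Γ Γ' : SimpleGraph W}

/-- next vertex on the way from `u` to `v` -/
noncomputable def nx (Γ : SimpleGraph W) (u v : W) : W :=
  if h : ∃ n, Γ.Adj u n ∧ Γ.dist n v + 1 = Γ.dist u v then h.choose else u

/-- first edge of the path from `u` to `v` -/
noncomputable def fe (Γ : SimpleGraph W) (u v : W) : Sym2 W := s(u, nx Γ u v)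

theorem nx_spec {u v : W} (h : Γ.Reachable u v) (hne : u ≠ v) :
    Γ.Adj u (nx Γ u v) ∧ Γ.dist (nx Γ u v) v + 1 = Γ.dist u v := by
  have hex : ∃ n, Γ.Adj u n ∧ Γ.dist n v + 1 = Γ.dist u v := by
    obtain ⟨p, hp⟩ := h.exists_walk_length_eq_dist
    cases p with
    | nil => exact absurd rfl hne
    | cons hadj q =>
      rename_i n
      refine ⟨n, hadj, ?_⟩
      have h1 := Γ.dist_le q
      have h2 := (hadj.reachable).dist_triangle_left v
      have h3 : Γ.dist u n = 1 := SimpleGraph.dist_eq_one_iff_adj.2 hadj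
      simp at hp
      omega
  unfold nx
  rw [dif_pos hex]
  exact hex.choose_spec

theorem nx_adj {u v : W} (h : Γ.Reachable u v) (hne : u ≠ v) : Γ.Adj u (nx Γ u v) :=
  (nx_spec h hne).1

theorem nx_dist {u v : W} (h : Γ.Reachable u v) (hne : u ≠ v) :
    Γ.dist (nx Γ u v) v + 1 = Γ.dist u v := (nx_spec h hne).2

theorem nx_reach {u v : W} (h : Γ.Reachable u v) : Γ.Reachable u (nx Γ u v) := by
  by_cases hne : u = v
  · subst hne
    unfold nx
    split_ifs with h1
    · exact h1.choose_spec.1.reachable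
    · exact SimpleGraph.Reachable.refl _
  · exact (nx_adj h hne).reachable

theorem nx_reach' {u v : W} (h : Γ.Reachable u v) : Γ.Reachable (nx Γ u v) v :=
  (nx_reach h).symm.trans h

theorem adj_dist (hΓ : Γ.IsAcyclic) {x y r : W} (h : Γ.Adj x y) (hr : Γ.Reachable x r) :
    Γ.dist x r = Γ.dist y r + 1 ∨ Γ.dist y r = Γ.dist x r + 1 := by
  have := hΓ.dist_eq_dist_add_one_of_adj_of_reachable r h hr.symm
  rwa [Γ.dist_comm, Γ.dist_comm (u := r)] at this

theorem nx_unique (hΓ : Γ.IsAcyclic) {u v n : W} (hr : Γ.Reachable u v) (h : Γ.Adj u n)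
    (hd : Γ.dist n v + 1 = Γ.dist u v) : n = nx Γ u v := by
  have hne : u ≠ v := by rintro rfl; simp at hd
  obtain ⟨h1, h2⟩ := nx_spec hr hne
  have key : ∀ m, Γ.Adj u m → Γ.dist m v + 1 = Γ.dist u v →
      ∃ p : Γ.Walk u v, p.IsPath ∧ p.snd = m := by
    intro m hm hmd
    obtain ⟨q, hq⟩ := (hm.symm.reachable.trans hr).exists_walk_length_eq_dist
    refine ⟨SimpleGraph.Walk.cons hm q, ?_, by simp⟩
    apply SimpleGraph.Walk.isPath_of_length_eq_dist
    simp; omega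
  obtain ⟨p, hp, rfl⟩ := key n h hd
  obtain ⟨q, hq, hq'⟩ := key _ h1 h2
  rw [← hq']
  have := (hΓ.subsingleton_path u v).elim ⟨p, hp⟩ ⟨q, hq⟩
  rw [Subtype.mk.injEq] at this
  rw [this]

theorem dist_tri {a b c : W} (h : Γ.Reachable a b) :
    Γ.dist a c ≤ Γ.dist a b + Γ.dist b c := h.dist_triangle_left c

theorem dist_pos {a b : W} (h : Γ.Reachable a b) (hne : a ≠ b) : 0 < Γ.dist a b :=
  h.pos_dist_of_ne hne

theorem dist_adj {a b : W} (h : Γ.Adj a b) : Γ.dist a b = 1 :=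
  SimpleGraph.dist_eq_one_iff_adj.2 h

/-- `p` is on the path from `u` to `v` -/
def Btw (Γ : SimpleGraph W) (u p v : W) : Prop :=
  Γ.Reachable u p ∧ Γ.Reachable p v ∧ Γ.dist u p + Γ.dist p v = Γ.dist u v

theorem Btw.reach {u p v : W} (h : Btw Γ u p v) : Γ.Reachable u v := h.1.trans h.2.1

theorem Btw.symm {u p v : W} (h : Btw Γ u p v) : Btw Γ v p u := by
  refine ⟨h.2.1.symm, h.1.symm, ?_⟩
  have h1 := Γ.dist_comm (u := v) (v := p)
  have h2 := Γ.dist_comm (u := p) (v := u)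
  have h3 := Γ.dist_comm (u := v) (v := u)
  have := h.2.2; omega

theorem btw_comm {u p v : W} : Btw Γ u p v ↔ Btw Γ v p u := ⟨Btw.symm, Btw.symm⟩

theorem btw_left {u v : W} (h : Γ.Reachable u v) : Btw Γ u u v :=
  ⟨SimpleGraph.Reachable.refl _, h, by simp⟩

theorem btw_right {u v : W} (h : Γ.Reachable u v) : Btw Γ u v v :=
  ⟨h, SimpleGraph.Reachable.refl _, by simp⟩

theorem Btw.ne {u p v : W} (h : Btw Γ u p v) (hp : p ≠ u) : u ≠ v := by
  rintro rfl
  have := h.2.2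
  have h1 := dist_pos h.1 hp.symm
  rw [SimpleGraph.dist_self] at this; omega

theorem btw_self {u p : W} : Btw Γ u p u ↔ p = u := by
  constructor
  · intro h; by_contra hp; exact h.ne hp rfl
  · rintro rfl; exact btw_left (SimpleGraph.Reachable.refl _)

theorem Btw.antisymm {u p v : W} (h : Btw Γ u p v) (h' : Btw Γ p u v) : p = u := by
  by_contra hne
  have h1 := h.2.2; have h2 := h'.2.2
  have := dist_pos h'.1 hne
  have := Γ.dist_comm (u := u) (v := p)
  omega

theorem nx_prefix (hΓ : Γ.IsAcyclic) {u p v : W} (h : Btw Γ u p v) (hp : p ≠ u) :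
    nx Γ u p = nx Γ u v := by
  obtain ⟨h1, h2⟩ := nx_spec h.1 hp.symm
  apply nx_unique hΓ h.reach h1
  have h3 := dist_tri (c := v) (h1.symm.reachable.trans h.1)
  have h4 := h.2.2
  rcases adj_dist hΓ h1 h.reach with h5 | h5 <;> omega

theorem btw_nx (hΓ : Γ.IsAcyclic) {u p v : W} (h : Btw Γ u p v) (hp : p ≠ u) :
    Btw Γ (nx Γ u v) p v := by
  have e := nx_prefix hΓ h hp
  have h1 := nx_dist h.1 hp.symm
  have h2 := nx_dist h.reach (h.ne hp)
  rw [e] at h1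
  refine ⟨(nx_reach h.reach).symm.trans h.1, h.2.1, ?_⟩
  have := h.2.2; omega

theorem btw_of_nx {u p v : W} (hr : Γ.Reachable u v) (hne : u ≠ v)
    (h : Btw Γ (nx Γ u v) p v) : Btw Γ u p v ∧ Γ.dist u p = Γ.dist (nx Γ u v) p + 1 := by
  have h0 := nx_adj hr hne
  have h1 := nx_dist hr hne
  have h2 := h.2.2
  have h3 : Γ.Reachable u p := h0.reachable.trans h.1
  have h4 := dist_tri (c := p) h0.reachable
  have h5 := dist_tri (c := v) h3
  rw [dist_adj h0] at h4
  refine ⟨⟨h3, h.2.1, ?_⟩, ?_⟩ <;> omega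

theorem btw_nx_self {u v : W} (h : Γ.Reachable u v) (hne : u ≠ v) : Btw Γ u (nx Γ u v) v :=
  (btw_of_nx h hne (btw_left (nx_reach' h))).1

theorem nx_ne {u v : W} (h : Γ.Reachable u v) (hne : u ≠ v) : nx Γ u v ≠ u :=
  (nx_adj h hne).ne'

theorem nx_of_adj (hΓ : Γ.IsAcyclic) {u v : W} (h : Γ.Adj u v) : nx Γ u v = v :=
  (nx_unique hΓ h.reachable h (by simp [dist_adj h])).symm

theorem nx_nx (hΓ : Γ.IsAcyclic) {u v : W} (h : Γ.Reachable u v) (hne : u ≠ v) :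
    nx Γ (nx Γ u v) u = u := nx_of_adj hΓ (nx_adj h hne).symm

theorem btw_of_nx_ne (hΓ : Γ.IsAcyclic) {a x b : W} (ha : Γ.Reachable x a) (hb : Γ.Reachable x b)
    (hxa : x ≠ a) (hxb : x ≠ b) (h : nx Γ x a ≠ nx Γ x b) : Btw Γ a x b := by
  suffices H : ∀ k x, Γ.dist x a = k → Γ.Reachable x a → Γ.Reachable x b → x ≠ a → x ≠ b →
      nx Γ x a ≠ nx Γ x b → Γ.dist x a + Γ.dist x b = Γ.dist a b by
    refine ⟨ha.symm, hb, ?_⟩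
    rw [Γ.dist_comm (u := a) (v := x)]
    exact H _ x rfl ha hb hxa hxb h
  intro k
  induction k with
  | zero =>
    intro x hk ha hb hxa
    exact absurd ((ha.dist_eq_zero_iff).1 hk) hxa
  | succ k ih =>
    intro x hk ha hb hxa hxb h
    obtain ⟨h1, h2⟩ := nx_spec ha hxa
    set n := nx Γ x a with hn
    have h3 : Γ.dist n b = Γ.dist x b + 1 := by
      rcases adj_dist hΓ h1 hb with h5 | h5
      · exact absurd (nx_unique hΓ hb h1 h5.symm) h
      · exact h5
    by_cases hna : n = a
    · rw [hna] at h2 h3; simp at h2; omega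
    have hnb : Γ.Reachable n b := h1.symm.reachable.trans hb
    have hnb' : n ≠ b := by rintro h; rw [h] at h3; simp at h3
    have h4 : nx Γ n b = x := (nx_unique hΓ hnb h1.symm h3.symm).symm
    have h5 := nx_dist (nx_reach' ha) hna
    have := ih n (by omega) (nx_reach' ha) hnb hna hnb' (by
      rw [h4]; intro h6; rw [← hn, h6] at h5; omega)
    omega

theorem nx_ne_of_btw {a x b : W} (h : Btw Γ a x b) (hxa : x ≠ a) (hxb : x ≠ b) :
    nx Γ x a ≠ nx Γ x b := by
  intro e
  have h1 := nx_dist h.1.symm hxa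
  have h2 := nx_dist h.2.1 hxb
  rw [← e] at h2
  have h3 := dist_tri (c := b) (h.1.trans (nx_reach h.1.symm))
  have h4 := h.2.2
  rw [Γ.dist_comm (u := a) (v := x), ] at h4
  rw [Γ.dist_comm (u := a) (v := nx Γ x a)] at h3
  omega

theorem btw_or_nx_eq (hΓ : Γ.IsAcyclic) {a x b : W} (ha : Γ.Reachable x a) (hb : Γ.Reachable x b)
    (hxa : x ≠ a) (hxb : x ≠ b) : Btw Γ a x b ∨ nx Γ x a = nx Γ x b := by
  by_cases h : nx Γ x a = nx Γ x b
  · exact Or.inr h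
  · exact Or.inl (btw_of_nx_ne hΓ ha hb hxa hxb h)

theorem adj_cases (hΓ : Γ.IsAcyclic) {x y r : W} (h : Γ.Adj x y) (hr : Γ.Reachable x r) :
    (x ≠ r ∧ y = nx Γ x r) ∨ (y ≠ r ∧ x = nx Γ y r) := by
  rcases adj_dist hΓ h hr with h5 | h5
  · left; refine ⟨?_, nx_unique hΓ hr h h5.symm⟩
    rintro rfl; simp at h5
  · right; refine ⟨?_, nx_unique hΓ (h.symm.reachable.trans hr) h.symm h5.symm⟩
    rintro rfl; simp at h5

/-- one step further along a path -/
theorem btw_step (hΓ : Γ.IsAcyclic) {v p r : W} (h : Btw Γ v p r) (hp : p ≠ r) :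
    Btw Γ v (nx Γ p r) r ∧ nx Γ (nx Γ p r) v = p ∧ nx Γ p r ≠ v ∧ Btw Γ v p (nx Γ p r) := by
  obtain ⟨h1, h2⟩ := nx_spec h.2.1 hp
  have hr : Γ.Reachable v (nx Γ p r) := h.1.trans h1.reachable
  have h3 := dist_tri (c := r) hr
  have h4 := h.2.2
  have h5 := dist_tri (c := nx Γ p r) h.1
  rw [dist_adj h1] at h5
  have h6 : nx Γ p r ≠ v := by
    intro h; rw [h] at h3 h2; simp at h3; omega
  refine ⟨⟨hr, nx_reach' h.2.1, by omega⟩, ?_, h6, ⟨h.1, h1.reachable, ?_⟩⟩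
  · refine (nx_unique hΓ hr.symm h1.symm ?_).symm
    rw [Γ.dist_comm (u := p), Γ.dist_comm (u := nx Γ p r)]; omega
  · rw [dist_adj h1]; omega

theorem Btw.trans_left {u p q v : W} (h : Btw Γ u p v) (h' : Btw Γ u q p) : Btw Γ u q v := by
  have h1 := h.2.2; have h2 := h'.2.2
  have h3 := dist_tri (c := v) h'.2.1
  have h4 := dist_tri (c := v) h'.1
  exact ⟨h'.1, h'.2.1.trans h.2.1, by omega⟩

theorem Btw.trans_right' {u p q v : W} (h : Btw Γ u p v) (h' : Btw Γ u q p) : Btw Γ q p v := by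
  have h1 := h.2.2; have h2 := h'.2.2
  have h3 := dist_tri (c := v) h'.2.1
  have h4 := dist_tri (c := v) h'.1
  exact ⟨h'.2.1, h.2.1, by omega⟩

/-! locality -/
theorem dist_local (hΓ : Γ.IsAcyclic) (hle : Γ' ≤ Γ) {u v : W} (h : Γ'.Reachable u v) :
    Γ'.dist u v = Γ.dist u v := by
  obtain ⟨p, hp, hl⟩ := h.exists_path_of_dist
  obtain ⟨q, hq, hl'⟩ := (h.mono hle).exists_path_of_dist
  have := (hΓ.subsingleton_path u v).elim ⟨p.mapLe hle, hp.mapLe hle⟩ ⟨q, hq⟩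
  rw [Subtype.mk.injEq] at this
  rw [← hl, ← hl', ← this]; simp

theorem nx_local (hΓ : Γ.IsAcyclic) (hle : Γ' ≤ Γ) {u v : W} (h : Γ'.Reachable u v) (hne : u ≠ v) :
    nx Γ' u v = nx Γ u v := by
  obtain ⟨h1, h2⟩ := nx_spec h hne
  apply nx_unique hΓ (h.mono hle) (hle h1)
  rw [← dist_local hΓ hle h, ← dist_local hΓ hle (nx_reach' h)]; exact h2

theorem fe_local (hΓ : Γ.IsAcyclic) (hle : Γ' ≤ Γ) {u v : W} (h : Γ'.Reachable u v) (hne : u ≠ v) :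
    fe Γ' u v = fe Γ u v := by
  unfold fe; rw [nx_local hΓ hle h hne]

theorem btw_reach_local (hΓ : Γ.IsAcyclic) (hle : Γ' ≤ Γ) {u p v : W} (h : Γ'.Reachable u v)
    (hb : Btw Γ u p v) : Γ'.Reachable u p := by
  suffices H : ∀ k u, Γ.dist u p = k → Γ'.Reachable u v → Btw Γ u p v → Γ'.Reachable u p from
    H _ u rfl h hb
  intro k
  induction k with
  | zero =>
    intro u hk h hb
    rw [(hb.1.dist_eq_zero_iff).1 hk]
  | succ k ih =>
    intro u hk h hb
    have hpu : p ≠ u := by rintro rfl; simp at hk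
    have e := nx_local hΓ hle h (hb.ne hpu)
    have h1 := btw_nx hΓ hb hpu
    have h2 := btw_of_nx hb.reach (hb.ne hpu) h1
    rw [← e] at h1 h2
    exact (nx_reach h).trans (ih _ (by omega) (nx_reach' h) h1)

theorem btw_local (hΓ : Γ.IsAcyclic) (hle : Γ' ≤ Γ) {u p v : W} (h : Γ'.Reachable u v) :
    Btw Γ' u p v ↔ Btw Γ u p v := by
  constructor
  · intro hb
    refine ⟨hb.1.mono hle, hb.2.1.mono hle, ?_⟩
    rw [← dist_local hΓ hle hb.1, ← dist_local hΓ hle hb.2.1, ← dist_local hΓ hle h]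
    exact hb.2.2
  · intro hb
    have h1 := btw_reach_local hΓ hle h hb
    have h2 := h1.symm.trans h
    refine ⟨h1, h2, ?_⟩
    rw [dist_local hΓ hle h1, dist_local hΓ hle h2, dist_local hΓ hle h]
    exact hb.2.2

end toolkit
end TC

namespace TC
section objects
variable {W : Type} {Γ Γ' : SimpleGraph W} {ty : W → Fin 3}

/-- auxiliary for `lab` -/
noncomputable def labF (Γ : SimpleGraph W) (ty : W → Fin 3) (c : Fin 3) (r : W) : ℕ → W → Fin 3
  | 0, _ => 0
  | n + 1, q => if ty q ≠ c then ty q else labF Γ ty c r n (nx Γ q r)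

/-- type of the first vertex of type not `c` on the path from `q` to `r` (excluding `r`) -/
noncomputable def lab (Γ : SimpleGraph W) (ty : W → Fin 3) (c : Fin 3) (r q : W) : Fin 3 :=
  labF Γ ty c r (Γ.dist q r) q

theorem lab_self (c : Fin 3) (r : W) : lab Γ ty c r r = 0 := by
  simp [lab, labF]

theorem lab_step (c : Fin 3) {r q : W} (h : Γ.Reachable q r) (hne : q ≠ r) :
    lab Γ ty c r q = if ty q ≠ c then ty q else lab Γ ty c r (nx Γ q r) := by
  unfold lab
  rw [← nx_dist h hne, labF]

theorem lab_of_ne {c : Fin 3} {r q : W} (h : Γ.Reachable q r) (hne : q ≠ r) (hc : ty q ≠ c) :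
    lab Γ ty c r q = ty q := by
  rw [lab_step c h hne, if_pos hc]

theorem lab_local (hΓ : Γ.IsAcyclic) (hle : Γ' ≤ Γ) (c : Fin 3) {r q : W}
    (h : Γ'.Reachable q r) : lab Γ' ty c r q = lab Γ ty c r q := by
  suffices H : ∀ k q, Γ'.dist q r = k → Γ'.Reachable q r →
      lab Γ' ty c r q = lab Γ ty c r q from H _ q rfl h
  intro k
  induction k with
  | zero =>
    intro q hk h
    rw [(h.dist_eq_zero_iff).1 hk, lab_self, lab_self]
  | succ k ih =>
    intro q hk h
    have hne : q ≠ r := by rintro rfl; simp at hk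
    rw [lab_step c h hne, lab_step c (h.mono hle) hne, ← nx_local hΓ hle h hne]
    have := nx_dist h hne
    rw [ih _ (by omega) (nx_reach' h)]

theorem lab_mem (c : Fin 3) {r q : W} (h : Γ.Reachable q r) :
    lab Γ ty c r q = 0 ∨ ∃ x, Btw Γ q x r ∧ x ≠ r ∧ ty x = lab Γ ty c r q := by
  suffices H : ∀ k q, Γ.dist q r = k → Γ.Reachable q r →
      (lab Γ ty c r q = 0 ∨ ∃ x, Btw Γ q x r ∧ x ≠ r ∧ ty x = lab Γ ty c r q) from H _ q rfl h
  intro k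
  induction k with
  | zero =>
    intro q hk h
    rw [(h.dist_eq_zero_iff).1 hk, lab_self]; simp
  | succ k ih =>
    intro q hk h
    have hne : q ≠ r := by rintro rfl; simp at hk
    rw [lab_step c h hne]
    split_ifs with hc
    · exact Or.inr ⟨q, btw_left h, hne, rfl⟩
    · have := nx_dist h hne
      rcases ih _ (by omega) (nx_reach' h) with h1 | ⟨x, h1, h2, h3⟩
      · exact Or.inl h1
      · exact Or.inr ⟨x, (btw_of_nx h hne h1).1, h2, h3⟩

theorem chain_card [Fintype W] (hΓ : Γ.IsAcyclic) (P : W → Prop) [DecidablePred P] {q r : W} (h : Γ.Reachable q r)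
    (hne : q ≠ r) :
    (Finset.univ.filter fun p => Btw Γ q p r ∧ p ≠ r ∧ P p).card =
      (if P q then 1 else 0) +
      (Finset.univ.filter fun p => Btw Γ (nx Γ q r) p r ∧ p ≠ r ∧ P p).card := by
  have hq : ¬ Btw Γ (nx Γ q r) q r := by
    intro hb
    have := (btw_of_nx h hne hb).2
    simp at this
  have e : (Finset.univ.filter fun p => Btw Γ q p r ∧ p ≠ r ∧ P p) =
      (if P q then {q} else ∅) ∪
      (Finset.univ.filter fun p => Btw Γ (nx Γ q r) p r ∧ p ≠ r ∧ P p) := by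
    ext p
    simp only [Finset.mem_filter, Finset.mem_univ, true_and, Finset.mem_union]
    by_cases hp : p = q
    · subst hp
      have := btw_left h
      split_ifs <;> simp [*]
    · have h1 : Btw Γ q p r ↔ Btw Γ (nx Γ q r) p r :=
        ⟨fun hb => btw_nx hΓ hb hp, fun hb => (btw_of_nx h hne hb).1⟩
      split_ifs <;> simp [*]
  rw [e, Finset.card_union_of_disjoint]
  · split_ifs <;> simp
  · split_ifs <;> simp [hq]

theorem chain [Fintype W] (hΓ : Γ.IsAcyclic) (c τ : Fin 3) {q r : W} (h : Γ.Reachable q r) :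
    (Finset.univ.filter fun p => Btw Γ q p r ∧ p ≠ r ∧
        (ty p ≠ c ∧ lab Γ ty c r (nx Γ p r) ≠ τ)).card
      + (if lab Γ ty c r q ≠ τ then 1 else 0) =
    (Finset.univ.filter fun p => Btw Γ q p r ∧ p ≠ r ∧ (ty p ≠ c ∧ ty p ≠ τ)).card
      + (if (0 : Fin 3) ≠ τ then 1 else 0) := by
  induction hk : Γ.dist q r generalizing q with
  | zero =>
    have := (h.dist_eq_zero_iff).1 hk
    subst this
    rw [lab_self]
    congr 1
    simp only [btw_self]
    rw [Finset.filter_false_of_mem, Finset.filter_false_of_mem] <;> tauto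
  | succ k ih =>
    have hne : q ≠ r := by rintro rfl; simp at hk
    have h1 := nx_dist h hne
    have := ih (nx_reach' h) (by omega)
    rw [chain_card hΓ (fun p => ty p ≠ c ∧ lab Γ ty c r (nx Γ p r) ≠ τ) h hne,
      chain_card hΓ (fun p => ty p ≠ c ∧ ty p ≠ τ) h hne, lab_step c h hne]
    by_cases hc : ty q = c
    · simp only [hc, ne_eq, not_true, false_and, if_false]
      simp only [ne_eq] at this
      omega
    · simp only [hc, ne_eq, not_false_eq_true, true_and, if_true]
      simp only [ne_eq] at this
      omega

/-- indicator of an edge -/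
noncomputable def dl (e : Sym2 W) : Sym2 W → ℕ := fun x => if x = e then 1 else 0

noncomputable def m2 (Γ : SimpleGraph W) (u v : W) : Sym2 W → ℕ := dl (fe Γ u v) + dl (fe Γ v u)
noncomputable def m3 (Γ : SimpleGraph W) (r v p : W) : Sym2 W → ℕ := m2 Γ r v + dl (fe Γ p r)

theorem dl_inj {e f : Sym2 W} (h : dl e = dl f) : e = f := by
  have := congrFun h e
  simp only [dl] at this
  split_ifs at this <;> simp_all

theorem m2_comm (u v : W) : m2 Γ u v = m2 Γ v u := add_comm _ _

def Comp3 (Γ : SimpleGraph W) (ty : W → Fin 3) (r v p : W) : Prop :=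
  ty v < ty r ∧ Btw Γ v p r ∧ p ≠ r ∧ ty p ≠ ty r ∧ lab Γ ty (ty r) r (nx Γ p r) ≠ ty v

def Inc3 (Γ : SimpleGraph W) (ty : W → Fin 3) (r v p : W) : Prop :=
  ty r = 2 ∧ ty v = 0 ∧ ty p = 1 ∧ Γ.Reachable v r ∧ Γ.Reachable p r ∧
    ¬ Btw Γ v p r ∧ ¬ Btw Γ p v r ∧ ¬ Btw Γ v r p

def Idx3 (Γ : SimpleGraph W) (ty : W → Fin 3) (r v p : W) : Prop :=
  Comp3 Γ ty r v p ∨ Inc3 Γ ty r v p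

def Tip (Γ : SimpleGraph W) (ty : W → Fin 3) (r v p x : W) : Prop :=
  x = r ∨ x = v ∨ (Inc3 Γ ty r v p ∧ x = p)

theorem Idx3.reach {r v p : W} (h : Idx3 Γ ty r v p) : Γ.Reachable v r ∧ Γ.Reachable p r := by
  rcases h with h | h
  · exact ⟨h.2.1.reach, h.2.1.2.1⟩
  · exact ⟨h.2.2.2.1, h.2.2.2.2.1⟩

theorem Idx3.ty_lt {r v p : W} (h : Idx3 Γ ty r v p) : ty v < ty r := by
  rcases h with h | h
  · exact h.1
  · rw [h.1, h.2.1]; decide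

theorem Idx3.ty_ne {r v p : W} (h : Idx3 Γ ty r v p) : ty p ≠ ty r := by
  rcases h with h | h
  · exact h.2.2.2.1
  · rw [h.1, h.2.2.1]; decide

theorem Idx3.pne {r v p : W} (h : Idx3 Γ ty r v p) : p ≠ r := by
  intro e; exact h.ty_ne (by rw [e])

theorem Idx3.vne {r v p : W} (h : Idx3 Γ ty r v p) : v ≠ r := by
  rintro rfl; exact absurd h.ty_lt (lt_irrefl _)

/-! first edges -/
theorem fe_mem {u v : W} (h : Γ.Reachable u v) (hne : u ≠ v) : fe Γ u v ∈ Γ.edgeSet :=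
  nx_adj h hne

theorem fe_inj (_hΓ : Γ.IsAcyclic) {u w r : W} (hu : Γ.Reachable u r) (hw : Γ.Reachable w r)
    (hur : u ≠ r) (hwr : w ≠ r) (h : fe Γ u r = fe Γ w r) : u = w := by
  unfold fe at h
  rw [Sym2.eq_iff] at h
  rcases h with h | ⟨h1, h2⟩
  · exact h.1
  · have h3 := nx_dist hu hur
    have h4 := nx_dist hw hwr
    rw [← h1] at h4; rw [h2] at h3; omega

theorem fe_surj (hΓ : Γ.IsAcyclic) {x y r : W} (h : Γ.Adj x y) (hr : Γ.Reachable x r) :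
    ∃ u, u ≠ r ∧ Γ.Reachable u r ∧ fe Γ u r = s(x, y) := by
  rcases adj_cases hΓ h hr with ⟨h1, h2⟩ | ⟨h1, h2⟩
  · exact ⟨x, h1, hr, by rw [fe, ← h2]⟩
  · exact ⟨y, h1, h.symm.reachable.trans hr, by rw [fe, ← h2, Sym2.eq_swap]⟩

theorem fe_btw {u v z : W} (h : Γ.Reachable u v) (hne : u ≠ v) (hz : z ∈ fe Γ u v) :
    Btw Γ u z v := by
  rw [fe, Sym2.mem_iff] at hz
  rcases hz with rfl | rfl
  · exact btw_left h
  · exact btw_nx_self h hne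

theorem fe_btw' (hΓ : Γ.IsAcyclic) {v p r z : W} (h : Btw Γ v p r) (hne : p ≠ r)
    (hz : z ∈ fe Γ p r) : Btw Γ v z r := by
  rw [fe, Sym2.mem_iff] at hz
  rcases hz with rfl | rfl
  · exact h
  · exact (btw_step hΓ h hne).1

/-- extremal vertices -/
def End (Γ : SimpleGraph W) (m : Sym2 W → ℕ) (x : W) : Prop :=
  (∃ e, m e ≠ 0 ∧ x ∈ e) ∧ ∃ y, ∀ e, m e ≠ 0 → ∀ z ∈ e, z ≠ x → nx Γ x z = y

theorem end_path (hΓ : Γ.IsAcyclic) {m : Sym2 W → ℕ} {u v : W}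
    (hm : ∀ e, m e ≠ 0 → ∀ z ∈ e, Btw Γ u z v) (h1 : m (fe Γ u v) ≠ 0) (h2 : m (fe Γ v u) ≠ 0)
    (x : W) : End Γ m x ↔ x = u ∨ x = v := by
  have hu : u ∈ fe Γ u v := by simp [fe]
  have hv : v ∈ fe Γ v u := by simp [fe]
  constructor
  · rintro ⟨⟨e, he, hx⟩, y, hy⟩
    by_contra hne
    push Not at hne
    have := nx_ne_of_btw (hm e he x hx) hne.1 hne.2
    rw [hy _ h1 u hu hne.1.symm, hy _ h2 v hv hne.2.symm] at this
    exact this rfl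
  · rintro (rfl | rfl)
    · exact ⟨⟨_, h1, hu⟩, nx Γ x v, fun e he z hz hzx => nx_prefix hΓ (hm e he z hz) hzx⟩
    · exact ⟨⟨_, h2, hv⟩, nx Γ x u, fun e he z hz hzx => nx_prefix hΓ (hm e he z hz).symm hzx⟩

theorem m2_ne {u v : W} {e : Sym2 W} : m2 Γ u v e ≠ 0 ↔ e = fe Γ u v ∨ e = fe Γ v u := by
  simp only [m2, dl, Pi.add_apply]; split_ifs <;> simp_all

theorem m3_ne {r v p : W} {e : Sym2 W} :
    m3 Γ r v p e ≠ 0 ↔ e = fe Γ r v ∨ e = fe Γ v r ∨ e = fe Γ p r := by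
  simp only [m3, m2, dl, Pi.add_apply]; split_ifs <;> simp_all

theorem end_m2 (hΓ : Γ.IsAcyclic) {u v : W} (h : Γ.Reachable u v) (hne : u ≠ v) (x : W) :
    End Γ (m2 Γ u v) x ↔ x = u ∨ x = v := by
  apply end_path hΓ
  · intro e he z hz
    rcases m2_ne.1 he with rfl | rfl
    · exact fe_btw h hne hz
    · exact (fe_btw h.symm hne.symm hz).symm
  · exact m2_ne.2 (Or.inl rfl)
  · exact m2_ne.2 (Or.inr rfl)

theorem end_comp (hΓ : Γ.IsAcyclic) {r v p : W} (h : Comp3 Γ ty r v p) (x : W) :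
    End Γ (m3 Γ r v p) x ↔ x = r ∨ x = v := by
  have hv := Idx3.vne (Or.inl h)
  have hr := (Idx3.reach (Or.inl h)).1
  apply end_path hΓ
  · intro e he z hz
    rcases m3_ne.1 he with rfl | rfl | rfl
    · exact fe_btw hr.symm hv.symm hz
    · exact (fe_btw hr hv hz).symm
    · exact (fe_btw' hΓ h.2.1 h.2.2.1 hz).symm
  · exact m3_ne.2 (Or.inl rfl)
  · exact m3_ne.2 (Or.inr (Or.inl rfl))

theorem Inc3.nxs (hΓ : Γ.IsAcyclic) {r v p : W} (h : Inc3 Γ ty r v p) :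
    nx Γ r v = nx Γ r p ∧ nx Γ v r = nx Γ v p ∧ nx Γ p r = nx Γ p v ∧ v ≠ r ∧ p ≠ r ∧ v ≠ p := by
  obtain ⟨t1, t2, t3, r1, r2, n1, n2, n3⟩ := h
  have d1 : v ≠ r := by rintro rfl; rw [t1] at t2; exact absurd t2 (by decide)
  have d2 : p ≠ r := by rintro rfl; rw [t1] at t3; exact absurd t3 (by decide)
  have d3 : v ≠ p := by rintro rfl; rw [t2] at t3; exact absurd t3 (by decide)
  refine ⟨?_, ?_, ?_, d1, d2, d3⟩
  · exact (btw_or_nx_eq hΓ r1.symm r2.symm d1.symm d2.symm).resolve_left n3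
  · exact (btw_or_nx_eq hΓ r1 (r1.trans r2.symm) d1 d3).resolve_left fun hb => n2 hb.symm
  · exact (btw_or_nx_eq hΓ r2 (r2.trans r1.symm) d2 d3.symm).resolve_left fun hb => n1 hb.symm

theorem end_inc (hΓ : Γ.IsAcyclic) {r v p : W} (h : Inc3 Γ ty r v p) (x : W) :
    End Γ (m3 Γ r v p) x ↔ x = r ∨ x = v ∨ x = p := by
  obtain ⟨e1, e2, e3, d1, d2, d3⟩ := h.nxs hΓ
  obtain ⟨t1, t2, t3, r1, r2, n1, n2, n3⟩ := h
  have m1 : m3 Γ r v p (fe Γ r v) ≠ 0 := m3_ne.2 (by simp)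
  have mm2 : m3 Γ r v p (fe Γ v r) ≠ 0 := m3_ne.2 (by simp)
  have mm3 : m3 Γ r v p (fe Γ p r) ≠ 0 := m3_ne.2 (by simp)
  have s1 : r ∈ fe Γ r v := by simp [fe]
  have s2 : v ∈ fe Γ v r := by simp [fe]
  have s3 : p ∈ fe Γ p r := by simp [fe]
  have e1' : fe Γ r p = fe Γ r v := by rw [fe, ← e1, fe]
  have e2' : fe Γ v p = fe Γ v r := by rw [fe, ← e2, fe]
  have e3' : fe Γ p v = fe Γ p r := by rw [fe, ← e3, fe]
  constructor
  · rintro ⟨⟨e, he, hx⟩, y, hy⟩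
    by_contra hne
    push Not at hne
    obtain ⟨x1, x2, x3⟩ := hne
    rcases m3_ne.1 he with rfl | rfl | rfl
    · have := nx_ne_of_btw (fe_btw r1.symm d1.symm hx) x1 x2
      rw [hy _ m1 r s1 x1.symm, hy _ mm2 v s2 x2.symm] at this
      exact this rfl
    · have := nx_ne_of_btw (fe_btw r1 d1 hx) x2 x1
      rw [hy _ m1 r s1 x1.symm, hy _ mm2 v s2 x2.symm] at this
      exact this rfl
    · have := nx_ne_of_btw (fe_btw r2 d2 hx) x3 x1
      rw [hy _ m1 r s1 x1.symm, hy _ mm3 p s3 x3.symm] at this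
      exact this rfl
  · rintro (rfl | rfl | rfl)
    · refine ⟨⟨_, m1, s1⟩, nx Γ x v, fun e he z hz hzx => ?_⟩
      rcases m3_ne.1 he with rfl | rfl | rfl
      · exact nx_prefix hΓ (fe_btw r1.symm d1.symm hz) hzx
      · exact nx_prefix hΓ (fe_btw r1 d1 hz).symm hzx
      · rw [e1]; exact nx_prefix hΓ (fe_btw r2 d2 hz).symm hzx
    · refine ⟨⟨_, mm2, s2⟩, nx Γ x r, fun e he z hz hzx => ?_⟩
      rcases m3_ne.1 he with rfl | rfl | rfl
      · exact nx_prefix hΓ (fe_btw r1.symm d1.symm hz).symm hzx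
      · exact nx_prefix hΓ (fe_btw r1 d1 hz) hzx
      · rw [e2]; rw [← e3'] at hz
        exact nx_prefix hΓ (fe_btw (r2.trans r1.symm) d3.symm hz).symm hzx
    · refine ⟨⟨_, mm3, s3⟩, nx Γ x r, fun e he z hz hzx => ?_⟩
      rcases m3_ne.1 he with rfl | rfl | rfl
      · rw [← e1'] at hz
        exact nx_prefix hΓ (fe_btw r2.symm d2.symm hz).symm hzx
      · rw [← e2'] at hz; rw [e3]
        exact nx_prefix hΓ (fe_btw (r1.trans r2.symm) d3 hz).symm hzx
      · exact nx_prefix hΓ (fe_btw r2 d2 hz) hzx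

theorem m2_inj (hΓ : Γ.IsAcyclic) {u v u' v' : W} (h : Γ.Reachable u v) (h' : Γ.Reachable u' v')
    (ht : ty u < ty v) (ht' : ty u' < ty v') (e : m2 Γ u v = m2 Γ u' v') : u = u' ∧ v = v' := by
  have hne : u ≠ v := by rintro rfl; exact lt_irrefl _ ht
  have hne' : u' ≠ v' := by rintro rfl; exact lt_irrefl _ ht'
  have h1 := end_m2 hΓ h hne
  have h2 := end_m2 hΓ h' hne'
  rw [← e] at h2
  have h3 := fun x => (h1 x).symm.trans (h2 x)
  rcases (h3 u).1 (Or.inl rfl) with rfl | rfl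
  · rcases (h3 v).1 (Or.inr rfl) with rfl | rfl
    · exact absurd rfl hne
    · exact ⟨rfl, rfl⟩
  · rcases (h3 v).1 (Or.inr rfl) with rfl | rfl
    · exact absurd ht (not_lt_of_gt ht')
    · exact absurd rfl hne

theorem m3_inj (hΓ : Γ.IsAcyclic) {r v p r' v' p' : W} (h : Idx3 Γ ty r v p)
    (h' : Idx3 Γ ty r' v' p') (e : m3 Γ r v p = m3 Γ r' v' p') : r = r' ∧ v = v' ∧ p = p' := by
  have key : r = r' ∧ v = v' → r = r' ∧ v = v' ∧ p = p' := by
    rintro ⟨rfl, rfl⟩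
    refine ⟨rfl, rfl, ?_⟩
    have := add_left_cancel e
    exact fe_inj hΓ h.reach.2 h'.reach.2 h.pne h'.pne (dl_inj this)
  have l1 := h.ty_lt
  have l2 := h'.ty_lt
  rcases h with h | h <;> rcases h' with h' | h'
  · have h1 := end_comp hΓ h
    have h2 := end_comp hΓ h'
    rw [← e] at h2
    have h3 := fun x => (h1 x).symm.trans (h2 x)
    apply key
    rcases (h3 r).1 (Or.inl rfl) with rfl | rfl
    · rcases (h3 v).1 (Or.inr rfl) with rfl | rfl
      · exact absurd l1 (lt_irrefl _)
      · exact ⟨rfl, rfl⟩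
    · rcases (h3 v).1 (Or.inr rfl) with rfl | rfl
      · exact absurd l1 (not_lt_of_gt l2)
      · exact absurd l1 (lt_irrefl _)
  · exfalso
    have h1 := end_comp hΓ h
    have h2 := end_inc hΓ h'
    rw [← e] at h2
    have h3 := fun x => (h2 x).symm.trans (h1 x)
    obtain ⟨-, -, -, d1, d2, d3⟩ := h'.nxs hΓ
    have a1 := (h3 r').1 (by simp)
    have a2 := (h3 v').1 (by simp)
    have a3 := (h3 p').1 (by simp)
    grind
  · exfalso
    have h1 := end_inc hΓ h
    have h2 := end_comp hΓ h'
    rw [← e] at h2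
    have h3 := fun x => (h1 x).symm.trans (h2 x)
    obtain ⟨-, -, -, d1, d2, d3⟩ := h.nxs hΓ
    have a1 := (h3 r).1 (by simp)
    have a2 := (h3 v).1 (by simp)
    have a3 := (h3 p).1 (by simp)
    grind
  · have h1 := end_inc hΓ h
    have h2 := end_inc hΓ h'
    rw [← e] at h2
    have h3 := fun x => (h1 x).symm.trans (h2 x)
    obtain ⟨t1, t2, t3, -⟩ := h
    obtain ⟨s1, s2, s3, -⟩ := h'
    have a1 := (h3 r).1 (by simp)
    have a2 := (h3 v).1 (by simp)
    have a3 := (h3 p).1 (by simp)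
    grind

/-! leaves -/
def Leaf (Γ : SimpleGraph W) (ty : W → Fin 3) (st q : W) : Prop :=
  Γ.Adj st q ∧ (∀ x, Γ.Adj st x → x = q) ∧ ty st = ty q

theorem Leaf.btw {st q : W} (hl : Leaf Γ ty st q) {u v : W} (h : Btw Γ u st v) :
    st = u ∨ st = v := by
  by_contra hne
  push Not at hne
  apply nx_ne_of_btw h hne.1 hne.2
  rw [hl.2.1 _ (nx_adj h.1.symm hne.1), hl.2.1 _ (nx_adj h.2.1 hne.2)]

theorem Leaf.fe_eq {st q : W} (hl : Leaf Γ ty st q) {x y : W} (h : Γ.Reachable x y) (hne : x ≠ y)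
    (ht : ty x ≠ ty y) : fe Γ x y = s(st, q) ↔ x = st := by
  constructor
  · intro e
    rw [fe, Sym2.eq_iff] at e
    rcases e with e | ⟨e1, e2⟩
    · exact e.1
    · exfalso
      have := btw_nx_self h hne
      rw [e2] at this
      rcases hl.btw this with h1 | h1
      · exact nx_ne h hne (e2.trans h1)
      · apply ht; rw [e1, ← h1, hl.2.2]
  · rintro rfl
    rw [fe, hl.2.1 _ (nx_adj h hne)]

theorem m2_leaf {st q : W} (hl : Leaf Γ ty st q) {u v : W} (h : Γ.Reachable u v)
    (ht : ty u < ty v) : m2 Γ u v s(st, q) = if st = u ∨ st = v then 1 else 0 := by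
  have hne : u ≠ v := by rintro rfl; exact lt_irrefl _ ht
  have e1 := hl.fe_eq h hne ht.ne
  have e2 := hl.fe_eq h.symm hne.symm ht.ne'
  simp only [m2, dl, Pi.add_apply, eq_comm (a := s(st, q)), e1, e2]
  split_ifs <;> grind

theorem m3_leaf (hΓ : Γ.IsAcyclic) {st q : W} (hl : Leaf Γ ty st q) {r v p : W}
    (h : Idx3 Γ ty r v p) :
    m3 Γ r v p s(st, q) = if Tip Γ ty r v p st then 1 else 0 := by
  have hr := h.reach
  have e1 := hl.fe_eq hr.1.symm h.vne.symm h.ty_lt.ne'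
  have e2 := hl.fe_eq hr.1 h.vne h.ty_lt.ne
  have e3 := hl.fe_eq hr.2 h.pne h.ty_ne
  have t1 := h.vne
  have t2 := h.pne
  have t3 : st = p → Inc3 Γ ty r v p := by
    rintro rfl
    rcases h with h | h
    swap
    · exact h
    exfalso
    have h1 := (hl.btw h.2.1).resolve_right h.2.2.1
    have h2 := hl.2.1 _ (nx_adj h.2.1.2.1 h.2.2.1)
    have h3 := h.2.2.2.2
    rw [h2] at h3
    have h4 : ty q ≠ ty r := by rw [← hl.2.2]; exact h.2.2.2.1
    rw [lab_of_ne (hl.1.symm.reachable.trans h.2.1.2.1) (by rintro rfl; exact h4 rfl) h4] at h3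
    rw [← hl.2.2, h1] at h3; exact h3 rfl
  have t4 : Inc3 Γ ty r v p → v ≠ p := fun h => (h.nxs hΓ).2.2.2.2.2
  simp only [m3, m2, dl, Pi.add_apply, eq_comm (a := s(st, q)), e1, e2, e3, Tip]
  by_cases hi : Inc3 Γ ty r v p
  · have := t4 hi
    simp only [hi, true_and]
    split_ifs <;> grind
  · simp only [hi, false_and, or_false]
    split_ifs <;> grind

end objects
end TC

namespace TC
section counting
variable {W : Type} [Fintype W] {Γ Γ' : SimpleGraph W} {ty : W → Fin 3}

/-- admissible vertices of type `i` in the component of `u`, where `st` is a pinned vertex -/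
def AA (Γ : SimpleGraph W) (ty : W → Fin 3) (u : W) (i : Fin 3) (st x : W) : Prop :=
  Γ.Reachable u x ∧ ty x = i ∧ (Γ.Reachable u st → x = st)

def A0 (Γ : SimpleGraph W) (ty : W → Fin 3) (u : W) (x : W) : Prop :=
  Γ.Reachable u x ∧ ty x = 0

def IdxPin (Γ : SimpleGraph W) (ty : W → Fin 3) (u st1 st2 r v p : W) : Prop :=
  Γ.Reachable u r ∧ Idx3 Γ ty r v p ∧ (Γ.Reachable u st1 → Tip Γ ty r v p st1) ∧
    (Γ.Reachable u st2 → Tip Γ ty r v p st2)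

theorem comp_card (hΓ : Γ.IsAcyclic) {r v : W} (h : Γ.Reachable v r) (ht : ty v < ty r) :
    (Finset.univ.filter fun p => Comp3 Γ ty r v p).card =
    (Finset.univ.filter fun x => Btw Γ v x r ∧ ty x ≠ ty r ∧ ty x ≠ ty v).card
      + (if (0 : Fin 3) ≠ ty v then 1 else 0) := by
  have h1 := chain (ty := ty) hΓ (ty r) (ty v) h
  have hne : v ≠ r := by rintro rfl; exact lt_irrefl _ ht
  rw [lab_of_ne h hne ht.ne, if_neg (by simp), add_zero] at h1
  have e1 : (Finset.univ.filter fun p => Comp3 Γ ty r v p) =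
      (Finset.univ.filter fun p => Btw Γ v p r ∧ p ≠ r ∧
        (ty p ≠ ty r ∧ lab Γ ty (ty r) r (nx Γ p r) ≠ ty v)) := by
    ext p; simp [Comp3, ht]
  have e2 : (Finset.univ.filter fun x => Btw Γ v x r ∧ ty x ≠ ty r ∧ ty x ≠ ty v) =
      (Finset.univ.filter fun p => Btw Γ v p r ∧ p ≠ r ∧ (ty p ≠ ty r ∧ ty p ≠ ty v)) := by
    ext p
    simp only [Finset.mem_filter, Finset.mem_univ, true_and]
    constructor
    · rintro ⟨a, b, c⟩
      exact ⟨a, by rintro rfl; exact b rfl, b, c⟩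
    · rintro ⟨a, _, b, c⟩; exact ⟨a, b, c⟩
  rw [e1, e2, h1]

theorem comp_not_inc {r v p : W} (h : Comp3 Γ ty r v p) : ¬ Inc3 Γ ty r v p :=
  fun hi => hi.2.2.2.2.2.1 h.2.1

variable {u st1 st2 q1 q2 : W}

theorem pin_point (hΓ : Γ.IsAcyclic) (hl1 : Leaf Γ ty st1 q1) (hl2 : Leaf Γ ty st2 q2)
    (t1 : ty st1 = 1) (t2 : ty st2 = 2) (r v : W) :
    (Finset.univ.filter fun p => IdxPin Γ ty u st1 st2 r v p).card =
    (if AA Γ ty u 2 st2 r ∧ AA Γ ty u 1 st1 v then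
      1 + (Finset.univ.filter fun x => A0 Γ ty u x ∧ Btw Γ v x r).card else 0) +
    (if AA Γ ty u 2 st2 r ∧ A0 Γ ty u v then
      (Finset.univ.filter fun x => AA Γ ty u 1 st1 x ∧ Btw Γ v x r).card else 0) +
    (if AA Γ ty u 1 st1 r ∧ A0 Γ ty u v then
      (Finset.univ.filter fun x => AA Γ ty u 2 st2 x ∧ Btw Γ v x r).card else 0) +
    (if AA Γ ty u 2 st2 r ∧ A0 Γ ty u v then
      (Finset.univ.filter fun x => AA Γ ty u 1 st1 x ∧
        (¬ Btw Γ v x r ∧ ¬ Btw Γ x v r ∧ ¬ Btw Γ v r x)).card else 0) := by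
  have hsplit : (Finset.univ.filter fun p => IdxPin Γ ty u st1 st2 r v p).card =
      (Finset.univ.filter fun p => (Γ.Reachable u r ∧ (Γ.Reachable u st1 → st1 = r ∨ st1 = v) ∧
        (Γ.Reachable u st2 → st2 = r ∨ st2 = v)) ∧ Comp3 Γ ty r v p).card +
      (Finset.univ.filter fun p => (Γ.Reachable u r ∧ (Γ.Reachable u st1 → st1 = r ∨ st1 = v ∨ st1 = p) ∧
        (Γ.Reachable u st2 → st2 = r ∨ st2 = v ∨ st2 = p)) ∧ Inc3 Γ ty r v p).card := by
    rw [← Finset.card_union_of_disjoint]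
    · congr 1
      ext p
      simp only [Finset.mem_filter, Finset.mem_univ, true_and, Finset.mem_union]
      simp only [IdxPin, Idx3, Tip]
      by_cases hi : Inc3 Γ ty r v p
      · have : ¬ Comp3 Γ ty r v p := fun h => comp_not_inc h hi
        simp only [hi, this]; tauto
      · simp only [hi]; tauto
    · rw [Finset.disjoint_filter]
      rintro p - ⟨-, h⟩ ⟨-, h'⟩
      exact comp_not_inc h h'
  have hinc : (Finset.univ.filter fun p => (Γ.Reachable u r ∧
        (Γ.Reachable u st1 → st1 = r ∨ st1 = v ∨ st1 = p) ∧
        (Γ.Reachable u st2 → st2 = r ∨ st2 = v ∨ st2 = p)) ∧ Inc3 Γ ty r v p).card =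
      (if AA Γ ty u 2 st2 r ∧ A0 Γ ty u v then
      (Finset.univ.filter fun x => AA Γ ty u 1 st1 x ∧
        (¬ Btw Γ v x r ∧ ¬ Btw Γ x v r ∧ ¬ Btw Γ v r x)).card else 0) := by
    have key : ∀ p, ((Γ.Reachable u r ∧
        (Γ.Reachable u st1 → st1 = r ∨ st1 = v ∨ st1 = p) ∧
        (Γ.Reachable u st2 → st2 = r ∨ st2 = v ∨ st2 = p)) ∧ Inc3 Γ ty r v p) ↔
        ((AA Γ ty u 2 st2 r ∧ A0 Γ ty u v) ∧ AA Γ ty u 1 st1 p ∧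
        (¬ Btw Γ v p r ∧ ¬ Btw Γ p v r ∧ ¬ Btw Γ v r p)) := by
      intro p
      constructor
      · rintro ⟨⟨h1, h2, h3⟩, a1, a2, a3, a4, a5, a6⟩
        have b1 : Γ.Reachable u st1 → p = st1 := by
          intro h
          rcases h2 h with rfl | rfl | rfl
          · rw [t1] at a1; exact absurd a1 (by decide)
          · rw [t1] at a2; exact absurd a2 (by decide)
          · rfl
        have b2 : Γ.Reachable u st2 → r = st2 := by
          intro h
          rcases h3 h with rfl | rfl | rfl
          · rfl
          · rw [t2] at a2; exact absurd a2 (by decide)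
          · rw [t2] at a3; exact absurd a3 (by decide)
        exact ⟨⟨⟨h1, a1, b2⟩, h1.trans a4.symm, a2⟩, ⟨h1.trans a5.symm, a3, b1⟩, a6⟩
      · rintro ⟨⟨⟨h1, a1, b2⟩, h2, a2⟩, ⟨h3, a3, b1⟩, a6⟩
        exact ⟨⟨h1, fun h => Or.inr (Or.inr (b1 h).symm), fun h => Or.inl (b2 h).symm⟩,
          a1, a2, a3, h2.symm.trans h1, h3.symm.trans h1, a6⟩
    simp only [key]
    split_ifs with hc
    · simp only [hc, true_and]
    · simp only [hc, false_and, Finset.filter_false, Finset.card_empty]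
  rw [hsplit, hinc]
  congr 1
  by_cases hb : ty v < ty r ∧ Γ.Reachable u r ∧ Γ.Reachable v r
  swap
  · have z1 : ¬ (AA Γ ty u 2 st2 r ∧ AA Γ ty u 1 st1 v) := by
      rintro ⟨⟨a, b, -⟩, c, d, -⟩
      exact hb ⟨by rw [b, d]; decide, a, c.symm.trans a⟩
    have z2 : ¬ (AA Γ ty u 2 st2 r ∧ A0 Γ ty u v) := by
      rintro ⟨⟨a, b, -⟩, c, d⟩
      exact hb ⟨by rw [b, d]; decide, a, c.symm.trans a⟩
    have z3 : ¬ (AA Γ ty u 1 st1 r ∧ A0 Γ ty u v) := by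
      rintro ⟨⟨a, b, -⟩, c, d⟩
      exact hb ⟨by rw [b, d]; decide, a, c.symm.trans a⟩
    rw [if_neg z1, if_neg z2, if_neg z3]
    simp only [add_zero, Finset.card_eq_zero]
    apply Finset.filter_false_of_mem
    rintro p - ⟨⟨h1, -⟩, h2⟩
    exact hb ⟨h2.1, h1, h2.2.1.reach⟩
  obtain ⟨hlt, hur, hvr⟩ := hb
  have huv := hur.trans hvr.symm
  have hcc := comp_card hΓ hvr hlt
  -- pinned comp count
  have hpc : ∀ (Q : Prop) [Decidable Q], (Finset.univ.filter fun p => Q ∧ Comp3 Γ ty r v p).card =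
      if Q then (Finset.univ.filter fun p => Comp3 Γ ty r v p).card else 0 := by
    intro Q _; split_ifs with h
    · simp only [h, true_and]
    · simp only [h, false_and, Finset.filter_false, Finset.card_empty]
  have hlf : ∀ {st q : W} (_ : Leaf Γ ty st q) (i : Fin 3), ty v ≠ i → ty r ≠ i → ty st = i →
      (Finset.univ.filter fun x => AA Γ ty u i st x ∧ Btw Γ v x r).card =
      if Γ.Reachable u st then 0 else
        (Finset.univ.filter fun x => Btw Γ v x r ∧ ty x = i).card := by
    intro st q hl i h1 h2 h3
    split_ifs with h
    · rw [Finset.card_eq_zero]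
      apply Finset.filter_false_of_mem
      rintro x - ⟨⟨-, -, a⟩, b⟩
      rw [a h] at b
      rcases hl.btw b with rfl | rfl
      · exact h1 h3
      · exact h2 h3
    · congr 1; ext x
      simp only [Finset.mem_filter, Finset.mem_univ, true_and]
      simp only [AA]
      constructor
      · rintro ⟨⟨-, a, -⟩, b⟩; exact ⟨b, a⟩
      · rintro ⟨b, a⟩; exact ⟨⟨huv.trans b.1, a, fun h' => absurd h' h⟩, b⟩
  have hA0 : (Finset.univ.filter fun x => A0 Γ ty u x ∧ Btw Γ v x r).card =
        (Finset.univ.filter fun x => Btw Γ v x r ∧ ty x = 0).card := by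
    congr 1; ext x
    simp only [Finset.mem_filter, Finset.mem_univ, true_and]
    simp only [A0]
    constructor
    · rintro ⟨⟨-, a⟩, b⟩; exact ⟨b, a⟩
    · rintro ⟨b, a⟩; exact ⟨⟨huv.trans b.1, a⟩, b⟩
  rw [hpc, hcc]
  have hty : (ty r = 2 ∧ ty v = 1) ∨ (ty r = 2 ∧ ty v = 0) ∨ (ty r = 1 ∧ ty v = 0) := by
    revert hlt; generalize ty v = a; generalize ty r = b; revert a b; decide
  have st_ne : ∀ st x : W, ty st ≠ ty x → st ≠ x := by rintro st x h rfl; exact h rfl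
  rcases hty with ⟨a, b⟩ | ⟨a, b⟩ | ⟨a, b⟩
  · have n1 := st_ne st1 r (by rw [t1, a]; decide)
    have n2 := st_ne st2 v (by rw [t2, b]; decide)
    have e3 : (Finset.univ.filter fun x => Btw Γ v x r ∧ ty x ≠ ty r ∧ ty x ≠ ty v) =
       (Finset.univ.filter fun x => Btw Γ v x r ∧ ty x = 0) := by
      ext x; simp only [a, b, Finset.mem_filter, Finset.mem_univ, true_and]
      have : ∀ z : Fin 3, (z ≠ 2 ∧ z ≠ 1) ↔ z = 0 := by decide
      rw [this]
    rw [e3, hA0]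
    simp only [AA, A0, hur, huv, a, b, n1, n2, true_and, false_or, or_false,
      eq_comm (a := st1), eq_comm (a := st2)]
    simp
    simp only [and_comm, add_comm]
  · have n1 := st_ne st1 r (by rw [t1, a]; decide)
    have n2 := st_ne st2 v (by rw [t2, b]; decide)
    have n3 := st_ne st1 v (by rw [t1, b]; decide)
    have e3 : (Finset.univ.filter fun x => Btw Γ v x r ∧ ty x ≠ ty r ∧ ty x ≠ ty v) =
       (Finset.univ.filter fun x => Btw Γ v x r ∧ ty x = 1) := by
      ext x; simp only [a, b, Finset.mem_filter, Finset.mem_univ, true_and]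
      have : ∀ z : Fin 3, (z ≠ 2 ∧ z ≠ 0) ↔ z = 1 := by decide
      rw [this]
    rw [e3, hlf hl1 1 (by rw [b]; decide) (by rw [a]; decide) t1]
    simp only [AA, A0, hur, huv, a, b, n1, n2, n3, true_and, false_or, or_false,
      eq_comm (a := st2)]
    simp
    split_ifs <;> first | rfl | (exfalso; tauto)
  · have n1 := st_ne st2 r (by rw [t2, a]; decide)
    have n2 := st_ne st1 v (by rw [t1, b]; decide)
    have n3 := st_ne st2 v (by rw [t2, b]; decide)
    have e3 : (Finset.univ.filter fun x => Btw Γ v x r ∧ ty x ≠ ty r ∧ ty x ≠ ty v) =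
       (Finset.univ.filter fun x => Btw Γ v x r ∧ ty x = 2) := by
      ext x; simp only [a, b, Finset.mem_filter, Finset.mem_univ, true_and]
      have : ∀ z : Fin 3, (z ≠ 1 ∧ z ≠ 0) ↔ z = 2 := by decide
      rw [this]
    rw [e3, hlf hl2 2 (by rw [b]; decide) (by rw [a]; decide) t2]
    simp only [AA, A0, hur, huv, a, b, n1, n2, n3, true_and, false_or, or_false,
      eq_comm (a := st1)]
    simp
    split_ifs <;> first | rfl | (exfalso; tauto)

theorem tri_excl {r w v : W} (h1 : Γ.Reachable r w) (h2 : Γ.Reachable r v)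
    (n1 : r ≠ w) (n2 : r ≠ v) (n3 : w ≠ v) :
    (if Btw Γ w v r then 1 else 0) + (if Btw Γ v w r then 1 else 0) +
    (if Btw Γ v r w then 1 else 0) +
    (if (¬ Btw Γ v w r ∧ ¬ Btw Γ w v r ∧ ¬ Btw Γ v r w) then 1 else 0) = 1 := by
  have a1 : Btw Γ w v r → ¬ Btw Γ v w r := fun a b => n3 (a.antisymm b).symm
  have a2 : Btw Γ w v r → ¬ Btw Γ v r w := fun a b => n2 (a.symm.antisymm b.symm.symm.symm.symm.symm.symm |>.symm |> fun h => by
    first | exact h | exact h.symm)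
  have a3 : Btw Γ v w r → ¬ Btw Γ v r w := fun a b => n1 (a.symm.antisymm b.symm).symm
  split_ifs <;> first | rfl | (exfalso; tauto)

theorem sum_ite_two (P Q : W → Prop) [DecidablePred P] [DecidablePred Q] (f : W → W → ℕ) :
    (∑ r : W, ∑ v : W, if P r ∧ Q v then f r v else 0) =
    ∑ r ∈ Finset.univ.filter P, ∑ v ∈ Finset.univ.filter Q, f r v := by
  rw [Finset.sum_filter]
  apply Finset.sum_congr rfl
  intro r _
  rw [Finset.sum_filter]
  split_ifs with h
  · simp only [h, true_and]
  · simp only [h, false_and, if_false, Finset.sum_const_zero]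

theorem card_and_filter (P Q : W → Prop) [DecidablePred P] [DecidablePred Q] :
    (Finset.univ.filter fun x => P x ∧ Q x).card =
      ∑ x ∈ Finset.univ.filter P, if Q x then 1 else 0 := by
  rw [← Finset.card_filter, Finset.filter_filter]

theorem abs_count (P0 P1 P2 : W → Prop) [DecidablePred P0] [DecidablePred P1] [DecidablePred P2]
    (B I : W → W → W → Prop) [∀ a b, DecidablePred (B a b)] [∀ a b, DecidablePred (I a b)]
    (h : ∀ a b c, P2 a → P1 b → P0 c →
      (if B b c a then 1 else 0) + (if B c b a then 1 else 0) + (if B c a b then 1 else 0)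
       + (if I c b a then 1 else 0) = 1) :
    (∑ r : W, ∑ v : W, (
      (if P2 r ∧ P1 v then 1 + (Finset.univ.filter fun x => P0 x ∧ B v x r).card else 0) +
      (if P2 r ∧ P0 v then (Finset.univ.filter fun x => P1 x ∧ B v x r).card else 0) +
      (if P1 r ∧ P0 v then (Finset.univ.filter fun x => P2 x ∧ B v x r).card else 0) +
      (if P2 r ∧ P0 v then (Finset.univ.filter fun x => P1 x ∧ I v x r).card else 0))) =
    (Finset.univ.filter P1).card * (Finset.univ.filter P2).card *
      ((Finset.univ.filter P0).card + 1) := by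
  simp only [Finset.sum_add_distrib]
  rw [sum_ite_two, sum_ite_two, sum_ite_two, sum_ite_two]
  simp only [card_and_filter, Finset.sum_add_distrib]
  have e2 : ∀ R : W → W → W → Prop, ∀ [∀ a b, DecidablePred (R a b)],
    (∑ r ∈ Finset.univ.filter P2, ∑ v ∈ Finset.univ.filter P0, ∑ x ∈ Finset.univ.filter P1,
      if R v x r then 1 else 0) = ∑ r ∈ Finset.univ.filter P2, ∑ b ∈ Finset.univ.filter P1,
        ∑ c ∈ Finset.univ.filter P0, if R c b r then 1 else 0 := by
    intro R _
    apply Finset.sum_congr rfl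
    intro r _
    rw [Finset.sum_comm]
  have e3 : (∑ r ∈ Finset.univ.filter P1, ∑ v ∈ Finset.univ.filter P0, ∑ x ∈ Finset.univ.filter P2,
      if B v x r then 1 else 0) = ∑ a ∈ Finset.univ.filter P2, ∑ b ∈ Finset.univ.filter P1,
        ∑ c ∈ Finset.univ.filter P0, if B c a b then 1 else 0 := by
    rw [Finset.sum_comm (s := Finset.univ.filter P2)]
    apply Finset.sum_congr rfl
    intro r _
    rw [Finset.sum_comm]
  rw [e2, e2, e3]
  have : (Finset.univ.filter P1).card * (Finset.univ.filter P2).card *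
      ((Finset.univ.filter P0).card + 1) = 
      (∑ a ∈ Finset.univ.filter P2, ∑ b ∈ Finset.univ.filter P1, 1) + 
      (∑ a ∈ Finset.univ.filter P2, ∑ b ∈ Finset.univ.filter P1,
        ∑ c ∈ Finset.univ.filter P0, 1) := by
    simp; ring
  rw [this, add_assoc, add_assoc, add_assoc]
  congr 1
  rw [← add_assoc, ← add_assoc]
  simp only [← Finset.sum_add_distrib]
  refine Finset.sum_congr rfl fun a ha => Finset.sum_congr rfl fun b hb =>
    Finset.sum_congr rfl fun c hc => ?_
  simp only [Finset.mem_filter, Finset.mem_univ, true_and] at ha hb hc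
  exact h a b c ha hb hc

theorem pin_card (hΓ : Γ.IsAcyclic) (hl1 : Leaf Γ ty st1 q1) (hl2 : Leaf Γ ty st2 q2)
    (t1 : ty st1 = 1) (t2 : ty st2 = 2) :
    (Finset.univ.filter fun q : W × W × W => IdxPin Γ ty u st1 st2 q.1 q.2.1 q.2.2).card =
    (Finset.univ.filter fun x => AA Γ ty u 1 st1 x).card *
    (Finset.univ.filter fun x => AA Γ ty u 2 st2 x).card *
    ((Finset.univ.filter fun x => A0 Γ ty u x).card + 1) := by
  rw [Finset.card_filter, Fintype.sum_prod_type]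
  have hp := fun r v => (Finset.card_filter (fun p => IdxPin Γ ty u st1 st2 r v p)
    Finset.univ).symm.trans (pin_point hΓ hl1 hl2 t1 t2 r v)
  simp only [Fintype.sum_prod_type, hp]
  apply abs_count (P0 := A0 Γ ty u) (P1 := AA Γ ty u 1 st1) (P2 := AA Γ ty u 2 st2) (B := Btw Γ)
    (I := fun v x r => (¬ Btw Γ v x r ∧ ¬ Btw Γ x v r ∧ ¬ Btw Γ v r x))
  intro a b c ha hb hc
  apply tri_excl (ha.1.symm.trans hb.1) (ha.1.symm.trans hc.1)
  · rintro rfl; have := ha.2.1.symm.trans hb.2.1; exact absurd this (by decide)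
  · rintro rfl; have := ha.2.1.symm.trans hc.2; exact absurd this (by decide)
  · rintro rfl; have := hb.2.1.symm.trans hc.2; exact absurd this (by decide)

end counting
end TC

namespace TC
section closure
variable {W : Type} {Γ Γ' : SimpleGraph W} {ty : W → Fin 3}

def Pair2 (Γ : SimpleGraph W) (ty : W → Fin 3) (k : Fin 3) (m : Sym2 W → ℕ) : Prop :=
  ∃ a b, Γ.Reachable a b ∧ ty a < ty b ∧ ty a ≠ k ∧ ty b ≠ k ∧ m = m2 Γ a b

def Full (Γ : SimpleGraph W) (ty : W → Fin 3) (m : Sym2 W → ℕ) : Prop :=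
  ∃ r v p, Idx3 Γ ty r v p ∧ m = m3 Γ r v p

theorem third_type (a b : Fin 3) : ∃ k : Fin 3, a ≠ k ∧ b ≠ k := by revert a b; decide

theorem mk_pair_k {a b : W} {k : Fin 3} (h : Γ.Reachable a b) (ht : ty a ≠ ty b) (ha : ty a ≠ k) (hb : ty b ≠ k) :
    Pair2 Γ ty k (m2 Γ a b) := by
  rcases lt_or_gt_of_ne ht with h1 | h1
  · exact ⟨a, b, h, h1, ha, hb, rfl⟩
  · exact ⟨b, a, h.symm, h1, hb, ha, m2_comm _ _⟩

theorem mk_pair {a b : W} (h : Γ.Reachable a b) (ht : ty a ≠ ty b) :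
    ∃ k, Pair2 Γ ty k (m2 Γ a b) := by
  obtain ⟨k, h1, h2⟩ := third_type (ty a) (ty b)
  exact ⟨k, mk_pair_k h ht h1 h2⟩

theorem m2_local (hΓ : Γ.IsAcyclic) (hle : Γ' ≤ Γ) {a b : W} (h : Γ'.Reachable a b) (hne : a ≠ b) :
    m2 Γ' a b = m2 Γ a b := by
  unfold m2; rw [fe_local hΓ hle h hne, fe_local hΓ hle h.symm hne.symm]

theorem m3_local (hΓ : Γ.IsAcyclic) (hle : Γ' ≤ Γ) {r v p : W} (h : Γ'.Reachable v r) (hp : Γ'.Reachable p r)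
    (n1 : v ≠ r) (n2 : p ≠ r) : m3 Γ' r v p = m3 Γ r v p := by
  unfold m3; rw [fe_local hΓ hle hp n2, m2_local hΓ hle h.symm n1.symm]

theorem idx3_local (hΓ : Γ.IsAcyclic) (hle : Γ' ≤ Γ) {r v p : W} (h : Γ'.Reachable v r)
    (hp : Γ'.Reachable p r) : Idx3 Γ' ty r v p ↔ Idx3 Γ ty r v p := by
  unfold Idx3
  have e1 : Comp3 Γ' ty r v p ↔ Comp3 Γ ty r v p := by
    unfold Comp3
    rw [btw_local hΓ hle h]
    by_cases hne : p = r
    · simp [hne]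
    · rw [lab_local hΓ hle _ (nx_reach' hp), nx_local hΓ hle hp hne]
  have e2 : Inc3 Γ' ty r v p ↔ Inc3 Γ ty r v p := by
    unfold Inc3
    rw [btw_local hΓ hle h, btw_local hΓ hle hp, btw_local hΓ hle (h.trans hp.symm)]
    simp only [h, hp, h.mono hle, hp.mono hle]
  rw [e1, e2]

theorem Pair2.up (hΓ : Γ.IsAcyclic) (hle : Γ' ≤ Γ) {k : Fin 3} {m : Sym2 W → ℕ} (h : Pair2 Γ' ty k m) :
    Pair2 Γ ty k m := by
  obtain ⟨a, b, h1, h2, h3, h4, rfl⟩ := h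
  exact ⟨a, b, h1.mono hle, h2, h3, h4, m2_local hΓ hle h1 (by rintro rfl; exact lt_irrefl _ h2)⟩

theorem Full.up (hΓ : Γ.IsAcyclic) (hle : Γ' ≤ Γ) {m : Sym2 W → ℕ} (h : Full Γ' ty m) :
    Full Γ ty m := by
  obtain ⟨r, v, p, h1, rfl⟩ := h
  exact ⟨r, v, p, (idx3_local hΓ hle h1.reach.1 h1.reach.2).1 h1,
    m3_local hΓ hle h1.reach.1 h1.reach.2 h1.vne h1.pne⟩

theorem Pair2.down (hΓ : Γ.IsAcyclic) (hle : Γ' ≤ Γ) {k : Fin 3} {m : Sym2 W → ℕ} {u : W}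
    (hm : ∀ e, m e ≠ 0 → ∀ z ∈ e, Γ'.Reachable u z) (h : Pair2 Γ ty k m) : Pair2 Γ' ty k m := by
  obtain ⟨a, b, h1, h2, h3, h4, rfl⟩ := h
  have ha := hm (fe Γ a b) (m2_ne.2 (by simp)) a (by simp [fe])
  have hb := hm (fe Γ b a) (m2_ne.2 (by simp)) b (by simp [fe])
  have hr := ha.symm.trans hb
  exact ⟨a, b, hr, h2, h3, h4, (m2_local hΓ hle hr (by rintro rfl; exact lt_irrefl _ h2)).symm⟩

theorem Full.down (hΓ : Γ.IsAcyclic) (hle : Γ' ≤ Γ) {m : Sym2 W → ℕ} {u : W}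
    (hm : ∀ e, m e ≠ 0 → ∀ z ∈ e, Γ'.Reachable u z) (h : Full Γ ty m) : Full Γ' ty m := by
  obtain ⟨r, v, p, h1, rfl⟩ := h
  have ha := hm (fe Γ r v) (m3_ne.2 (by simp)) r (by simp [fe])
  have hb := hm (fe Γ v r) (m3_ne.2 (by simp)) v (by simp [fe])
  have hc := hm (fe Γ p r) (m3_ne.2 (by simp)) p (by simp [fe])
  exact ⟨r, v, p, (idx3_local hΓ hle (hb.symm.trans ha) (hc.symm.trans ha)).2 h1,
    (m3_local hΓ hle (hb.symm.trans ha) (hc.symm.trans ha) h1.vne h1.pne).symm⟩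

/-- Removing one from a full function yields a pair. -/
theorem full_sub (hΓ : Γ.IsAcyclic) {m m' : Sym2 W → ℕ} {f : Sym2 W} (h : Full Γ ty m) (e : m = m' + dl f) :
    ∃ k, Pair2 Γ ty k m' := by
  obtain ⟨r, v, p, hi, rfl⟩ := h
  have hf : f = fe Γ r v ∨ f = fe Γ v r ∨ f = fe Γ p r := by
    apply m3_ne.1; rw [e]; simp [dl]
  have hr := hi.reach
  unfold m3 m2 at e
  rcases hf with rfl | rfl | rfl
  · have e' : m' = dl (fe Γ v r) + dl (fe Γ p r) := by
      apply add_right_cancel (b := dl (fe Γ r v)); rw [← e]; abel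
    rcases hi with hi | hi
    · obtain ⟨t1, b, n1, t2, l⟩ := hi
      have hs := btw_step hΓ b n1
      have hne : v ≠ nx Γ p r := hs.2.2.1.symm
      have hnr := (nx_reach' b.2.1)
      have hre : Γ.Reachable v (nx Γ p r) := b.1.trans (nx_reach b.2.1)
      have e1 : fe Γ v r = fe Γ v (nx Γ p r) := by
        unfold fe; rw [nx_prefix hΓ hs.1 hne.symm]
      have e2 : fe Γ p r = fe Γ (nx Γ p r) v := by
        unfold fe; rw [hs.2.1, Sym2.eq_swap]
      rw [e', e1, e2]
      apply mk_pair hre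
      intro ht
      apply l
      by_cases hq : nx Γ p r = r
      · exact absurd (ht.trans (by rw [hq])) t1.ne
      · rw [lab_of_ne hnr hq (by rw [← ht]; exact t1.ne), ht]
    · have hx := hi.nxs hΓ
      rw [e']
      have : dl (fe Γ v r) + dl (fe Γ p r) = m2 Γ v p := by
        unfold m2 fe; rw [hx.2.1, hx.2.2.1]
      rw [this]
      exact mk_pair (hr.1.trans hr.2.symm) (by rw [hi.2.1, hi.2.2.1]; decide)
  · have e' : m' = dl (fe Γ r v) + dl (fe Γ p r) := by
      apply add_right_cancel (b := dl (fe Γ v r)); rw [← e]; abel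
    have e1 : fe Γ r v = fe Γ r p := by
      rcases hi with hi | hi
      · unfold fe; rw [nx_prefix hΓ hi.2.1.symm hi.2.2.1]
      · unfold fe; rw [(hi.nxs hΓ).1]
    rw [e', e1]
    exact mk_pair hr.2.symm hi.ty_ne.symm
  · rw [← add_right_cancel e]
    exact mk_pair hr.1.symm hi.ty_lt.ne'

variable [Fintype W]

theorem dl_sum (f : Sym2 W) : ∑ e, dl f e = 1 := by
  simp [dl]

theorem m2_sum (a b : W) : ∑ e, m2 Γ a b e = 2 := by
  simp only [m2, Pi.add_apply, Finset.sum_add_distrib, dl_sum]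

theorem m3_sum (r v p : W) : ∑ e, m3 Γ r v p e = 3 := by
  simp only [m3, Pi.add_apply, Finset.sum_add_distrib, dl_sum, m2_sum]

theorem Pair2.sum {k : Fin 3} {m : Sym2 W → ℕ} (h : Pair2 Γ ty k m) : ∑ e, m e = 2 := by
  obtain ⟨a, b, h1, h2, h3, h4, rfl⟩ := h
  exact m2_sum _ _

theorem Full.sum {m : Sym2 W → ℕ} (h : Full Γ ty m) : ∑ e, m e = 3 := by
  obtain ⟨r, v, p, h1, rfl⟩ := h
  exact m3_sum _ _ _

theorem eq_of_le_sum {m m' : Sym2 W → ℕ} (hle : ∀ e, m' e ≤ m e) (hs : ∑ e, m e ≤ ∑ e, m' e) :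
    m' = m := by
  funext e
  exact (Finset.sum_eq_sum_iff_of_le (fun i _ => hle i)).1
    (le_antisymm (Finset.sum_le_sum fun i _ => hle i) hs) e (Finset.mem_univ e)

theorem sub_one {m m' : Sym2 W → ℕ} (hle : ∀ e, m' e ≤ m e) (hs : ∑ e, m e = ∑ e, m' e + 1) :
    ∃ f, m = m' + dl f := by
  have : ∃ f, m' f < m f := by
    by_contra hc
    push Not at hc
    have := Finset.sum_le_sum fun i (_ : i ∈ Finset.univ) => hc i
    omega
  obtain ⟨f, hf⟩ := this
  refine ⟨f, ?_⟩
  symm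
  apply eq_of_le_sum
  · intro e
    simp only [Pi.add_apply, dl]
    split_ifs with h
    · subst h; omega
    · have := hle e; omega
  · simp only [Pi.add_apply, Finset.sum_add_distrib, dl_sum]; omega

def GoodM (Γ : SimpleGraph W) (ty : W → Fin 3) (m : Sym2 W → ℕ) : Prop :=
  ∑ e, m e ≤ 1 ∨ (∃ k, Pair2 Γ ty k m) ∨ Full Γ ty m

theorem GoodM.sum_le {m : Sym2 W → ℕ} (h : GoodM Γ ty m) : ∑ e, m e ≤ 3 := by
  rcases h with h | ⟨k, h⟩ | h
  · omega
  · rw [h.sum]; omega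
  · rw [h.sum]

theorem good_sub (hΓ : Γ.IsAcyclic) {m m' : Sym2 W → ℕ} (h : GoodM Γ ty m) (hle : ∀ e, m' e ≤ m e) :
    GoodM Γ ty m' := by
  have hs := Finset.sum_le_sum fun i (_ : i ∈ Finset.univ) => hle i
  by_cases h1 : ∑ e, m' e ≤ 1
  · exact Or.inl h1
  right
  rcases h with h | ⟨k, h⟩ | h
  · omega
  · have := h.sum
    rw [eq_of_le_sum hle (by omega)]; exact Or.inl ⟨k, h⟩
  · have := h.sum
    by_cases h2 : ∑ e, m' e = 2
    · obtain ⟨f, hf⟩ := sub_one hle (by omega)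
      exact Or.inl (full_sub hΓ h hf)
    · rw [eq_of_le_sum hle (by omega)]; exact Or.inr h

theorem GoodM.down (hΓ : Γ.IsAcyclic) (hle : Γ' ≤ Γ) {m : Sym2 W → ℕ} {u : W}
    (hm : ∀ e, m e ≠ 0 → ∀ z ∈ e, Γ'.Reachable u z) (h : GoodM Γ ty m) : GoodM Γ' ty m := by
  rcases h with h | ⟨k, h⟩ | h
  · exact Or.inl h
  · exact Or.inr (Or.inl ⟨k, h.down hΓ hle hm⟩)
  · exact Or.inr (Or.inr (h.down hΓ hle hm))

theorem GoodM.up (hΓ : Γ.IsAcyclic) (hle : Γ' ≤ Γ) {m : Sym2 W → ℕ}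
    (h : GoodM Γ' ty m) : GoodM Γ ty m := by
  rcases h with h | ⟨k, h⟩ | h
  · exact Or.inl h
  · exact Or.inr (Or.inl ⟨k, h.up hΓ hle⟩)
  · exact Or.inr (Or.inr (h.up hΓ hle))

/-- the forest of a weight function -/
def Gr (y : Sym2 W → ℕ) : SimpleGraph W := SimpleGraph.fromEdgeSet {e | y e ≠ 0}

/-- excess in the component of `u` -/
noncomputable def MM (y : Sym2 W → ℕ) (u : W) (e : Sym2 W) : ℕ :=
  if ∃ z ∈ e, (Gr y).Reachable u z then y e - 1 else 0

noncomputable def NN (y : Sym2 W → ℕ) (u : W) : ℕ := ∑ e, MM y u e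

structure XH (ty : W → Fin 3) (Hs : Set (Sym2 W)) (y : Sym2 W → ℕ) : Prop where
  nd : ∀ e, y e ≠ 0 → ¬ e.IsDiag
  sub : ∀ e, y e ≠ 0 → e ∈ Hs
  ac : (Gr y).IsAcyclic
  good : ∀ u, GoodM (Gr y) ty (MM y u)
  gv2 : ∀ u u', ¬ (Gr y).Reachable u u' → 2 ≤ NN y u → 2 ≤ NN y u' → NN y u ≤ 2 ∧ NN y u' ≤ 2 ∧
    ∀ k, Pair2 (Gr y) ty k (MM y u) → ¬ Pair2 (Gr y) ty k (MM y u')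
  gv3 : ∀ u u' u'', ¬ (Gr y).Reachable u u' → ¬ (Gr y).Reachable u u'' → ¬ (Gr y).Reachable u' u'' →
    2 ≤ NN y u → 2 ≤ NN y u' → 2 ≤ NN y u'' → False

theorem gr_reach {y : Sym2 W → ℕ} {e : Sym2 W} (he : y e ≠ 0) {z z' : W} (hz : z ∈ e) (hz' : z' ∈ e) :
    (Gr y).Reachable z z' := by
  by_cases h : z = z'
  · rw [h]
  · have : e = s(z, z') := by
      exact (Sym2.mem_and_mem_iff h).1 ⟨hz, hz'⟩
    subst this
    apply SimpleGraph.Adj.reachable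
    rw [Gr, SimpleGraph.fromEdgeSet_adj]
    exact ⟨he, h⟩

theorem mm_reach {y : Sym2 W → ℕ} {e : Sym2 W} {u : W} (he : MM y u e ≠ 0) :
    2 ≤ y e ∧ ∀ z ∈ e, (Gr y).Reachable u z := by
  unfold MM at he
  split_ifs at he with h
  · obtain ⟨z, hz, hr⟩ := h
    refine ⟨by omega, fun z' hz' => hr.trans (gr_reach (by omega) hz hz')⟩
  · exact absurd rfl he

theorem mm_eq_of_reach {y : Sym2 W → ℕ} {u u' : W} (h : (Gr y).Reachable u u') : MM y u = MM y u' := by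
  funext e
  unfold MM
  have : (∃ z ∈ e, (Gr y).Reachable u z) ↔ (∃ z ∈ e, (Gr y).Reachable u' z) :=
    ⟨fun ⟨z, a, b⟩ => ⟨z, a, h.symm.trans b⟩, fun ⟨z, a, b⟩ => ⟨z, a, h.trans b⟩⟩
  simp only [this]

theorem gr_mono {y y' : Sym2 W → ℕ} (h : ∀ e, y' e ≤ y e) : Gr y' ≤ Gr y := by
  apply SimpleGraph.fromEdgeSet_mono
  intro e he
  have := h e
  simp only [Set.mem_ofPred_eq] at he ⊢
  omega

theorem mm_mono {y y' : Sym2 W → ℕ} (h : ∀ e, y' e ≤ y e) (u : W) (e : Sym2 W) : MM y' u e ≤ MM y u e := by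
  unfold MM
  split_ifs with h1 h2
  · have := h e; omega
  · exact absurd (h1.imp fun z hz => ⟨hz.1, hz.2.mono (gr_mono h)⟩) h2
  · omega
  · omega

theorem XH.mono {Hs : Set (Sym2 W)} {y y' : Sym2 W → ℕ} (hy : XH ty Hs y) (h : ∀ e, y' e ≤ y e) :
    XH ty Hs y' := by
  have hpos : ∀ e, y' e ≠ 0 → y e ≠ 0 := fun e he => by have := h e; omega
  have hg := gr_mono h
  have hNle : ∀ u, NN y' u ≤ NN y u := fun u => Finset.sum_le_sum fun e _ => mm_mono h u e
  have hsep : ∀ u u', ¬ (Gr y').Reachable u u' → 2 ≤ NN y' u → 2 ≤ NN y' u' →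
      ¬ (Gr y).Reachable u u' := by
    intro u u' hn h1 h2 hr
    have hle : NN y' u + NN y' u' ≤ NN y u := by
      unfold NN
      rw [← Finset.sum_add_distrib]
      apply Finset.sum_le_sum
      intro e _
      have a1 := mm_mono h u e
      have a2 := mm_mono h u' e
      rw [← mm_eq_of_reach hr] at a2
      by_cases z1 : MM y' u e = 0
      · omega
      by_cases z2 : MM y' u' e = 0
      · omega
      exfalso
      obtain ⟨z, hz⟩ : ∃ z, z ∈ e := ⟨_, Sym2.out_fst_mem e⟩
      exact hn (((mm_reach z1).2 z hz).trans ((mm_reach z2).2 z hz).symm)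
    have := (hy.good u).sum_le
    unfold NN at *
    omega
  refine ⟨fun e he => hy.nd e (hpos e he), fun e he => hy.sub e (hpos e he),
    hy.ac.anti hg, ?_, ?_, ?_⟩
  · intro u
    exact (good_sub hy.ac (hy.good u) (mm_mono h u)).down hy.ac hg fun e he => (mm_reach he).2
  · intro u u' hn h1 h2
    have hn' := hsep u u' hn h1 h2
    obtain ⟨b1, b2, b3⟩ := hy.gv2 u u' hn' (h1.trans (hNle u)) (h2.trans (hNle u'))
    have c1 := hNle u
    have c2 := hNle u'
    refine ⟨by omega, by omega, fun k p1 p2 => ?_⟩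
    rw [eq_of_le_sum (mm_mono h u) (b1.trans h1)] at p1
    rw [eq_of_le_sum (mm_mono h u') (b2.trans h2)] at p2
    exact b3 k (p1.up hy.ac hg) (p2.up hy.ac hg)
  · intro u u' u'' n1 n2 n3 h1 h2 h3
    exact hy.gv3 u u' u'' (hsep _ _ n1 h1 h2) (hsep _ _ n2 h1 h3) (hsep _ _ n3 h2 h3)
      (h1.trans (hNle _)) (h2.trans (hNle _)) (h3.trans (hNle _))

end closure
end TC

namespace TC
section ext
variable {W : Type} {Γ Γ' : SimpleGraph W} {ty : W → Fin 3}

noncomputable def rt (Γ : SimpleGraph W) (u : W) : W := (Γ.connectedComponentMk u).out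

theorem rt_reach (u : W) : Γ.Reachable (rt Γ u) u := by
  have : Γ.connectedComponentMk (rt Γ u) = Γ.connectedComponentMk u := Quot.out_eq _
  exact SimpleGraph.ConnectedComponent.eq.1 this

theorem rt_eq {u v : W} (h : Γ.Reachable u v) : rt Γ u = rt Γ v := by
  unfold rt; rw [SimpleGraph.ConnectedComponent.eq.2 h]

theorem rt_rt (u : W) : rt Γ (rt Γ u) = rt Γ u := rt_eq (rt_reach u)

variable [Fintype W]

noncomputable def Rt (Γ : SimpleGraph W) : Finset W := Finset.univ.filter fun u => rt Γ u = u

theorem mem_Rt {u : W} : u ∈ Rt Γ ↔ rt Γ u = u := by simp [Rt]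

theorem edge_count (hΓ : Γ.IsAcyclic) :
    (Finset.univ.filter fun e => e ∈ Γ.edgeSet).card + (Rt Γ).card = Fintype.card W := by
  have h1 : (Finset.univ.filter fun u => rt Γ u ≠ u).card =
      (Finset.univ.filter fun e => e ∈ Γ.edgeSet).card := by
    apply Finset.card_bij (fun u _ => fe Γ u (rt Γ u))
    · intro u hu
      simp only [Finset.mem_filter, Finset.mem_univ, true_and] at hu ⊢
      exact fe_mem (rt_reach u).symm hu.symm
    · intro u hu v hv h
      simp only [Finset.mem_filter, Finset.mem_univ, true_and] at hu hv
      have huv : Γ.Reachable u v := by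
        have : v ∈ fe Γ u (rt Γ u) := by rw [h]; simp [fe]
        exact (fe_btw (rt_reach u).symm hu.symm this).1
      rw [← rt_eq huv] at h hv
      exact fe_inj hΓ (rt_reach u).symm (huv.symm.trans (rt_reach u).symm) hu.symm hv.symm h
    · intro e he
      induction e using Sym2.ind with | _ x y => ?_
      simp only [Finset.mem_filter, Finset.mem_univ, true_and, SimpleGraph.mem_edgeSet] at he
      obtain ⟨u, h1, h2, h3⟩ := fe_surj hΓ he (rt_reach x).symm
      have : rt Γ u = rt Γ x := (rt_eq h2).trans (rt_rt x)
      refine ⟨u, ?_, ?_⟩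
      · simp only [Finset.mem_filter, Finset.mem_univ, true_and]
        rw [this]; exact h1.symm
      · rw [this]; exact h3
  rw [← h1, Rt, add_comm, Finset.card_filter_add_card_filter_not, Finset.card_univ]

theorem gr_edge {y : Sym2 W → ℕ} (nd : ∀ e, y e ≠ 0 → ¬ e.IsDiag) (e : Sym2 W) :
    e ∈ (Gr y).edgeSet ↔ y e ≠ 0 := by
  rw [Gr, SimpleGraph.edgeSet_fromEdgeSet]
  exact ⟨fun h => h.1, fun h => ⟨h, nd e h⟩⟩

theorem gr_adj {y : Sym2 W → ℕ} {a b : W} : (Gr y).Adj a b ↔ y s(a, b) ≠ 0 ∧ a ≠ b := by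
  rw [Gr, SimpleGraph.fromEdgeSet_adj]; rfl

theorem sum_NN (y : Sym2 W → ℕ) : ∑ c ∈ Rt (Gr y), NN y c = ∑ e, (y e - 1) := by
  unfold NN
  rw [Finset.sum_comm]
  apply Finset.sum_congr rfl
  intro e _
  by_cases h : y e - 1 = 0
  · rw [h]; apply Finset.sum_eq_zero
    intro c _; unfold MM; split_ifs <;> omega
  · obtain ⟨z, hz⟩ : ∃ z, z ∈ e := ⟨_, Sym2.out_fst_mem e⟩
    rw [Finset.sum_eq_single (rt (Gr y) z)]
    · unfold MM; rw [if_pos ⟨z, hz, rt_reach z⟩]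
    · intro c hc hne
      unfold MM
      rw [if_neg]
      rintro ⟨z', hz', hr⟩
      apply hne
      rw [← mem_Rt.1 hc]
      exact rt_eq (hr.trans (gr_reach (by omega) hz' hz))
    · intro hc; exact absurd (mem_Rt.2 (rt_rt z)) hc

theorem total_count {y : Sym2 W → ℕ} (nd : ∀ e, y e ≠ 0 → ¬ e.IsDiag) (hy : (Gr y).IsAcyclic) :
    ∑ e, y e + (Rt (Gr y)).card = Fintype.card W + ∑ c ∈ Rt (Gr y), NN y c := by
  rw [sum_NN, ← edge_count hy]
  have : ∑ e, y e = (Finset.univ.filter fun e => e ∈ (Gr y).edgeSet).card + ∑ e, (y e - 1) := by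
    rw [Finset.card_filter, ← Finset.sum_add_distrib]
    apply Finset.sum_congr rfl
    intro e _
    simp only [gr_edge nd]
    split_ifs <;> omega
  omega

/-! extension by one edge -/
variable {y : Sym2 W → ℕ} {a b : W}

theorem ext_ne {e e' : Sym2 W} : (y + dl e) e' ≠ 0 ↔ y e' ≠ 0 ∨ e' = e := by
  simp only [Pi.add_apply, dl]; split_ifs with h <;> simp [h]

theorem ext_le (e : Sym2 W) : Gr y ≤ Gr (y + dl e) :=
  gr_mono fun e' => by simp

theorem ext_off {u w : W} (h1 : ¬ (Gr y).Reachable a u) (h2 : ¬ (Gr y).Reachable b u)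
    (h : (Gr (y + dl s(a, b))).Reachable u w) : (Gr y).Reachable u w := by
  obtain ⟨p⟩ := h
  have : ∀ {x w : W} (p : (Gr (y + dl s(a, b))).Walk x w), (Gr y).Reachable u x → (Gr y).Reachable u w := by
    intro x w p
    induction p with
    | nil => exact id
    | cons hadj p ih =>
      intro hx
      apply ih
      rw [gr_adj, ext_ne] at hadj
      rcases hadj with ⟨h | h, hne⟩
      · exact hx.trans (SimpleGraph.Adj.reachable (gr_adj.2 ⟨h, hne⟩))
      · exfalso
        rcases Sym2.eq_iff.1 h with ⟨rfl, rfl⟩ | ⟨rfl, rfl⟩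
        · exact h1 hx.symm
        · exact h2 hx.symm
  exact this p (SimpleGraph.Reachable.refl _)

theorem ext_adj (hab : a ≠ b) : (Gr (y + dl s(a, b))).Adj a b :=
  gr_adj.2 ⟨ext_ne.2 (Or.inr rfl), hab⟩

theorem ext_acyclic (hab : a ≠ b) (hy : (Gr y).IsAcyclic) (hc : y s(a, b) ≠ 0 ∨ ¬ (Gr y).Reachable a b) :
    (Gr (y + dl s(a, b))).IsAcyclic := by
  rcases hc with hc | hc
  · have : Gr (y + dl s(a, b)) = Gr y := by
      apply le_antisymm _ (ext_le _)
      apply SimpleGraph.fromEdgeSet_mono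
      intro e he
      rcases ext_ne.1 he with h | h
      · exact h
      · rw [h]; exact hc
    rw [this]; exact hy
  · have h := SimpleGraph.IsAcyclic.sup_edge_of_not_reachable hc hy
    apply h.anti
    intro u v huv
    rw [gr_adj, ext_ne] at huv
    rw [SimpleGraph.sup_adj, SimpleGraph.edge_adj]
    rcases huv with ⟨h | h, hne⟩
    · left; exact gr_adj.2 ⟨h, hne⟩
    · right; refine ⟨?_, hne⟩
      rcases Sym2.eq_iff.1 h with ⟨rfl, rfl⟩ | ⟨rfl, rfl⟩ <;> simp

theorem ext_mm_off {u : W} (h1 : ¬ (Gr y).Reachable a u) (h2 : ¬ (Gr y).Reachable b u) :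
    MM (y + dl s(a, b)) u = MM y u := by
  funext e
  unfold MM
  by_cases he : e = s(a, b)
  · subst he
    rw [if_neg, if_neg]
    · rintro ⟨z, hz, hr⟩
      rcases Sym2.mem_iff.1 hz with rfl | rfl
      · exact h1 hr.symm
      · exact h2 hr.symm
    · rintro ⟨z, hz, hr⟩
      have := ext_off h1 h2 hr
      rcases Sym2.mem_iff.1 hz with rfl | rfl
      · exact h1 this.symm
      · exact h2 this.symm
  · have : (y + dl s(a, b)) e = y e := by simp [dl, he]
    rw [this]
    have h3 : (∃ z ∈ e, (Gr (y + dl s(a, b))).Reachable u z) ↔ ∃ z ∈ e, (Gr y).Reachable u z :=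
      ⟨fun ⟨z, p, q⟩ => ⟨z, p, ext_off h1 h2 q⟩, fun ⟨z, p, q⟩ => ⟨z, p, q.mono (ext_le _)⟩⟩
    simp only [h3]

theorem gr_raise (hc : y s(a, b) ≠ 0) : Gr (y + dl s(a, b)) = Gr y := by
  apply le_antisymm _ (ext_le _)
  apply SimpleGraph.fromEdgeSet_mono
  intro e he
  rcases ext_ne.1 he with h | h
  · exact h
  · rw [h]; exact hc

theorem mm_raise (hc : y s(a, b) ≠ 0) : MM (y + dl s(a, b)) a = MM y a + dl s(a, b) := by
  funext e
  unfold MM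
  rw [gr_raise hc]
  by_cases he : e = s(a, b)
  · subst he
    have : ∃ z ∈ s(a, b), (Gr y).Reachable a z := ⟨a, by simp, SimpleGraph.Reachable.refl _⟩
    simp only [Pi.add_apply, if_pos this, dl, if_true]
    omega
  · simp [dl, he]

theorem mm_merge (hab : a ≠ b) (hc : ¬ (Gr y).Reachable a b) :
    MM (y + dl s(a, b)) a = MM y a + MM y b := by
  have h0 : y s(a, b) = 0 := by
    by_contra h
    exact hc (SimpleGraph.Adj.reachable (gr_adj.2 ⟨h, hab⟩))
  funext e
  simp only [Pi.add_apply]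
  by_cases he : e = s(a, b)
  · subst he
    unfold MM
    simp [h0, dl]
  by_cases h1 : y e = 0
  · unfold MM; simp [h1, dl, he]
  obtain ⟨z, hz⟩ : ∃ z, z ∈ e := ⟨_, Sym2.out_fst_mem e⟩
  have k0 : ∀ x, (∃ z' ∈ e, (Gr y).Reachable x z') ↔ (Gr y).Reachable x z :=
    fun x => ⟨fun ⟨z', p, q⟩ => q.trans (gr_reach h1 p hz), fun q => ⟨z, hz, q⟩⟩
  have h1' : (y + dl s(a, b)) e ≠ 0 := ext_ne.2 (Or.inl h1)
  have k1 : (∃ z' ∈ e, (Gr (y + dl s(a, b))).Reachable a z') ↔ (Gr (y + dl s(a, b))).Reachable a z :=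
    ⟨fun ⟨z', p, q⟩ => q.trans (gr_reach h1' p hz), fun q => ⟨z, hz, q⟩⟩
  have k2 : (Gr (y + dl s(a, b))).Reachable a z ↔ (Gr y).Reachable a z ∨ (Gr y).Reachable b z := by
    constructor
    · intro h
      by_contra hn
      push Not at hn
      exact hn.1 (ext_off hn.1 hn.2 h.symm).symm
    · rintro (h | h)
      · exact h.mono (ext_le _)
      · exact (ext_adj hab).reachable.trans (h.mono (ext_le _))
  unfold MM
  simp only [k0, k1, k2]
  have : (y + dl s(a, b)) e = y e := by simp [dl, he]
  rw [this]
  by_cases h2 : (Gr y).Reachable a z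
  · have h3 : ¬ (Gr y).Reachable b z := fun h => hc (h2.trans h.symm)
    simp [h2, h3]
  · simp [h2]

theorem XH.ext {Hs : Set (Sym2 W)} (hy : XH ty Hs y) (hab : a ≠ b) (hH : s(a, b) ∈ Hs)
    (hc : y s(a, b) ≠ 0 ∨ ¬ (Gr y).Reachable a b)
    (c1 : GoodM (Gr (y + dl s(a, b))) ty (MM (y + dl s(a, b)) a))
    (c2 : ∀ u, ¬ (Gr y).Reachable a u → ¬ (Gr y).Reachable b u → 2 ≤ NN y u →
      2 ≤ NN (y + dl s(a, b)) a → NN y u ≤ 2 ∧ NN (y + dl s(a, b)) a ≤ 2 ∧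
      ∀ k, Pair2 (Gr (y + dl s(a, b))) ty k (MM (y + dl s(a, b)) a) → ¬ Pair2 (Gr y) ty k (MM y u))
    (c3 : ∀ u u', ¬ (Gr y).Reachable a u → ¬ (Gr y).Reachable b u →
      ¬ (Gr y).Reachable a u' → ¬ (Gr y).Reachable b u' → ¬ (Gr y).Reachable u u' → 2 ≤ NN y u →
      2 ≤ NN y u' → 2 ≤ NN (y + dl s(a, b)) a → False) :
    XH ty Hs (y + dl s(a, b)) := by
  have hle : Gr y ≤ Gr (y + dl s(a, b)) := ext_le _
  have hac := ext_acyclic hab hy.ac hc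
  set y' := y + dl s(a, b) with hy'
  have hon : ∀ u, (Gr y).Reachable a u ∨ (Gr y).Reachable b u → (Gr y').Reachable a u := by
    rintro u (h | h)
    · exact h.mono hle
    · exact (ext_adj hab).reachable.trans (h.mono hle)
  have hMon : ∀ u, (Gr y).Reachable a u ∨ (Gr y).Reachable b u → MM y' u = MM y' a :=
    fun u h => (mm_eq_of_reach (hon u h)).symm
  have hNon : ∀ u, (Gr y).Reachable a u ∨ (Gr y).Reachable b u → NN y' u = NN y' a :=
    fun u h => by unfold NN; rw [hMon u h]
  have hMoff : ∀ u, ¬ ((Gr y).Reachable a u ∨ (Gr y).Reachable b u) → MM y' u = MM y u :=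
    fun u h => by push Not at h; exact ext_mm_off h.1 h.2
  have hNoff : ∀ u, ¬ ((Gr y).Reachable a u ∨ (Gr y).Reachable b u) → NN y' u = NN y u :=
    fun u h => by unfold NN; rw [hMoff u h]
  have hdown : ∀ u k, Pair2 (Gr y') ty k (MM y u) → Pair2 (Gr y) ty k (MM y u) :=
    fun u k h => h.down hac hle fun e he => (mm_reach he).2
  refine ⟨?_, ?_, hac, ?_, ?_, ?_⟩
  · intro e he
    rcases ext_ne.1 he with h | rfl
    · exact hy.nd e h
    · simpa using hab
  · intro e he
    rcases ext_ne.1 he with h | rfl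
    · exact hy.sub e h
    · exact hH
  · intro u
    by_cases h : (Gr y).Reachable a u ∨ (Gr y).Reachable b u
    · rw [hMon u h]; exact c1
    · rw [hMoff u h]; exact (hy.good u).up hac hle
  · intro u u' hn h1 h2
    by_cases k1 : (Gr y).Reachable a u ∨ (Gr y).Reachable b u <;>
    by_cases k2 : (Gr y).Reachable a u' ∨ (Gr y).Reachable b u'
    · exact absurd ((hon u k1).symm.trans (hon u' k2)) hn
    · rw [hNon u k1] at h1 ⊢
      rw [hNoff u' k2] at h2 ⊢
      rw [hMon u k1, hMoff u' k2]
      push Not at k2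
      obtain ⟨a1, a2, a3⟩ := c2 u' k2.1 k2.2 h2 h1
      exact ⟨a2, a1, fun k p q => a3 k p (hdown _ _ q)⟩
    · rw [hNoff u k1] at h1 ⊢
      rw [hNon u' k2] at h2 ⊢
      rw [hMoff u k1, hMon u' k2]
      push Not at k1
      obtain ⟨a1, a2, a3⟩ := c2 u k1.1 k1.2 h1 h2
      exact ⟨a1, a2, fun k p q => a3 k q (hdown _ _ p)⟩
    · rw [hNoff u k1] at h1 ⊢
      rw [hNoff u' k2] at h2 ⊢
      rw [hMoff u k1, hMoff u' k2]
      obtain ⟨a1, a2, a3⟩ := hy.gv2 u u' (fun h => hn (h.mono hle)) h1 h2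
      exact ⟨a1, a2, fun k p q => a3 k (hdown _ _ p) (hdown _ _ q)⟩
  · have key : ∀ u u' u'', ¬ (Gr y').Reachable u u' → ¬ (Gr y').Reachable u u'' →
        ¬ (Gr y').Reachable u' u'' → 2 ≤ NN y' u → 2 ≤ NN y' u' → 2 ≤ NN y' u'' →
        ((Gr y).Reachable a u ∨ (Gr y).Reachable b u) → False := by
      intro u u' u'' n1 n2 n3 h1 h2 h3 k1
      have k2 : ¬ ((Gr y).Reachable a u' ∨ (Gr y).Reachable b u') :=
        fun k2 => n1 ((hon u k1).symm.trans (hon u' k2))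
      have k3 : ¬ ((Gr y).Reachable a u'' ∨ (Gr y).Reachable b u'') :=
        fun k2 => n2 ((hon u k1).symm.trans (hon u'' k2))
      rw [hNon u k1] at h1
      rw [hNoff _ k2] at h2
      rw [hNoff _ k3] at h3
      push Not at k2 k3
      exact c3 u' u'' k2.1 k2.2 k3.1 k3.2 (fun h => n3 (h.mono hle)) h2 h3 h1
    intro u u' u'' n1 n2 n3 h1 h2 h3
    by_cases k1 : (Gr y).Reachable a u ∨ (Gr y).Reachable b u
    · exact key u u' u'' n1 n2 n3 h1 h2 h3 k1
    by_cases k2 : (Gr y).Reachable a u' ∨ (Gr y).Reachable b u'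
    · exact key u' u u'' (fun h => n1 h.symm) n3 n2 h2 h1 h3 k2
    by_cases k3 : (Gr y).Reachable a u'' ∨ (Gr y).Reachable b u''
    · exact key u'' u u' (fun h => n2 h.symm) (fun h => n3 h.symm) n1 h3 h1 h2 k3
    rw [hNoff _ k1] at h1
    rw [hNoff _ k2] at h2
    rw [hNoff _ k3] at h3
    exact hy.gv3 u u' u'' (fun h => n1 (h.mono hle)) (fun h => n2 (h.mono hle))
      (fun h => n3 (h.mono hle)) h1 h2 h3

end ext
end TC

namespace TC
section pure
variable {W : Type} {Γ Γ' : SimpleGraph W} {ty : W → Fin 3}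

theorem Pair2.uniq (hΓ : Γ.IsAcyclic) {k k' : Fin 3} {m : Sym2 W → ℕ} (h : Pair2 Γ ty k m)
    (h' : Pair2 Γ ty k' m) : k = k' := by
  obtain ⟨a, b, h1, h2, h3, h4, rfl⟩ := h
  obtain ⟨a', b', g1, g2, g3, g4, e⟩ := h'
  obtain ⟨rfl, rfl⟩ := m2_inj hΓ h1 g1 h2 g2 e
  revert h2 h3 h4 g3 g4
  generalize ty a = x; generalize ty b = z
  revert x z k k'; decide

theorem ext1 (hΓ : Γ.IsAcyclic) {p q x x' : W} (k : Fin 3) (h : Γ.Adj p q) (hx : Γ.Reachable p x)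
    (hx' : Γ.Reachable p x') (tx : ty x = k) (tx' : ty x' ≠ k) :
    ∃ a b, Γ.Reachable a b ∧ a ≠ b ∧ fe Γ a b = s(p, q) ∧
      ((ty a = k ∧ ty b ≠ k) ∨ (ty a ≠ k ∧ ty b = k)) := by
  have key : ∀ z, Γ.Reachable p z → ((p ≠ z ∧ fe Γ p z = s(p, q)) ∨ (q ≠ z ∧ fe Γ q z = s(p, q))) := by
    intro z hz
    rcases adj_cases hΓ h hz with ⟨h1, h2⟩ | ⟨h1, h2⟩
    · exact Or.inl ⟨h1, by rw [fe, ← h2]⟩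
    · exact Or.inr ⟨h1, by rw [fe, ← h2, Sym2.eq_swap]⟩
  have hq := h.symm.reachable
  by_cases tp : ty p = k
  · by_cases tq : ty q = k
    · rcases key x' hx' with ⟨h1, h2⟩ | ⟨h1, h2⟩
      · exact ⟨p, x', hx', h1, h2, Or.inl ⟨tp, tx'⟩⟩
      · exact ⟨q, x', hq.trans hx', h1, h2, Or.inl ⟨tq, tx'⟩⟩
    · exact ⟨p, q, h.reachable, h.ne, by rw [fe, nx_of_adj hΓ h], Or.inl ⟨tp, tq⟩⟩
  · by_cases tq : ty q = k
    · exact ⟨p, q, h.reachable, h.ne, by rw [fe, nx_of_adj hΓ h], Or.inr ⟨tp, tq⟩⟩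
    · rcases key x hx with ⟨h1, h2⟩ | ⟨h1, h2⟩
      · exact ⟨p, x, hx, h1, h2, Or.inr ⟨tp, tx⟩⟩
      · exact ⟨q, x, hq.trans hx, h1, h2, Or.inr ⟨tq, tx⟩⟩

theorem comp_outer (hΓ : Γ.IsAcyclic) {u a b : W} (hb : Btw Γ u a b) (hne : a ≠ b) (tb : ty b < ty u)
    (tab : ty a ≠ ty b) (hno : ∀ x, Btw Γ a x b → ty x ≠ ty u) :
    Full Γ ty (m2 Γ a b + dl (fe Γ u b)) := by
  have hab := hb.2.1
  have hpb := btw_nx_self hab hne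
  have tp := hno _ hpb
  have hau : a ≠ u := by rintro rfl; exact hno _ (btw_left hab) rfl
  have hpa : nx Γ a b ≠ a := nx_ne hab hne
  have b1 : Btw Γ b (nx Γ a b) u := hb.symm.trans_left hpb.symm
  have b2 : Btw Γ (nx Γ a b) a u := hb.symm.trans_right' hpb.symm
  have n1 : nx Γ (nx Γ a b) u = a := by
    rw [← nx_prefix hΓ b2 hpa.symm, nx_nx hΓ hab hne]
  refine ⟨u, b, nx Γ a b, Or.inl ⟨tb, b1, ?_, tp, ?_⟩, ?_⟩
  · intro h; exact tp (by rw [h])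
  · rw [n1, lab_of_ne b2.2.1 hau (hno _ (btw_left hab))]; exact tab
  · have e1 : fe Γ b u = fe Γ b a := by unfold fe; rw [nx_prefix hΓ hb.symm hne]
    have e2 : fe Γ (nx Γ a b) u = fe Γ a b := by unfold fe; rw [n1, Sym2.eq_swap]
    unfold m3 m2
    rw [e1, e2]; abel

theorem ext2 (hΓ : Γ.IsAcyclic) {u v w : W} {k : Fin 3} (h : Γ.Reachable v w) (hu : Γ.Reachable u v)
    (tv : ty v = 0) (tu : ty u = k) (hk : (k = 1 ∧ ty w = 2) ∨ (k = 2 ∧ ty w = 1))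
    (hno : ∀ x, Btw Γ v x w → ty x ≠ k) : Full Γ ty (m2 Γ v w + dl (fe Γ u v)) := by
  have hvw : v ≠ w := by
    rintro rfl; rw [tv] at hk
    rcases hk with ⟨_, h⟩ | ⟨_, h⟩ <;> exact absurd h (by decide)
  have huv : u ≠ v := by rintro rfl; exact hno _ (btw_left h) tu
  have huw : u ≠ w := by rintro rfl; exact hno _ (btw_right h) tu
  have huw' := hu.trans h
  have hnb : ¬ Btw Γ v u w := fun hb => hno _ hb tu
  by_cases c1 : Btw Γ u w v
  · rw [m2_comm]
    apply comp_outer hΓ c1 hvw.symm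
    · rw [tv, tu]; rcases hk with ⟨rfl, _⟩ | ⟨rfl, _⟩ <;> decide
    · rw [tv]; rcases hk with ⟨_, e⟩ | ⟨_, e⟩ <;> rw [e] <;> decide
    · intro x hx; rw [tu]; exact hno x hx.symm
  by_cases c2 : Btw Γ u v w
  · have e0 : fe Γ u v = fe Γ u w := by unfold fe; rw [nx_prefix hΓ c2 huv.symm]
    rw [e0]
    rcases hk with ⟨rfl, e⟩ | ⟨rfl, e⟩
    · refine ⟨w, u, v, Or.inl ⟨by rw [tu, e]; decide, c2, hvw, by rw [tv, e]; decide, ?_⟩, ?_⟩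
      · rw [tu]
        rcases lab_mem (ty := ty) (ty w) (nx_reach' h) with h0 | ⟨x, hx, hxw, hx'⟩
        · rw [h0]; decide
        · rw [← hx']
          exact hno x (btw_of_nx h hvw hx).1
      · have e1 : fe Γ w u = fe Γ w v := by unfold fe; rw [nx_prefix hΓ c2.symm hvw]
        unfold m3 m2
        rw [e1]; abel
    · apply comp_outer hΓ c2 hvw
      · rw [tu, e]; decide
      · rw [tv, e]; decide
      · intro x hx; rw [tu]; exact hno x hx
  rcases hk with ⟨rfl, e⟩ | ⟨rfl, e⟩
  · have hi : Inc3 Γ ty w v u := ⟨e, tv, tu, h, huw', hnb, c2, fun hb => c1 hb.symm⟩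
    have hx := hi.nxs hΓ
    refine ⟨w, v, u, Or.inr hi, ?_⟩
    unfold m3; rw [m2_comm]; unfold fe; rw [hx.2.2.1]
  · have hi : Inc3 Γ ty u v w := ⟨tu, tv, e, hu.symm, huw'.symm, fun hb => c1 hb.symm, 
      fun hb => c2 hb.symm, hnb⟩
    have hx := hi.nxs hΓ
    refine ⟨u, v, w, Or.inr hi, ?_⟩
    unfold m3 m2 fe; rw [hx.2.1, hx.2.2.1]; abel

variable [Fintype W] {y : Sym2 W → ℕ} {a b : W} {Hs : Set (Sym2 W)}

theorem exists_dl {u : W} (h : NN y u = 1) : ∃ f, MM y u = dl f := by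
  obtain ⟨f, hf⟩ := sub_one (m := MM y u) (m' := 0) (by simp) (by simpa [NN] using h)
  exact ⟨f, by simpa using hf⟩

theorem nn_eq_of_reach {u u' : W} (h : (Gr y).Reachable u u') : NN y u = NN y u' := by
  unfold NN; rw [mm_eq_of_reach h]

theorem cross (hac : (Gr (y + dl s(a, b))).IsAcyclic) (hab : a ≠ b) (hn : ¬ (Gr y).Reachable a b)
    {u : W} (hu : (Gr y).Reachable a u) : Btw (Gr (y + dl s(a, b))) u a b := by
  have hadj := ext_adj (y := y) hab
  have hu' := hu.mono (ext_le (y := y) s(a, b))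
  refine ⟨hu'.symm, hadj.reachable, ?_⟩
  rw [dist_adj hadj]
  rcases adj_dist hac hadj hu' with h | h
  · exfalso
    have h1 := nx_unique hac hu' hadj h.symm
    have hne : a ≠ u := by rintro rfl; simp at h
    rw [← nx_local hac (ext_le _) hu hne] at h1
    apply hn
    rw [h1]
    exact nx_reach hu
  · rw [SimpleGraph.dist_comm (u := u) (v := b), SimpleGraph.dist_comm (u := u) (v := a), h]

theorem cross2 (hac : (Gr (y + dl s(a, b))).IsAcyclic) (hab : a ≠ b) (hn : ¬ (Gr y).Reachable a b)
    {u w : W} (hu : (Gr y).Reachable a u) (hw : (Gr y).Reachable b w) :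
    Btw (Gr (y + dl s(a, b))) u b w := by
  have h1 := cross hac hab hn hu
  have hw' := hw.mono (ext_le (y := y) s(a, b))
  by_cases hwb : b = w
  · subst hwb; exact btw_right h1.reach
  have hub : b ≠ u := by rintro rfl; exact hn hu
  apply btw_of_nx_ne hac h1.reach.symm hw' hub hwb
  rw [← nx_prefix hac h1.symm hab, nx_of_adj hac (ext_adj hab).symm,
    ← nx_local hac (ext_le _) hw hwb]
  intro e
  apply hn
  have := (nx_reach hw).symm
  rw [← e] at this
  exact this

theorem XH.ext_free (hy : XH ty Hs y) (hab : a ≠ b) (hH : s(a, b) ∈ Hs)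
    (hc : y s(a, b) ≠ 0 ∨ ¬ (Gr y).Reachable a b)
    (c1 : GoodM (Gr (y + dl s(a, b))) ty (MM (y + dl s(a, b)) a))
    (c2 : ∀ u, ¬ (Gr y).Reachable a u → ¬ (Gr y).Reachable b u → 2 ≤ NN y u → False) :
    XH ty Hs (y + dl s(a, b)) :=
  hy.ext hab hH hc c1 (fun u h1 h2 h3 => (c2 u h1 h2 h3).elim)
    (fun u _ h1 h2 _ _ _ h3 => (c2 u h1 h2 h3).elim)

theorem XH.ext_pair (hy : XH ty Hs y) (hab : a ≠ b) (hH : s(a, b) ∈ Hs)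
    (hc : y s(a, b) ≠ 0 ∨ ¬ (Gr y).Reachable a b) {k k' : Fin 3} (hk : k' ≠ k)
    (c1 : Pair2 (Gr (y + dl s(a, b))) ty k' (MM (y + dl s(a, b)) a))
    (hU : ∀ u, 2 ≤ NN y u → Pair2 (Gr y) ty k (MM y u))
    (hUU : ∀ u u', 2 ≤ NN y u → 2 ≤ NN y u' → (Gr y).Reachable u u') :
    XH ty Hs (y + dl s(a, b)) := by
  have hac := ext_acyclic hab hy.ac hc
  refine hy.ext hab hH hc (Or.inr (Or.inl ⟨k', c1⟩)) ?_ ?_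
  · intro u h1 h2 h3 h4
    refine ⟨(hU u h3).sum.le, c1.sum.le, fun k'' p q => ?_⟩
    exact hk ((c1.uniq hac p).trans (q.uniq hy.ac (hU u h3)))
  · intro u u' _ _ _ _ h h1 h2 _
    exact h (hUU u u' h1 h2)

theorem pair_ne {k : Fin 3} {a b : W} (h : Γ.Reachable a b)
    (ht : (ty a = k ∧ ty b ≠ k) ∨ (ty a ≠ k ∧ ty b = k)) : ∃ k', k' ≠ k ∧ Pair2 Γ ty k' (m2 Γ a b) := by
  have hne : ty a ≠ ty b := by
    rcases ht with ⟨h1, h2⟩ | ⟨h1, h2⟩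
    · rw [h1]; exact h2.symm
    · rw [h2]; exact h1
  obtain ⟨k', h1, h2⟩ := third_type (ty a) (ty b)
  refine ⟨k', ?_, mk_pair_k h hne h1 h2⟩
  rcases ht with ⟨h3, h4⟩ | ⟨h3, h4⟩
  · rw [← h3]; exact h1.symm
  · rw [← h4]; exact h2.symm

theorem ps1 (hy : XH ty Hs y) {k : Fin 3} {x x' : W} (hr : (Gr y).Reachable x x') (tx : ty x = k)
    (tx' : ty x' ≠ k) (hN : NN y x = 1) (hU : ∀ u, 2 ≤ NN y u → Pair2 (Gr y) ty k (MM y u))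
    (hUU : ∀ u u', 2 ≤ NN y u → 2 ≤ NN y u' → (Gr y).Reachable u u') :
    ∃ a b, XH ty Hs (y + dl s(a, b)) := by
  obtain ⟨f, hf⟩ := exists_dl hN
  have hm := mm_reach (y := y) (u := x) (e := f) (by rw [hf]; simp [dl])
  induction f using Sym2.ind with | _ p q => ?_
  have hadj : (Gr y).Adj p q := by
    rw [gr_adj]; refine ⟨by omega, ?_⟩
    have := hy.nd s(p, q) (by omega)
    simpa using this
  have hp := hm.2 p (by simp)
  obtain ⟨a, b, h1, h2, h3, h4⟩ := ext1 hy.ac k hadj hp.symm (hp.symm.trans hr) tx tx'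
  have hadj' := nx_adj h1.symm h2.symm
  have hy0 := (gr_adj.1 hadj').1
  refine ⟨b, nx (Gr y) b a, ?_⟩
  have hrb : (Gr y).Reachable x b := by
    have : a ∈ s(p, q) := by rw [← h3]; simp [fe]
    exact (hm.2 a this).trans h1
  obtain ⟨k', hk', hP⟩ := pair_ne h1 h4
  refine hy.ext_pair hadj'.ne (hy.sub _ hy0) (Or.inl hy0) hk' ?_ hU hUU
  rw [mm_raise hy0, gr_raise hy0, ← mm_eq_of_reach hrb, hf, ← h3]
  exact hP

theorem ps2 (hy : XH ty Hs y) {k : Fin 3} (hH : s(a, b) ∈ Hs) (ta : ∀ u, (Gr y).Reachable a u → ty u = k)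
    (tb : ∀ u, (Gr y).Reachable b u → ty u ≠ k) (hNa : NN y a = 1) (hNb : NN y b = 1)
    (hU : ∀ u, 2 ≤ NN y u → Pair2 (Gr y) ty k (MM y u))
    (hUU : ∀ u u', 2 ≤ NN y u → 2 ≤ NN y u' → (Gr y).Reachable u u') :
    XH ty Hs (y + dl s(a, b)) := by
  have hn : ¬ (Gr y).Reachable a b := fun h => 
    tb b (SimpleGraph.Reachable.refl _) (ta b h)
  have hab : a ≠ b := by rintro rfl; exact hn (SimpleGraph.Reachable.refl _)
  have hac := ext_acyclic hab hy.ac (Or.inr hn)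
  have hle := ext_le (y := y) s(a, b)
  have key : ∀ {x z : W} (_ : NN y x = 1) (_ : (Gr (y + dl s(a, b))).Reachable x z), ∃ u, MM y x = dl (fe (Gr (y + dl s(a, b))) u z) ∧
      u ≠ z ∧ (Gr y).Reachable x u := by
    intro x z hx hz
    obtain ⟨f, hf⟩ := exists_dl hx
    have hm := mm_reach (y := y) (u := x) (e := f) (by rw [hf]; simp [dl])
    induction f using Sym2.ind with | _ p q => ?_
    have hadj : (Gr y).Adj p q := by
      rw [gr_adj]; refine ⟨by omega, ?_⟩
      have := hy.nd s(p, q) (by omega)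
      simpa using this
    obtain ⟨u, h1, h2, h3⟩ := fe_surj hac (hle hadj) (((hm.2 p (by simp)).symm.mono hle).trans hz)
    refine ⟨u, by rw [h3, hf], h1, hm.2 u ?_⟩
    rw [← h3]; simp [fe]
  have hadj := (ext_adj (y := y) hab).reachable
  obtain ⟨u1, e1, n1, r1⟩ := key hNa hadj
  obtain ⟨u2, e2, n2, r2⟩ := key hNb hadj.symm
  have b1 := cross2 hac hab hn r1 r2
  have b2 : Btw (Gr (y + dl s(a, b))) u2 a u1 := by
    have hs : s(a, b) = s(b, a) := Sym2.eq_swap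
    rw [hs] at hac ⊢
    exact cross2 hac hab.symm (fun h => hn h.symm) r2 r1
  obtain ⟨k', hk', hP⟩ := pair_ne (ty := ty) (k := k) b1.reach (Or.inl ⟨ta u1 r1, tb u2 r2⟩)
  refine hy.ext_pair hab hH (Or.inr hn) hk' ?_ hU hUU
  rw [mm_merge hab hn, e1, e2]
  convert hP using 1
  unfold m2 fe
  rw [nx_prefix hac b1 n1.symm, nx_prefix hac b2 n2.symm]

theorem pairstep (hy : XH ty Hs y) {k : Fin 3} (cut : ∃ a b, s(a, b) ∈ Hs ∧ ty a = k ∧ ty b ≠ k)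
    (hU : ∀ u, 2 ≤ NN y u → Pair2 (Gr y) ty k (MM y u))
    (hUU : ∀ u u', 2 ≤ NN y u → 2 ≤ NN y u' → (Gr y).Reachable u u')
    (h1 : ∀ u, ¬ 2 ≤ NN y u → NN y u = 1) (hk : ∀ u, 2 ≤ NN y u → ty u ≠ k) :
    (∃ a b, XH ty Hs (y + dl s(a, b))) ∨
    (∃ a b, s(a, b) ∈ Hs ∧ (∀ u, (Gr y).Reachable a u → ty u = k) ∧ NN y a = 1 ∧ 2 ≤ NN y b) := by
  obtain ⟨a, b, hH, ta, tb⟩ := cut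
  have ha : NN y a = 1 := h1 a fun h => hk a h ta
  by_cases hpa : ∀ u, (Gr y).Reachable a u → ty u = k
  swap
  · push Not at hpa
    obtain ⟨u, hu, tu⟩ := hpa
    exact Or.inl (ps1 hy hu ta tu ha hU hUU)
  by_cases hb : 2 ≤ NN y b
  · exact Or.inr ⟨a, b, hH, hpa, ha, hb⟩
  left
  by_cases hpb : ∀ u, (Gr y).Reachable b u → ty u ≠ k
  · exact ⟨a, b, ps2 hy hH hpa hpb ha (h1 b hb) hU hUU⟩
  · push Not at hpb
    obtain ⟨u, hu, tu⟩ := hpb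
    exact ps1 hy hu.symm tu tb (by rw [← nn_eq_of_reach hu]; exact h1 b hb) hU hUU

end pure
end TC

namespace TC
section pure3
variable {W : Type} {Γ Γ' : SimpleGraph W} {ty : W → Fin 3}
variable [Fintype W] {y : Sym2 W → ℕ} {a b : W} {Hs : Set (Sym2 W)}

theorem pureA (hy : XH ty Hs y) {u : W} (h0 : NN y u = 0) (Hnb : ∃ w', w' ≠ u ∧ s(u, w') ∈ Hs) :
    ∃ a b, XH ty Hs (y + dl s(a, b)) := by
  by_cases hx : ∃ x, (Gr y).Adj u x
  · obtain ⟨x, hx⟩ := hx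
    have hy0 := (gr_adj.1 hx).1
    have hN : NN (y + dl s(u, x)) u = 1 := by
      unfold NN
      rw [mm_raise hy0]
      simp only [Pi.add_apply, Finset.sum_add_distrib, dl_sum]
      unfold NN at h0; omega
    refine ⟨u, x, hy.ext hx.ne (hy.sub _ hy0) (Or.inl hy0) (Or.inl hN.le) ?_ ?_⟩
    · intro _ _ _ _ h; omega
    · intro _ _ _ _ _ _ _ _ _ h; omega
  · obtain ⟨x, hne, hH⟩ := Hnb
    have hn : ¬ (Gr y).Reachable u x := fun h => hx ⟨_, nx_adj h hne.symm⟩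
    have hM0 : MM y u = 0 := by
      unfold NN at h0
      funext e
      exact (Finset.sum_eq_zero_iff.1 h0) e (Finset.mem_univ e)
    have hle := ext_le (y := y) s(u, x)
    have hac := ext_acyclic hne.symm hy.ac (Or.inr hn)
    have hM : MM (y + dl s(u, x)) u = MM y x := by rw [mm_merge hne.symm hn, hM0, zero_add]
    have hN : NN (y + dl s(u, x)) u = NN y x := by unfold NN; rw [hM]
    refine ⟨u, x, hy.ext hne.symm hH (Or.inr hn) ?_ ?_ ?_⟩
    · rw [hM]; exact (hy.good x).up hac hle
    · intro z h1 h2 h3 h4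
      rw [hN] at h4 ⊢
      rw [hM]
      obtain ⟨g1, g2, g3⟩ := hy.gv2 x z h2 h4 h3
      refine ⟨g2, g1, fun k hk => g3 k (hk.down hac hle (u := x) ?_)⟩
      intro e he z hz
      exact (mm_reach he).2 z hz
    · intro z z' h1 h2 h3 h4 h5 h6 h7 h8
      rw [hN] at h8
      exact hy.gv3 x z z' h2 h4 h5 h8 h6 h7

theorem one_big (hlt : ∑ c ∈ Rt (Gr y), NN y c < (Rt (Gr y)).card + 2) (h1 : ∀ u, NN y u ≠ 0)
    {c : W} (hc : 2 ≤ NN y c) : NN y c = 2 ∧ ∀ u, 2 ≤ NN y u → (Gr y).Reachable c u := by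
  have hr : ∀ u, rt (Gr y) u ∈ Rt (Gr y) := fun u => mem_Rt.2 (rt_rt u)
  have hN : ∀ u, NN y (rt (Gr y) u) = NN y u := fun u => nn_eq_of_reach (rt_reach u)
  have hs : ∑ c ∈ Rt (Gr y), (NN y c - 1) < 2 := by
    have : ∑ c ∈ Rt (Gr y), NN y c = ∑ c ∈ Rt (Gr y), (NN y c - 1) + (Rt (Gr y)).card := by
      rw [Finset.card_eq_sum_ones, ← Finset.sum_add_distrib]
      refine Finset.sum_congr rfl fun i _ => ?_
      have := h1 i; omega
    omega
  constructor
  · have := Finset.single_le_sum (f := fun c => NN y c - 1) (fun _ _ => Nat.zero_le _) (hr c)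
    simp only [hN] at this
    omega
  · intro u hu
    by_contra hn
    have hne : rt (Gr y) c ≠ rt (Gr y) u := by
      intro h
      apply hn
      have h2 := rt_reach (Γ := Gr y) c
      rw [h] at h2
      exact h2.symm.trans (rt_reach u)
    have := Finset.sum_le_sum_of_subset (f := fun c => NN y c - 1)
      (show {rt (Gr y) c, rt (Gr y) u} ⊆ Rt (Gr y) by
        intro x hx
        simp at hx
        rcases hx with rfl | rfl <;> exact hr _)
    rw [Finset.sum_pair hne] at this
    simp only [hN] at this
    omega

theorem raise_full (hy : XH ty Hs y) {c u r : W} (hur : (Gr y).Reachable u r) (hne : u ≠ r)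
    (hcu : (Gr y).Reachable c u) (hF : Full (Gr y) ty (MM y c + dl (fe (Gr y) u r)))
    (hbig : ∀ u, 2 ≤ NN y u → (Gr y).Reachable c u) :
    ∃ a b, XH ty Hs (y + dl s(a, b)) := by
  have hadj := nx_adj hur hne
  have hy0 := (gr_adj.1 hadj).1
  refine ⟨u, nx (Gr y) u r, hy.ext_free hadj.ne (hy.sub _ hy0) (Or.inl hy0) ?_ ?_⟩
  · rw [mm_raise hy0, gr_raise hy0, ← mm_eq_of_reach hcu]
    exact Or.inr (Or.inr hF)
  · intro z h1 _ h3
    exact h1 (hcu.symm.trans (hbig z h3))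

theorem pureC (hy : XH ty Hs y) (h1 : ∀ u, NN y u ≠ 0)
    (hcut : ∀ k : Fin 3, k ≠ 0 → ∃ a b, s(a, b) ∈ Hs ∧ ty a = k ∧ ty b ≠ k)
    {c : W} (hc2 : NN y c = 2) (hbig : ∀ u, 2 ≤ NN y u → (Gr y).Reachable c u) :
    ∃ a b, XH ty Hs (y + dl s(a, b)) := by
  obtain ⟨k, hP⟩ : ∃ k, Pair2 (Gr y) ty k (MM y c) := by
    rcases hy.good c with h | h | h
    · unfold NN at hc2; omega
    · exact h
    · have := h.sum; unfold NN at hc2; omega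
  have hP0 := hP
  obtain ⟨v, w, hr, ht, hvk, hwk, hM⟩ := hP
  have hvw : v ≠ w := by rintro rfl; exact lt_irrefl _ ht
  have hcv : (Gr y).Reachable c v := by
    have : MM y c (fe (Gr y) v w) ≠ 0 := by rw [hM]; exact m2_ne.2 (by simp)
    exact (mm_reach this).2 v (by simp [fe])
  by_cases hcp : ∃ p, Comp3 (Gr y) ty w v p
  · obtain ⟨p, hp⟩ := hcp
    have hp' := hp
    obtain ⟨_, hb, hpw, _, _⟩ := hp'
    refine raise_full hy hb.2.1 hpw (hcv.trans hb.1) ⟨w, v, p, Or.inl hp, ?_⟩ hbig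
    rw [hM]; unfold m3; rw [m2_comm]
  have hcard : (Finset.univ.filter fun p => Comp3 (Gr y) ty w v p).card = 0 := by
    rw [Finset.card_eq_zero, Finset.filter_eq_empty_iff]
    intro p _ hp; exact hcp ⟨p, hp⟩
  rw [comp_card hy.ac hr ht] at hcard
  have tv : ty v = 0 := by
    by_contra h
    rw [if_pos (Ne.symm h)] at hcard; omega
  have hk0 : k ≠ 0 := by rintro rfl; exact hvk tv
  have hno : ∀ x, Btw (Gr y) v x w → ty x ≠ k := by
    intro x hx tx
    have : x ∈ (Finset.univ.filter fun x => Btw (Gr y) v x w ∧ ty x ≠ ty w ∧ ty x ≠ ty v) := by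
      simp only [Finset.mem_filter, Finset.mem_univ, true_and]
      exact ⟨hx, by rw [tx]; exact hwk.symm, by rw [tx]; exact hvk.symm⟩
    have := Finset.card_pos.2 ⟨x, this⟩
    omega
  have hkk : (k = 1 ∧ ty w = 2) ∨ (k = 2 ∧ ty w = 1) := by
    rw [tv] at ht
    revert ht hwk hk0
    generalize ty w = z
    clear * -
    revert k z; decide
  by_cases hu : ∃ u, (Gr y).Reachable u v ∧ ty u = k
  · obtain ⟨u, hu, tu⟩ := hu
    refine raise_full hy hu (by rintro rfl; exact hvk tu) (hcv.trans hu.symm) ?_ hbig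
    rw [hM]
    exact ext2 hy.ac hr hu tv tu hkk hno
  have hnk : ∀ u, 2 ≤ NN y u → ty u ≠ k := fun u h tu =>
    hu ⟨u, (hbig u h).symm.trans hcv, tu⟩
  rcases pairstep hy (hcut k hk0) (fun u h => by rw [← mm_eq_of_reach (hbig u h)]; exact hP0)
    (fun u u' h h' => (hbig u h).symm.trans (hbig u' h'))
    (fun u h => by have := h1 u; omega) hnk with h | ⟨a, b, hH, ta, ha, hb⟩
  · exact h
  have hn : ¬ (Gr y).Reachable a b := fun h => hnk b hb (ta b h)
  have hab : a ≠ b := by rintro rfl; exact hn (SimpleGraph.Reachable.refl _)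
  have hac := ext_acyclic hab hy.ac (Or.inr hn)
  have hle := ext_le (y := y) s(a, b)
  refine ⟨a, b, hy.ext_free hab hH (Or.inr hn) ?_ ?_⟩
  · obtain ⟨f, hf⟩ := exists_dl ha
    have hm := mm_reach (y := y) (u := a) (e := f) (by rw [hf]; simp [dl])
    induction f using Sym2.ind with | _ p q => ?_
    have hadj : (Gr y).Adj p q := by
      rw [gr_adj]; refine ⟨by omega, ?_⟩
      have := hy.nd s(p, q) (by omega)
      simpa using this
    have hcb := hbig b hb
    have hpv : (Gr (y + dl s(a, b))).Reachable p v :=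
      (((hm.2 p (by simp)).symm.mono hle).trans (ext_adj hab).reachable).trans
        ((hcb.symm.trans hcv).mono hle)
    obtain ⟨u0, n0, r0, e0⟩ := fe_surj hac (hle hadj) hpv
    have hu0 : (Gr y).Reachable a u0 := hm.2 u0 (by rw [← e0]; simp [fe])
    rw [mm_merge hab hn, hf, ← mm_eq_of_reach hcb, hM, ← e0, add_comm (dl _) (m2 _ _ _),
      m2_local hac hle hr hvw]
    refine Or.inr (Or.inr (ext2 hac (hr.mono hle) r0 tv (ta u0 hu0) hkk ?_))
    intro x hx
    exact hno x ((btw_local hac hle hr).2 hx)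
  · intro z _ h2 h3
    exact h2 ((hbig b hb).symm.trans (hbig z h3))

theorem pure (hy : XH ty Hs y) (hsum : ∑ e, y e < Fintype.card W + 2)
    (Hnb : ∀ w, ∃ w', w' ≠ w ∧ s(w, w') ∈ Hs)
    (hcut : ∀ k : Fin 3, k ≠ 0 → ∃ a b, s(a, b) ∈ Hs ∧ ty a = k ∧ ty b ≠ k) :
    ∃ a b, XH ty Hs (y + dl s(a, b)) := by
  by_cases h0 : ∃ u, NN y u = 0
  · obtain ⟨u, h0⟩ := h0
    exact pureA hy h0 (Hnb u)
  push Not at h0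
  have hlt : ∑ c ∈ Rt (Gr y), NN y c < (Rt (Gr y)).card + 2 := by
    have := total_count hy.nd hy.ac; omega
  by_cases hc : ∃ c, 2 ≤ NN y c
  · obtain ⟨c, hc⟩ := hc
    obtain ⟨g1, g2⟩ := one_big hlt h0 hc
    exact pureC hy h0 hcut g1 g2
  · push Not at hc
    have hc' : ∀ u, ¬ 2 ≤ NN y u := fun u => by have := hc u; omega
    rcases pairstep hy (hcut 2 (by decide)) (fun u h => (hc' u h).elim)
      (fun u _ h => (hc' u h).elim) (fun u h => by have := h0 u; omega)
      (fun u h => (hc' u h).elim) with h | ⟨_, b, _, _, _, h⟩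
    · exact h
    · exact (hc' b h).elim

end pure3
end TC

namespace TC
section datsec
variable {V : Type} [Fintype V] [LinearOrder V] [LinearOrder (Sym2 V)]

/-- parent of a vertex -/
noncomputable def par (G : SimpleGraph V) (v0 v1 v2 v : V) : V :=
  if G.Adj v0 v then v0 else if G.Adj v1 v then v1 else v2

/-- the combinatorial data used in the proof -/
structure Dat (G : SimpleGraph V) (v0 v1 v2 : V) (B0 : Set (Sym2 V)) (pr : V → V) : Prop where
  h01 : v0 ≠ v1
  h02 : v0 ≠ v2
  h12 : v1 ≠ v2
  par1 : pr v1 = v0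
  par2 : pr v2 = v0
  parm : ∀ v, pr v = v0 ∨ pr v = v1 ∨ pr v = v2
  adj : ∀ v, v ≠ v0 → G.Adj v (pr v)
  hB : ∀ e, e ∈ B0 ↔ ∃ v, v ≠ v0 ∧ e = s(v, pr v)
  mono : ∀ u v, u ≠ v0 → v ≠ v0 → u < v → s(u, pr u) < s(v, pr v)
  bH : ∀ v e, v ≠ v0 → e ∈ G.edgeSet → e ∉ B0 → s(v, pr v) < e
  H0 : ∀ e, e ∈ G.edgeSet → e ∉ B0 → v0 ∉ e
  lt1 : ∀ v, v ≠ v0 → v1 ≤ v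
  lt2 : ∀ v, v ≠ v0 → v ≠ v1 → v2 ≤ v

theorem conn_of_base {W : Type} {Γ : SimpleGraph W} (v0 : W) (h : ∀ v, Γ.Reachable v v0) : Γ.Connected := by
  haveI : Nonempty W := ⟨v0⟩
  exact ⟨fun a b => (h a).trans (h b).symm⟩

/-- closed sets in connected graphs -/
theorem closed_conn {W : Type} {Γ : SimpleGraph W} {P : W → Prop} 
    (hc : ∀ a b, Γ.Adj a b → P a → P b) {a b : W} (h : Γ.Reachable a b) (ha : P a) : P b := by
  obtain ⟨p⟩ := h
  induction p with
  | nil => exact ha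
  | cons hadj _ ih => exact ih (hc _ _ hadj ha)

theorem tree_iff (G : SimpleGraph V) (T : Set (Sym2 V)) : IsSpanningTree G T ↔
    T ⊆ G.edgeSet ∧ (SimpleGraph.fromEdgeSet T).Connected ∧ T.ncard + 1 = Fintype.card V := by
  unfold IsSpanningTree
  refine and_congr_right fun h => ?_
  rw [SimpleGraph.isTree_iff_connected_and_card, Nat.card_eq_fintype_card (α := V)]
  have : (SimpleGraph.fromEdgeSet T).edgeSet = T := by
    rw [SimpleGraph.edgeSet_fromEdgeSet]
    ext e
    simp only [Set.mem_diff]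
    refine ⟨fun h => h.1, fun he => ⟨he, ?_⟩⟩
    exact fun hd => G.not_isDiag_of_mem_edgeSet (h he) hd
  rw [this]
  rfl

theorem ncard_eq_of_tree {G : SimpleGraph V} {T T' : Set (Sym2 V)} (h : IsSpanningTree G T)
    (h' : IsSpanningTree G T') : T.ncard = T'.ncard := by
  have := ((tree_iff G T).1 h).2.2
  have := ((tree_iff G T').1 h').2.2
  omega

theorem mk_dat {G : SimpleGraph V} {v0 v1 v2 : V} {B0 : Set (Sym2 V)}
    (hG : IsTriconed G v0 v1 v2)
    (hvo : VertexOrderSpec G v0 v1 v2)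
    (heo : EdgeOrderSpec G v0 v1 v2)
    (hB0 : IsMinSpanningTree G B0) : Dat G v0 v1 v2 B0 (par G v0 v1 v2) := by
  obtain ⟨hc, h01, h02, h12, a1, a2, hcone⟩ := hG
  obtain ⟨o1, o2, o3, o4, o5⟩ := hvo
  have p0 : ∀ v, G.Adj v0 v → par G v0 v1 v2 v = v0 := fun v h => by simp [par, h]
  have p1 : ∀ v, ¬ G.Adj v0 v → G.Adj v1 v → par G v0 v1 v2 v = v1 := fun v h h' => by simp [par, h, h']
  have p2 : ∀ v, ¬ G.Adj v0 v → ¬ G.Adj v1 v → par G v0 v1 v2 v = v2 := fun v h h' => by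
    simp [par, h, h']
  have adj : ∀ v, v ≠ v0 → G.Adj v (par G v0 v1 v2 v) := by
    intro v hv
    by_cases h0 : G.Adj v0 v
    · rw [p0 v h0]; exact h0.symm
    by_cases h1 : G.Adj v1 v
    · rw [p1 v h0 h1]; exact h1.symm
    rw [p2 v h0 h1]
    rcases hcone v hv (by rintro rfl; exact h0 a1) (by rintro rfl; exact h0 a2) with h | h | h
    · exact (h0 h).elim
    · exact (h1 h).elim
    · exact h.symm
  have hlt1 : ∀ v, v ≠ v0 → v1 ≤ v := by
    intro v hv
    by_cases h1 : v = v1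
    · exact h1.ge
    by_cases h2 : v = v2
    · exact h2 ▸ o2.le
    · exact o2.le.trans (o3 v hv h1 h2).le
  have hlt2 : ∀ v, v ≠ v0 → v ≠ v1 → v2 ≤ v := by
    intro v hv h1
    by_cases h2 : v = v2
    · exact h2.ge
    · exact (o3 v hv h1 h2).le
  set pr := par G v0 v1 v2 with hpr
  have bl0 : ∀ v, v ≠ v0 → G.Adj v0 v → edgeBlock G v0 v1 v2 s(v, pr v) = 0 := by
    intro v hv h
    rw [p0 v h]; simp [edgeBlock]
  have bl1 : ∀ v, v ≠ v0 → ¬ G.Adj v0 v → G.Adj v1 v → edgeBlock G v0 v1 v2 s(v, pr v) = 1 := by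
    intro v hv h h1
    rw [p1 v h h1]
    unfold edgeBlock
    rw [if_neg (by simp [h01, hv.symm]), if_pos ⟨v, Sym2.eq_swap, h⟩]
  have bl2 : ∀ v, v ≠ v0 → ¬ G.Adj v0 v → ¬ G.Adj v1 v → edgeBlock G v0 v1 v2 s(v, pr v) = 2 := by
    intro v hv h h1
    rw [p2 v h h1]
    unfold edgeBlock
    rw [if_neg (by simp [h02, hv.symm]), if_neg, if_pos ⟨v, Sym2.eq_swap, h, h1⟩]
    rintro ⟨x, hx, hx'⟩
    rw [Sym2.eq_iff] at hx
    rcases hx with ⟨rfl, rfl⟩ | ⟨rfl, hx⟩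
    · exact h a1
    · exact h12 hx.symm
  have ble : ∀ v, v ≠ v0 → edgeBlock G v0 v1 v2 s(v, pr v) ≤ 2 := by
    intro v hv
    by_cases h0 : G.Adj v0 v
    · rw [bl0 v hv h0]; omega
    by_cases h1 : G.Adj v1 v
    · rw [bl1 v hv h0 h1]; omega
    · rw [bl2 v hv h0 h1]
  have bl3 : ∀ e, e ∈ G.edgeSet → (¬ ∃ v, v ≠ v0 ∧ e = s(v, pr v)) →
      v0 ∉ e ∧ edgeBlock G v0 v1 v2 e = 3 := by
    intro e he hn
    have g0 : v0 ∉ e := by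
      intro h
      obtain ⟨x, rfl⟩ := Sym2.mem_iff_exists.1 h
      have hadj : G.Adj v0 x := he
      exact hn ⟨x, hadj.ne.symm, by rw [p0 x hadj]; exact Sym2.eq_swap⟩
    refine ⟨g0, ?_⟩
    unfold edgeBlock
    rw [if_neg g0, if_neg, if_neg]
    · rintro ⟨x, rfl, h0, h1⟩
      exact hn ⟨x, by rintro rfl; simp at g0, by rw [p2 x h0 h1]; exact Sym2.eq_swap⟩
    · rintro ⟨x, rfl, h0⟩
      have hadj : G.Adj v1 x := he
      exact hn ⟨x, by rintro rfl; simp at g0, by rw [p1 x h0 hadj]; exact Sym2.eq_swap⟩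
  have pr1 : pr v1 = v0 := p0 v1 a1
  have pr2 : pr v2 = v0 := p0 v2 a2
  have prm : ∀ v, pr v = v0 ∨ pr v = v1 ∨ pr v = v2 := by
    intro v; simp only [hpr, par]; split_ifs <;> simp
  set P : Set (Sym2 V) := {e | ∃ v, v ≠ v0 ∧ e = s(v, pr v)} with hP
  have hinj : ∀ u v, u ≠ v0 → v ≠ v0 → s(u, pr u) = s(v, pr v) → u = v := by
    intro u v hu hv h
    rw [Sym2.eq_iff] at h
    rcases h with ⟨h, _⟩ | ⟨h1, h2⟩
    · exact h
    · rcases prm v with h | h | h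
      · exact (hu (h1.trans h)).elim
      · rw [h1.trans h, pr1] at h2; exact (hv h2.symm).elim
      · rw [h1.trans h, pr2] at h2; exact (hv h2.symm).elim
  have hPe : P ⊆ G.edgeSet := by
    rintro e ⟨v, hv, rfl⟩; exact adj v hv
  have hPtree : IsSpanningTree G P := by
    rw [tree_iff]
    refine ⟨hPe, ?_, ?_⟩
    · apply conn_of_base v0
      have st : ∀ v, v ≠ v0 → (SimpleGraph.fromEdgeSet P).Adj v (pr v) := by
        intro v hv
        rw [SimpleGraph.fromEdgeSet_adj]
        exact ⟨⟨v, hv, rfl⟩, (adj v hv).ne⟩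
      have r1 := (st v1 h01.symm).reachable
      have r2 := (st v2 h02.symm).reachable
      rw [pr1] at r1; rw [pr2] at r2
      intro v
      by_cases hv : v = v0
      · rw [hv]
      · have r := (st v hv).reachable
        rcases prm v with h | h | h <;> rw [h] at r
        · exact r
        · exact r.trans r1
        · exact r.trans r2
    · have : P = (fun v => s(v, pr v)) '' {v | v ≠ v0} := by
        ext e; constructor
        · rintro ⟨v, hv, rfl⟩; exact ⟨v, hv, rfl⟩
        · rintro ⟨v, hv, rfl⟩; exact ⟨v, hv, rfl⟩
      have hi : Set.InjOn (fun v => s(v, pr v)) {v | v ≠ v0} := fun u hu v hv h => hinj u v hu hv h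
      rw [this, Set.ncard_image_of_injOn hi]
      have h2 : ({v | v ≠ v0} : Set V) = {v0}ᶜ := by ext; simp
      rw [h2]
      have := Set.ncard_add_ncard_compl ({v0} : Set V)
      rw [Set.ncard_singleton, Nat.card_eq_fintype_card] at this
      omega
  have hBP : B0 = P := by
    by_contra hne
    obtain ⟨e, he, he', hmin⟩ := hB0.2 P hPtree (Ne.symm hne)
    have hcard := ncard_eq_of_tree hB0.1 hPtree
    have : ¬ P ⊆ B0 := by
      intro hs
      have := Set.eq_of_subset_of_ncard_le hs hcard.le (Set.toFinite _)
      exact he' (this ▸ he)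
    obtain ⟨f, hf, hf'⟩ := Set.not_subset.1 this
    have h1 := hmin f (Or.inr ⟨hf, hf'⟩) (by rintro rfl; exact hf' he)
    have heE := hB0.1.1 he
    have h3 := (bl3 e heE he').2
    obtain ⟨v, hv, rfl⟩ := hf
    have h4 := heo.1 s(v, pr v) (adj v hv) e heE (by have := ble v hv; rw [h3]; omega)
    exact lt_asymm h1 h4
  refine ⟨h01, h02, h12, pr1, pr2, prm, adj, ?_, ?_, ?_, ?_, hlt1, hlt2⟩
  · intro e; rw [hBP]; rfl
  · intro u v hu hv huv
    have key : ∀ c, G.Adj c u → G.Adj c v → pr u = c → pr v = c → (c ≤ u) → (c ≤ v) → 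
        edgeBlock G v0 v1 v2 s(u, pr u) = edgeBlock G v0 v1 v2 s(v, pr v) → s(u, pr u) < s(v, pr v) := by
      intro c h1 h2 e1 e2 l1 l2 hbl
      apply heo.2 _ (adj u hu) _ (adj v hv) hbl (ble u hu)
      right
      rw [e1, e2]
      simp only [sym2Min, sym2Max, Sym2.lift_mk]
      rw [min_eq_right l1, min_eq_right l2, max_eq_left l1, max_eq_left l2]
      exact ⟨rfl, huv⟩
    have l0 : ∀ v, v ≠ v0 → v0 ≤ v := fun v hv => o1.le.trans (hlt1 v hv)
    have nsp : ∀ w, w ≠ v0 → ¬ G.Adj v0 w → w ≠ v1 ∧ w ≠ v2 := by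
      intro w _ h
      exact ⟨by rintro rfl; exact h a1, by rintro rfl; exact h a2⟩
    by_cases hu0 : G.Adj v0 u
    · by_cases hv0 : G.Adj v0 v
      · exact key v0 hu0 hv0 (p0 u hu0) (p0 v hv0) (l0 u hu) (l0 v hv) (by rw [bl0 u hu hu0, bl0 v hv hv0])
      · apply heo.1 _ (adj u hu) _ (adj v hv)
        rw [bl0 u hu hu0]
        by_cases hv1 : G.Adj v1 v
        · rw [bl1 v hv hv0 hv1]; omega
        · rw [bl2 v hv hv0 hv1]; omega
    · have nu := nsp u hu hu0
      have hv0 : ¬ G.Adj v0 v := by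
        intro h
        by_cases e1 : v = v1
        · exact not_lt.2 (hlt1 u hu) (e1 ▸ huv)
        by_cases e2 : v = v2
        · exact not_lt.2 (hlt2 u hu nu.1) (e2 ▸ huv)
        exact lt_asymm huv (o4 v u hv e1 e2 hu nu.1 nu.2 h hu0)
      have nv := nsp v hv hv0
      by_cases hu1 : G.Adj v1 u
      · by_cases hv1 : G.Adj v1 v
        · exact key v1 hu1 hv1 (p1 u hu0 hu1) (p1 v hv0 hv1) (hlt1 u hu) (hlt1 v hv)
            (by rw [bl1 u hu hu0 hu1, bl1 v hv hv0 hv1])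
        · apply heo.1 _ (adj u hu) _ (adj v hv)
          rw [bl1 u hu hu0 hu1, bl2 v hv hv0 hv1]; omega
      · have hv1 : ¬ G.Adj v1 v := fun h =>
          lt_asymm huv (o5 v u hv nv.1 nv.2 hu nu.1 nu.2 hv0 hu0 h hu1)
        have qu := p2 u hu0 hu1
        have qv := p2 v hv0 hv1
        exact key v2 (by rw [← qu]; exact (adj u hu).symm) (by rw [← qv]; exact (adj v hv).symm)
          qu qv (hlt2 u hu nu.1) (hlt2 v hv nv.1) (by rw [bl2 u hu hu0 hu1, bl2 v hv hv0 hv1])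
  · intro v e hv he he'
    apply heo.1 _ (adj v hv) e he
    rw [(bl3 e he (by rw [hBP] at he'; exact he')).2]
    have := ble v hv; omega
  · intro e he he'
    exact (bl3 e he (by rw [hBP] at he'; exact he')).1

end datsec
end TC

namespace TC

inductive Stat : Type
  | z : Stat
  | o : Stat
  | p : Fin 3 → Stat
  | f : Stat

section loc
variable {W : Type} [Fintype W] {Γ : SimpleGraph W} {ty : W → Fin 3} {st1 q1 st2 q2 r c : W}

/-- leaves context -/
structure LC (Γ : SimpleGraph W) (ty : W → Fin 3) (st1 q1 st2 q2 : W) : Prop where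
  ac : Γ.IsAcyclic
  l1 : Leaf Γ ty st1 q1
  l2 : Leaf Γ ty st2 q2
  t1 : ty st1 = 1
  t2 : ty st2 = 2

def MkC (Γ : SimpleGraph W) (st1 st2 c : W) (S : Finset W) : Prop :=
  (∀ x ∈ S, Γ.Reachable c x) ∧ (Γ.Reachable c st1 → st1 ∈ S) ∧ (Γ.Reachable c st2 → st2 ∈ S)

def MkS (Γ : SimpleGraph W) (ty : W → Fin 3) (st1 st2 r c : W) (s : Stat) (d : Finset W × Bool) : Prop :=
  MkC Γ st1 st2 c d.1 ∧ match s with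
  | Stat.z => d = ({r}, false)
  | Stat.o => ∃ u, u ≠ r ∧ d = ({u}, false)
  | Stat.p k => ∃ u v, ty u < ty v ∧ ty u ≠ k ∧ ty v ≠ k ∧ d = ({u, v}, false)
  | Stat.f => ∃ u v, ty u = 1 ∧ ty v = 2 ∧ (d = ({u, v}, true) ∨ ∃ w, ty w = 0 ∧ d = ({w, u, v}, false))

def WtC (Γ : SimpleGraph W) (st1 q1 st2 q2 c : W) (m : Sym2 W → ℕ) : Prop :=
  (∀ e, m e ≠ 0 → e ∈ Γ.edgeSet ∧ ∀ x ∈ e, Γ.Reachable c x) ∧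
    (Γ.Reachable c st1 → m s(st1, q1) = 1) ∧ (Γ.Reachable c st2 → m s(st2, q2) = 1)

def WtS (Γ : SimpleGraph W) (ty : W → Fin 3) (st1 q1 st2 q2 c : W) (s : Stat) (m : Sym2 W → ℕ) : Prop :=
  WtC Γ st1 q1 st2 q2 c m ∧ match s with
  | Stat.z => ∑ e, m e = 0
  | Stat.o => ∑ e, m e = 1
  | Stat.p k => Pair2 Γ ty k m
  | Stat.f => Full Γ ty m

theorem bij_of {A B I : Type} {f : I → A} {g : I → B} {J : Set I} {P : Set A} {Q : Set B}
    (hf : Set.InjOn f J) (hg : Set.InjOn g J) (hP : ∀ a, a ∈ P ↔ ∃ i ∈ J, f i = a)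
    (hQ : ∀ a, a ∈ Q ↔ ∃ i ∈ J, g i = a) : Nonempty (P ≃ Q) := by
  have e1 : P = f '' J := by ext a; rw [hP]; rfl
  have e2 : Q = g '' J := by ext a; rw [hQ]; rfl
  rw [e1, e2]
  exact ⟨(Equiv.Set.imageOfInjOn f J hf).symm.trans (Equiv.Set.imageOfInjOn g J hg)⟩

theorem loc_z (hL : LC Γ ty st1 q1 st2 q2) (hr : Γ.Reachable c r) (hr1 : r ≠ st1) (hr2 : r ≠ st2) :
    Nonempty ({d | MkS Γ ty st1 st2 r c Stat.z d} ≃ {m | WtS Γ ty st1 q1 st2 q2 c Stat.z m}) := by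
  apply bij_of (I := Unit) (J := {_u | ¬ Γ.Reachable c st1 ∧ ¬ Γ.Reachable c st2})
    (f := fun _ => (({r} : Finset W), false)) (g := fun _ => (0 : Sym2 W → ℕ))
  · intro _ _ _ _ _; rfl
  · intro _ _ _ _ _; rfl
  · intro d
    constructor
    · rintro ⟨⟨h1, h2, h3⟩, rfl⟩
      refine ⟨(), ⟨fun h => ?_, fun h => ?_⟩, rfl⟩
      · have := h2 h; simp at this; exact hr1 this.symm
      · have := h3 h; simp at this; exact hr2 this.symm
    · rintro ⟨_, ⟨h1, h2⟩, rfl⟩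
      exact ⟨⟨by simpa using hr, fun h => (h1 h).elim, fun h => (h2 h).elim⟩, rfl⟩
  · intro m
    constructor
    · rintro ⟨⟨h1, h2, h3⟩, h4⟩
      have hm : m = 0 := by
        funext e; exact (Finset.sum_eq_zero_iff.1 h4) e (Finset.mem_univ e)
      subst hm
      exact ⟨(), ⟨fun h => by simpa using h2 h, fun h => by simpa using h3 h⟩, rfl⟩
    · rintro ⟨_, ⟨h1, h2⟩, rfl⟩
      exact ⟨⟨by simp, fun h => (h1 h).elim, fun h => (h2 h).elim⟩, by simp⟩

theorem dl_leaf (hL : LC Γ ty st1 q1 st2 q2) {st q u : W} (hl : Leaf Γ ty st q) 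
    (hcr : Γ.Reachable c r) (hrs : r ≠ st) (hu : Γ.Reachable c u) (hur : u ≠ r) (hst : Γ.Reachable c st) :
    dl (fe Γ u r) s(st, q) = 1 ↔ u = st := by
  have e : fe Γ st r = s(st, q) := by
    have := hl.2.1 _ (nx_adj (hst.symm.trans hcr) hrs.symm)
    rw [fe, this]
  constructor
  · intro h
    have : s(st, q) = fe Γ u r := by
      by_contra hne
      simp [dl, hne] at h
    rw [← e] at this
    exact (fe_inj hL.ac (hst.symm.trans hcr) (hu.symm.trans hcr) hrs.symm hur this).symm
  · rintro rfl
    rw [e]; simp [dl]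

theorem loc_o (hL : LC Γ ty st1 q1 st2 q2) (hr : Γ.Reachable c r) (hr1 : r ≠ st1) (hr2 : r ≠ st2) :
    Nonempty ({d | MkS Γ ty st1 st2 r c Stat.o d} ≃ {m | WtS Γ ty st1 q1 st2 q2 c Stat.o m}) := by
  apply bij_of (I := W) (J := {u | u ≠ r ∧ Γ.Reachable c u ∧ (Γ.Reachable c st1 → u = st1) ∧
      (Γ.Reachable c st2 → u = st2)})
    (f := fun u => (({u} : Finset W), false)) (g := fun u => dl (fe Γ u r))
  · intro a _ b _ h
    simpa using h
  · rintro a ⟨h1, h2, _⟩ b ⟨h3, h4, _⟩ h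
    exact fe_inj hL.ac (h2.symm.trans hr) (h4.symm.trans hr) h1 h3 (dl_inj h)
  · intro d
    constructor
    · rintro ⟨⟨h1, h2, h3⟩, u, hu, rfl⟩
      refine ⟨u, ⟨hu, h1 u (by simp), fun h => ?_, fun h => ?_⟩, rfl⟩
      · have := h2 h; simp at this; exact this.symm
      · have := h3 h; simp at this; exact this.symm
    · rintro ⟨u, ⟨h0, h1, h2, h3⟩, rfl⟩
      exact ⟨⟨by simpa using h1, fun h => by simp [h2 h], fun h => by simp [h3 h]⟩, u, h0, rfl⟩
  · intro m
    constructor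
    · rintro ⟨⟨h1, h2, h3⟩, h4⟩
      obtain ⟨e, he⟩ : ∃ e, m = dl e := by
        obtain ⟨f, hf⟩ := sub_one (m := m) (m' := 0) (by simp) (by simpa using h4)
        exact ⟨f, by simpa using hf⟩
      subst he
      obtain ⟨h5, h6⟩ := h1 e (by simp [dl])
      induction e using Sym2.ind with | _ x y => ?_
      obtain ⟨u, g1, g2, g3⟩ := fe_surj hL.ac h5 ((h6 x (by simp)).symm.trans hr)
      rw [← g3] at h2 h3 ⊢
      have hcu := hr.trans g2.symm
      exact ⟨u, ⟨g1, hcu, fun h => (dl_leaf hL hL.l1 hr hr1 hcu g1 h).1 (h2 h),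
        fun h => (dl_leaf hL hL.l2 hr hr2 hcu g1 h).1 (h3 h)⟩, rfl⟩
    · rintro ⟨u, ⟨h0, h1, h2, h3⟩, rfl⟩
      refine ⟨⟨?_, fun h => (dl_leaf hL hL.l1 hr hr1 h1 h0 h).2 (h2 h),
        fun h => (dl_leaf hL hL.l2 hr hr2 h1 h0 h).2 (h3 h)⟩, dl_sum _⟩
      intro e he
      have : e = fe Γ u r := by
        by_contra hne
        simp [dl, hne] at he
      subst this
      have hm := fe_mem (h1.symm.trans hr) h0
      refine ⟨hm, fun x hx => ?_⟩
      have hadj : Γ.Adj u (nx Γ u r) := hm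
      rw [fe, Sym2.mem_iff] at hx
      rcases hx with rfl | rfl
      · exact h1
      · exact h1.trans hadj.reachable

theorem fe_reach {u v x : W} (h : Γ.Reachable u v) (hne : u ≠ v) (hu : Γ.Reachable c u)
    (hx : x ∈ fe Γ u v) : Γ.Reachable c x := by
  have hadj := nx_adj h hne
  rw [fe, Sym2.mem_iff] at hx
  rcases hx with rfl | rfl
  · exact hu
  · exact hu.trans hadj.reachable

theorem loc_p (hL : LC Γ ty st1 q1 st2 q2) (k : Fin 3) :
    Nonempty ({d | MkS Γ ty st1 st2 r c (Stat.p k) d} ≃ {m | WtS Γ ty st1 q1 st2 q2 c (Stat.p k) m}) := by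
  apply bij_of (I := W × W) (J := {q | Γ.Reachable c q.1 ∧ Γ.Reachable c q.2 ∧ ty q.1 < ty q.2 ∧
      ty q.1 ≠ k ∧ ty q.2 ≠ k ∧ (Γ.Reachable c st1 → st1 = q.1 ∨ st1 = q.2) ∧
      (Γ.Reachable c st2 → st2 = q.1 ∨ st2 = q.2)})
    (f := fun q => (({q.1, q.2} : Finset W), false)) (g := fun q => m2 Γ q.1 q.2)
  · rintro ⟨a, b⟩ ⟨_, _, h, _⟩ ⟨a', b'⟩ ⟨_, _, h', _⟩ e
    simp only [Prod.mk.injEq, and_true] at e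
    simp only at h h'
    have e1 : a ∈ ({a', b'} : Finset W) := by rw [← e]; simp
    have e2 : b ∈ ({a', b'} : Finset W) := by rw [← e]; simp
    simp only [Finset.mem_insert, Finset.mem_singleton] at e1 e2
    rcases e1 with rfl | rfl <;> rcases e2 with rfl | rfl
    · exact (lt_irrefl _ h).elim
    · rfl
    · exact (lt_asymm h h').elim
    · exact (lt_irrefl _ h).elim
  · rintro ⟨a, b⟩ ⟨h1, h2, h, _⟩ ⟨a', b'⟩ ⟨h1', h2', h', _⟩ e
    obtain ⟨g1, g2⟩ := m2_inj hL.ac (h1.symm.trans h2) (h1'.symm.trans h2') h h' e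
    simp only at g1 g2
    rw [g1, g2]
  · intro d
    constructor
    · rintro ⟨⟨h1, h2, h3⟩, u, v, g1, g2, g3, rfl⟩
      exact ⟨(u, v), ⟨h1 u (by simp), h1 v (by simp), g1, g2, g3, fun h => by simpa using h2 h,
        fun h => by simpa using h3 h⟩, rfl⟩
    · rintro ⟨⟨u, v⟩, ⟨h1, h2, g1, g2, g3, h3, h4⟩, rfl⟩
      refine ⟨⟨?_, fun h => by simpa using h3 h, fun h => by simpa using h4 h⟩, u, v, g1, g2, g3, rfl⟩
      intro x hx
      simp only [Finset.mem_insert, Finset.mem_singleton] at hx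
      rcases hx with rfl | rfl
      exacts [h1, h2]
  · intro m
    constructor
    · rintro ⟨⟨h1, h2, h3⟩, u, v, g0, g1, g2, g3, rfl⟩
      have hu := (h1 (fe Γ u v) (m2_ne.2 (by simp))).2 u (by simp [fe])
      have hv := (h1 (fe Γ v u) (m2_ne.2 (by simp))).2 v (by simp [fe])
      refine ⟨(u, v), ⟨hu, hv, g1, g2, g3, fun h => ?_, fun h => ?_⟩, rfl⟩
      · have := h2 h
        rw [m2_leaf hL.l1 g0 g1] at this
        by_contra hn; simp only at hn; simp [hn] at this
      · have := h3 h
        rw [m2_leaf hL.l2 g0 g1] at this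
        by_contra hn; simp only at hn; simp [hn] at this
    · rintro ⟨⟨u, v⟩, ⟨h1, h2, g1, g2, g3, h3, h4⟩, rfl⟩
      simp only at h1 h2 g1 g2 g3 h3 h4 ⊢
      have g0 := h1.symm.trans h2
      have hne : u ≠ v := by rintro rfl; exact lt_irrefl _ g1
      refine ⟨⟨?_, fun h => by rw [m2_leaf hL.l1 g0 g1, if_pos (h3 h)], fun h => by
        rw [m2_leaf hL.l2 g0 g1, if_pos (h4 h)]⟩, u, v, g0, g1, g2, g3, rfl⟩
      intro e he
      rcases m2_ne.1 he with rfl | rfl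
      · exact ⟨fe_mem g0 hne, fun x hx => fe_reach g0 hne h1 hx⟩
      · exact ⟨fe_mem g0.symm hne.symm, fun x hx => fe_reach g0.symm hne.symm h2 hx⟩

theorem eqv_X {c : W} (hL : LC Γ ty st1 q1 st2 q2) :
    Nonempty ({q : W × W × W | IdxPin Γ ty c st1 st2 q.1 q.2.1 q.2.2} ≃
      {m | WtS Γ ty st1 q1 st2 q2 c Stat.f m}) := by
  apply bij_of (I := W × W × W) (J := {q : W × W × W | IdxPin Γ ty c st1 st2 q.1 q.2.1 q.2.2})
    (f := id) (g := fun q => m3 Γ q.1 q.2.1 q.2.2)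
  · exact Function.injective_id.injOn
  · rintro ⟨a, b, d⟩ h ⟨a', b', d'⟩ h' e
    obtain ⟨g1, g2, g3⟩ := m3_inj hL.ac h.2.1 h'.2.1 e
    simp only at g1 g2 g3
    rw [g1, g2, g3]
  · simp
  · intro m
    constructor
    · rintro ⟨⟨h1, h2, h3⟩, a, b, d, hi, rfl⟩
      refine ⟨(a, b, d), ⟨?_, hi, fun h => ?_, fun h => ?_⟩, rfl⟩
      · exact (h1 (fe Γ a b) (m3_ne.2 (by simp))).2 a (by simp [fe])
      · have := h2 h
        rw [m3_leaf hL.ac hL.l1 hi] at this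
        by_contra hn; simp only at hn; simp [hn] at this
      · have := h3 h
        rw [m3_leaf hL.ac hL.l2 hi] at this
        by_contra hn; simp only at hn; simp [hn] at this
    · rintro ⟨⟨a, b, d⟩, ⟨h1, hi, h3, h4⟩, rfl⟩
      simp only at h1 hi h3 h4 ⊢
      obtain ⟨r1, r2⟩ := hi.reach
      refine ⟨⟨?_, fun h => by rw [m3_leaf hL.ac hL.l1 hi, if_pos (h3 h)], fun h => by
        rw [m3_leaf hL.ac hL.l2 hi, if_pos (h4 h)]⟩, a, b, d, hi, rfl⟩
      intro e he
      have h1b := h1.trans r1.symm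
      have h1d := h1.trans r2.symm
      rcases m3_ne.1 he with rfl | rfl | rfl
      · exact ⟨fe_mem r1.symm hi.vne.symm, fun x hx => fe_reach r1.symm hi.vne.symm h1 hx⟩
      · exact ⟨fe_mem r1 hi.vne, fun x hx => fe_reach r1 hi.vne h1b hx⟩
      · exact ⟨fe_mem r2 hi.pne, fun x hx => fe_reach r2 hi.pne h1d hx⟩

theorem eqv_M {c : W} (hL : LC Γ ty st1 q1 st2 q2) :
    Nonempty ({x // AA Γ ty c 1 st1 x} × {x // AA Γ ty c 2 st2 x} × Option {x // A0 Γ ty c x} ≃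
      {d | MkS Γ ty st1 st2 r c Stat.f d}) := by
  let F : {x // AA Γ ty c 1 st1 x} × {x // AA Γ ty c 2 st2 x} × Option {x // A0 Γ ty c x} →
      Finset W × Bool := fun q => match q.2.2 with
    | none => ({q.1.1, q.2.1.1}, true)
    | some w => ({w.1, q.1.1, q.2.1.1}, false)
  have hinj : Function.Injective F := by
    rintro ⟨⟨a, ha⟩, ⟨b, hb⟩, w⟩ ⟨⟨a', ha'⟩, ⟨b', hb'⟩, w'⟩ h
    have ta := ha.2.1
    have ta' := ha'.2.1
    have tb := hb.2.1
    have tb' := hb'.2.1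
    rcases w with _ | ⟨w, hw⟩ <;> rcases w' with _ | ⟨w', hw'⟩ <;> simp only [F, Prod.mk.injEq, and_true, 
      reduceCtorEq, and_false] at h
    · have e1 : a ∈ ({a', b'} : Finset W) := by rw [← h]; simp
      have e2 : b ∈ ({a', b'} : Finset W) := by rw [← h]; simp
      simp only [Finset.mem_insert, Finset.mem_singleton] at e1 e2
      have : a = a' := by
        rcases e1 with h | h
        · exact h
        · rw [h, tb'] at ta; exact absurd ta (by decide)
      have : b = b' := by
        rcases e2 with h | h
        · rw [h, ta'] at tb; exact absurd tb (by decide)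
        · exact h
      subst_vars; rfl
    · have tw := hw.2
      have tw' := hw'.2
      have e1 : a ∈ ({w', a', b'} : Finset W) := by rw [← h]; simp
      have e2 : b ∈ ({w', a', b'} : Finset W) := by rw [← h]; simp
      have e3 : w ∈ ({w', a', b'} : Finset W) := by rw [← h]; simp
      simp only [Finset.mem_insert, Finset.mem_singleton] at e1 e2 e3
      have : a = a' := by
        rcases e1 with h | h | h
        · rw [h, tw'] at ta; exact absurd ta (by decide)
        · exact h
        · rw [h, tb'] at ta; exact absurd ta (by decide)
      have : b = b' := by
        rcases e2 with h | h | h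
        · rw [h, tw'] at tb; exact absurd tb (by decide)
        · rw [h, ta'] at tb; exact absurd tb (by decide)
        · exact h
      have : w = w' := by
        rcases e3 with h | h | h
        · exact h
        · rw [h, ta'] at tw; exact absurd tw (by decide)
        · rw [h, tb'] at tw; exact absurd tw (by decide)
      subst_vars; rfl
  have hr : {d | MkS Γ ty st1 st2 r c Stat.f d} = Set.range F := by
    ext d
    constructor
    · rintro ⟨⟨h1, h2, h3⟩, u, v, tu, tv, hd | ⟨w, tw, hd⟩⟩
      · subst hd
        refine ⟨⟨⟨u, h1 u (by simp), tu, fun h => ?_⟩, ⟨v, h1 v (by simp), tv, fun h => ?_⟩, none⟩, rfl⟩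
        · have := h2 h
          simp only [Finset.mem_insert, Finset.mem_singleton] at this
          rcases this with h | h
          · exact h.symm
          · have := hL.t1; rw [h, tv] at this; exact absurd this (by decide)
        · have := h3 h
          simp only [Finset.mem_insert, Finset.mem_singleton] at this
          rcases this with h | h
          · have := hL.t2; rw [h, tu] at this; exact absurd this (by decide)
          · exact h.symm
      · subst hd
        refine ⟨⟨⟨u, h1 u (by simp), tu, fun h => ?_⟩, ⟨v, h1 v (by simp), tv, fun h => ?_⟩, 
          some ⟨w, h1 w (by simp), tw⟩⟩, rfl⟩
        · have := h2 h
          simp only [Finset.mem_insert, Finset.mem_singleton] at this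
          rcases this with h | h | h
          · have := hL.t1; rw [h, tw] at this; exact absurd this (by decide)
          · exact h.symm
          · have := hL.t1; rw [h, tv] at this; exact absurd this (by decide)
        · have := h3 h
          simp only [Finset.mem_insert, Finset.mem_singleton] at this
          rcases this with h | h | h
          · have := hL.t2; rw [h, tw] at this; exact absurd this (by decide)
          · have := hL.t2; rw [h, tu] at this; exact absurd this (by decide)
          · exact h.symm
    · rintro ⟨⟨⟨a, ha⟩, ⟨b, hb⟩, w⟩, rfl⟩
      rcases w with _ | ⟨w, hw⟩
      · refine ⟨⟨?_, fun h => ?_, fun h => ?_⟩, a, b, ha.2.1, hb.2.1, Or.inl rfl⟩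
        · intro x hx
          simp only [F, Finset.mem_insert, Finset.mem_singleton] at hx
          rcases hx with rfl | rfl
          exacts [ha.1, hb.1]
        · simp [F, ha.2.2 h]
        · simp [F, hb.2.2 h]
      · refine ⟨⟨?_, fun h => ?_, fun h => ?_⟩, a, b, ha.2.1, hb.2.1, Or.inr ⟨w, hw.2, rfl⟩⟩
        · intro x hx
          simp only [F, Finset.mem_insert, Finset.mem_singleton] at hx
          rcases hx with rfl | rfl | rfl
          exacts [hw.1, ha.1, hb.1]
        · simp [F, ha.2.2 h]
        · simp [F, hb.2.2 h]
  rw [hr]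
  exact ⟨Equiv.ofInjective F hinj⟩

theorem loc_f (hL : LC Γ ty st1 q1 st2 q2) :
    Nonempty ({d | MkS Γ ty st1 st2 r c Stat.f d} ≃ {m | WtS Γ ty st1 q1 st2 q2 c Stat.f m}) := by
  obtain ⟨e1⟩ := eqv_X (c := c) hL
  obtain ⟨e2⟩ := eqv_M (c := c) (r := r) hL
  have hc := pin_card (u := c) hL.ac hL.l1 hL.l2 hL.t1 hL.t2
  have : Fintype.card {q : W × W × W | IdxPin Γ ty c st1 st2 q.1 q.2.1 q.2.2} =
      Fintype.card ({x // AA Γ ty c 1 st1 x} × {x // AA Γ ty c 2 st2 x} × Option {x // A0 Γ ty c x}) := by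
    have h0 : Fintype.card {q : W × W × W | IdxPin Γ ty c st1 st2 q.1 q.2.1 q.2.2} =
        (Finset.univ.filter fun q : W × W × W => IdxPin Γ ty c st1 st2 q.1 q.2.1 q.2.2).card :=
      Fintype.card_subtype _
    rw [h0, Fintype.card_prod, Fintype.card_prod, Fintype.card_option, Fintype.card_subtype,
      Fintype.card_subtype, Fintype.card_subtype, ← mul_assoc, ← hc]
  exact ⟨e2.symm.trans ((Fintype.equivOfCardEq this).symm.trans e1)⟩

theorem loc_all (hL : LC Γ ty st1 q1 st2 q2) (hr : Γ.Reachable c r) (hr1 : r ≠ st1) (hr2 : r ≠ st2) (s : Stat) :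
    Nonempty ({d | MkS Γ ty st1 st2 r c s d} ≃ {m | WtS Γ ty st1 q1 st2 q2 c s m}) := by
  cases s with
  | z => exact loc_z hL hr hr1 hr2
  | o => exact loc_o hL hr hr1 hr2
  | p k => exact loc_p hL k
  | f => exact loc_f hL

end loc
end TC

namespace TC

section comb
variable {W : Type} [Fintype W]

def EE (Γ : SimpleGraph W) (ty : W → Fin 3) (M : Finset W) (i j : Fin 3) : Prop :=
  ∃ u ∈ M, ∃ v ∈ M, Γ.Reachable u v ∧ ty u = i ∧ ty v = j

def EF (Γ : SimpleGraph W) (ty : W → Fin 3) (M : Finset W) (b1 b2 : Prop) (i j : Fin 3) : Prop :=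
  EE Γ ty M i j ∨ (b1 ∧ (i = 0 ∧ j = 1 ∨ i = 1 ∧ j = 0)) ∨ (b2 ∧ (i = 0 ∧ j = 2 ∨ i = 2 ∧ j = 0))

structure TV (Γ : SimpleGraph W) (ty : W → Fin 3) (M : Finset W) (b1 b2 : Prop) : Prop where
  v1 : ∀ c, ∃ m ∈ M, Γ.Reachable c m
  v2 : M.card + (if b1 then 1 else 0) + (if b2 then 1 else 0) = (Rt Γ).card + 2
  v3 : ∀ i, ∃ j, j ≠ i ∧ EF Γ ty M b1 b2 i j

noncomputable def sc (Γ : SimpleGraph W) (M : Finset W) (c : W) : Finset W := M.filter fun x => Γ.Reachable c x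

def fl (Γ : SimpleGraph W) (ty : W → Fin 3) (M : Finset W) (b1 b2 : Prop) : Prop :=
  b2 ∧ ¬ b1 ∧ EE Γ ty M 1 2

noncomputable def dd (Γ : SimpleGraph W) (ty : W → Fin 3) (M : Finset W) (b1 b2 : Prop) (c : W) : Finset W × Bool :=
  (sc Γ M c, decide (fl Γ ty M b1 b2 ∧ 2 ≤ (sc Γ M c).card))

variable {Γ : SimpleGraph W} {ty : W → Fin 3} {M : Finset W} {b1 b2 : Prop}

theorem mem_sc {c x : W} : x ∈ sc Γ M c ↔ x ∈ M ∧ Γ.Reachable c x := by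
  simp [sc]

theorem sc_eq {c c' : W} (h : Γ.Reachable c c') : sc Γ M c = sc Γ M c' := by
  ext x; rw [mem_sc, mem_sc]
  exact and_congr_right fun _ => ⟨fun h' => h.symm.trans h', fun h' => h.trans h'⟩

theorem dd_eq {c c' : W} (h : Γ.Reachable c c') : dd Γ ty M b1 b2 c = dd Γ ty M b1 b2 c' := by
  unfold dd; rw [sc_eq h]

theorem Rt_reach {c c' : W} (hc : c ∈ Rt Γ) (hc' : c' ∈ Rt Γ) (h : Γ.Reachable c c') : c = c' := by
  rw [mem_Rt] at hc hc'
  rw [← hc, ← hc', rt_eq h]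

theorem rt_mem (c : W) : rt Γ c ∈ Rt Γ := mem_Rt.2 (rt_rt c)

theorem card_sc (A : Finset W) : A.card = ∑ c ∈ Rt Γ, (sc Γ A c).card := by
  rw [Finset.card_eq_sum_card_fiberwise (f := rt Γ) (t := Rt Γ) (fun x _ => rt_mem x)]
  refine Finset.sum_congr rfl fun c hc => ?_
  congr 1
  ext x
  rw [mem_sc, Finset.mem_filter]
  refine and_congr_right fun _ => ⟨fun h => ?_, fun h => ?_⟩
  · rw [← h]; exact rt_reach x
  · rw [← rt_eq h]; exact mem_Rt.1 hc

theorem sum_one_cases {R : Finset W} {f : W → ℕ} (h : ∑ c ∈ R, f c = 1) :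
    ∃ c ∈ R, f c = 1 ∧ ∀ c' ∈ R, c' ≠ c → f c' = 0 := by
  obtain ⟨c, hc, h0⟩ : ∃ c ∈ R, f c ≠ 0 := by
    by_contra! hh
    rw [Finset.sum_eq_zero hh] at h; omega
  have := Finset.add_sum_erase R f hc
  refine ⟨c, hc, by omega, fun c' hc' hne => ?_⟩
  have h2 : ∑ x ∈ R.erase c, f x = 0 := by omega
  exact (Finset.sum_eq_zero_iff.1 h2) c' (Finset.mem_erase.2 ⟨hne, hc'⟩)

theorem sum_two_cases {R : Finset W} {f : W → ℕ} (h : ∑ c ∈ R, f c = 2) :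
    (∃ c ∈ R, f c = 2 ∧ ∀ c' ∈ R, c' ≠ c → f c' = 0) ∨
    (∃ c ∈ R, ∃ d ∈ R, c ≠ d ∧ f c = 1 ∧ f d = 1 ∧ ∀ c' ∈ R, c' ≠ c → c' ≠ d → f c' = 0) := by
  obtain ⟨c, hc, h0⟩ : ∃ c ∈ R, f c ≠ 0 := by
    by_contra! hh
    rw [Finset.sum_eq_zero hh] at h; omega
  have := Finset.add_sum_erase R f hc
  by_cases h1 : f c = 1
  · have h2 : ∑ x ∈ R.erase c, f x = 1 := by omega
    obtain ⟨d, hd, e1, e2⟩ := sum_one_cases h2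
    rw [Finset.mem_erase] at hd
    exact Or.inr ⟨c, hc, d, hd.2, hd.1.symm, h1, e1, fun c' h3 h4 h5 => e2 c' (Finset.mem_erase.2 ⟨h4, h3⟩) h5⟩
  · have h2 : ∑ x ∈ R.erase c, f x = 0 := by omega
    exact Or.inl ⟨c, hc, by omega, fun c' hc' hne => 
      (Finset.sum_eq_zero_iff.1 h2) c' (Finset.mem_erase.2 ⟨hne, hc'⟩)⟩

theorem TV.exc (h : TV Γ ty M b1 b2) :
    ∑ c ∈ Rt Γ, ((sc Γ M c).card - 1) + (if b1 then 1 else 0) + (if b2 then 1 else 0) = 2 := by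
  have h1 := h.v2
  rw [card_sc (Γ := Γ) M] at h1
  have : ∑ c ∈ Rt Γ, (sc Γ M c).card = ∑ c ∈ Rt Γ, ((sc Γ M c).card - 1) + (Rt Γ).card := by
    rw [Finset.card_eq_sum_ones, ← Finset.sum_add_distrib]
    refine Finset.sum_congr rfl fun c _ => ?_
    obtain ⟨m, hm, hr⟩ := h.v1 c
    have : 0 < (sc Γ M c).card := Finset.card_pos.2 ⟨m, mem_sc.2 ⟨hm, hr⟩⟩
    omega
  omega

theorem TV.pos (h : TV Γ ty M b1 b2) (c : W) : 0 < (sc Γ M c).card := by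
  obtain ⟨m, hm, hr⟩ := h.v1 c
  exact Finset.card_pos.2 ⟨m, mem_sc.2 ⟨hm, hr⟩⟩

theorem pair_eq {S : Finset W} {u v : W} (hc : S.card = 2) (hu : u ∈ S) (hv : v ∈ S) (hne : u ≠ v) :
    S = {u, v} := by
  symm
  apply Finset.eq_of_subset_of_card_le
  · intro x; simp only [Finset.mem_insert, Finset.mem_singleton]; rintro (rfl | rfl) <;> assumption
  · rw [hc, Finset.card_pair hne]

theorem triple_eq {S : Finset W} {w u v : W} (hc : S.card = 3) (hw : w ∈ S) (hu : u ∈ S) (hv : v ∈ S) 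
    (h1 : w ≠ u) (h2 : w ≠ v) (hne : u ≠ v) : S = {w, u, v} := by
  symm
  apply Finset.eq_of_subset_of_card_le
  · intro x; simp only [Finset.mem_insert, Finset.mem_singleton]; rintro (rfl | rfl | rfl) <;> assumption
  · rw [hc, Finset.card_eq_three.2 ⟨w, u, v, h1, h2, hne, rfl⟩]

/-- the type `i j` edge occurs as the pair of one component -/
def PairAt (Γ : SimpleGraph W) (ty : W → Fin 3) (M : Finset W) (c : W) (i j : Fin 3) : Prop :=
  ∃ u v, sc Γ M c = {u, v} ∧ ty u = i ∧ ty v = j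

theorem ee_big {i j : Fin 3} (h : EE Γ ty M i j) (hij : i ≠ j) : ∃ c ∈ Rt Γ, (sc Γ M c).card ≠ 1 ∧
    ∃ u ∈ sc Γ M c, ∃ v ∈ sc Γ M c, u ≠ v ∧ ty u = i ∧ ty v = j := by
  obtain ⟨u, hu, v, hv, hr, e1, e2⟩ := h
  have hne : u ≠ v := by rintro rfl; exact hij (e1.symm.trans e2)
  have hu' : u ∈ sc Γ M (rt Γ u) := mem_sc.2 ⟨hu, rt_reach u⟩
  have hv' : v ∈ sc Γ M (rt Γ u) := mem_sc.2 ⟨hv, (rt_reach u).trans hr⟩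
  refine ⟨rt Γ u, rt_mem u, fun h1 => ?_, u, hu', v, hv', hne, e1, e2⟩
  exact hne (Finset.card_le_one.1 h1.le u hu' v hv')

theorem tv_cases (h : TV Γ ty M b1 b2) :
    (b1 ∧ b2 ∧ ∀ c, (sc Γ M c).card = 1) ∨
    (∃ c0 u v, sc Γ M c0 = {u, v} ∧ ty u < ty v ∧ (∀ c, ¬ Γ.Reachable c0 c → (sc Γ M c).card = 1) ∧
      ((b1 ∧ ¬ b2 ∧ ty v = 2) ∨ (¬ b1 ∧ b2 ∧ (ty u = 1 ∨ ty v = 1)))) ∨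
    (¬ b1 ∧ ¬ b2 ∧ ∃ c0 w u v, sc Γ M c0 = {w, u, v} ∧ ty w = 0 ∧ ty u = 1 ∧ ty v = 2 ∧
      (∀ c, ¬ Γ.Reachable c0 c → (sc Γ M c).card = 1)) ∨
    (¬ b1 ∧ ¬ b2 ∧ ∃ c0 c1 u v u' v', ¬ Γ.Reachable c0 c1 ∧ sc Γ M c0 = {u, v} ∧ ty u < ty v ∧ 
      sc Γ M c1 = {u', v'} ∧ ty u' < ty v' ∧ ¬ (ty u = ty u' ∧ ty v = ty v') ∧
      (∀ c, ¬ Γ.Reachable c0 c → ¬ Γ.Reachable c1 c → (sc Γ M c).card = 1)) := by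
  have hx := h.exc
  have hone : ∀ c c0, c0 ∈ Rt Γ → ¬ Γ.Reachable c0 c → ∀ x : ℕ, (rt Γ c ≠ c0 → (sc Γ M (rt Γ c)).card = x) → 
      (sc Γ M c).card = x := by
    intro c c0 h0 hr x hh
    rw [← sc_eq (rt_reach c)]
    apply hh
    rintro rfl
    exact hr (rt_reach c)
  have p1 : ∀ c, (sc Γ M c).card - 1 = 0 → (sc Γ M c).card = 1 := fun c hc => by
    have := h.pos c; omega
  -- one big component
  have hB : ∑ c ∈ Rt Γ, ((sc Γ M c).card - 1) = 1 → ∀ i j, i ≠ j → EE Γ ty M i j → 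
      ∃ c0 u v, sc Γ M c0 = {u, v} ∧ ty u = i ∧ ty v = j ∧
        (∀ c, ¬ Γ.Reachable c0 c → (sc Γ M c).card = 1) := by
    intro hs i j hij he
    obtain ⟨c0, hc0, e1, e2⟩ := sum_one_cases hs
    obtain ⟨c, hc, hc1, u, hu, v, hv, hne, tu, tv⟩ := ee_big he hij
    have : c = c0 := by
      by_contra hcc
      exact hc1 (p1 c (e2 c hc hcc))
    subst this
    exact ⟨c, u, v, pair_eq (by omega) hu hv hne, tu, tv, fun c' hr => 
      hone c' c hc hr 1 fun hn => p1 _ (e2 _ (rt_mem c') hn)⟩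
  by_cases hb1 : b1 <;> by_cases hb2 : b2
  · left
    simp only [hb1, hb2, if_true] at hx
    have hs : ∑ c ∈ Rt Γ, ((sc Γ M c).card - 1) = 0 := by omega
    refine ⟨hb1, hb2, fun c => ?_⟩
    rw [← sc_eq (rt_reach c)]
    exact p1 _ ((Finset.sum_eq_zero_iff.1 hs) _ (rt_mem c))
  · right; left
    simp only [hb1, hb2, if_true, if_false] at hx
    obtain ⟨j, hj, he⟩ := h.v3 2
    have he' : EE Γ ty M 2 j := by
      rcases he with he | ⟨_, he⟩ | ⟨he, _⟩
      · exact he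
      · rcases he with ⟨h, _⟩ | ⟨h, _⟩ <;> exact absurd h (by decide)
      · exact absurd he hb2
    obtain ⟨c0, u, v, e1, e2, e3, e4⟩ := hB (by omega) 2 j hj.symm he'
    refine ⟨c0, v, u, by rw [e1, Finset.pair_comm], ?_, e4, Or.inl ⟨hb1, hb2, e2⟩⟩
    rw [e2, e3]; revert hj; clear he he' e3; revert j; decide
  · right; left
    simp only [hb1, hb2, if_true, if_false] at hx
    obtain ⟨j, hj, he⟩ := h.v3 1
    have he' : EE Γ ty M 1 j := by
      rcases he with he | ⟨he, _⟩ | ⟨_, he⟩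
      · exact he
      · exact absurd he hb1
      · rcases he with ⟨h, _⟩ | ⟨h, _⟩ <;> exact absurd h (by decide)
    obtain ⟨c0, u, v, e1, e2, e3, e4⟩ := hB (by omega) 1 j hj.symm he'
    rcases lt_or_gt_of_ne hj with h1 | h1
    · exact ⟨c0, v, u, by rw [e1, Finset.pair_comm], by rw [e2, e3]; exact h1, e4, Or.inr ⟨hb1, hb2, Or.inr e2⟩⟩
    · exact ⟨c0, u, v, e1, by rw [e2, e3]; exact h1, e4, Or.inr ⟨hb1, hb2, Or.inl e2⟩⟩
  · right; right
    simp only [hb1, hb2, if_false] at hx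
    have hE : ∀ i, ∃ j, j ≠ i ∧ EE Γ ty M i j := by
      intro i
      obtain ⟨j, hj, he⟩ := h.v3 i
      refine ⟨j, hj, ?_⟩
      rcases he with he | ⟨he, _⟩ | ⟨he, _⟩
      · exact he
      · exact absurd he hb1
      · exact absurd he hb2
    rcases sum_two_cases (by omega : ∑ c ∈ Rt Γ, ((sc Γ M c).card - 1) = 2) with 
      ⟨c, hc, e1, e2⟩ | ⟨c, hc, d, hd, hcd, e1, e1', e2⟩
    · left
      refine ⟨hb1, hb2, ?_⟩
      have hm : ∀ i, ∃ u ∈ sc Γ M c, ty u = i := by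
        intro i
        obtain ⟨j, hj, he⟩ := hE i
        obtain ⟨c', hc', hc1, u, hu, v, hv, hne, tu, tv⟩ := ee_big he hj.symm
        have : c' = c := by
          by_contra hcc
          exact hc1 (p1 _ (e2 _ hc' hcc))
        subst this
        exact ⟨u, hu, tu⟩
      obtain ⟨w, hw, tw⟩ := hm 0
      obtain ⟨u, hu, tu⟩ := hm 1
      obtain ⟨v, hv, tv⟩ := hm 2
      refine ⟨c, w, u, v, triple_eq (by omega) hw hu hv ?_ ?_ ?_, tw, tu, tv, fun c' hr => 
        hone c' c hc hr 1 fun hn => p1 _ (e2 _ (rt_mem c') hn)⟩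
      · rintro rfl; rw [tw] at tu; exact absurd tu (by decide)
      · rintro rfl; rw [tw] at tv; exact absurd tv (by decide)
      · rintro rfl; rw [tu] at tv; exact absurd tv (by decide)
    · right
      refine ⟨hb1, hb2, ?_⟩
      have main : ∀ c d, c ∈ Rt Γ → d ∈ Rt Γ → c ≠ d → (sc Γ M c).card - 1 = 1 → (sc Γ M d).card - 1 = 1 →
          (∀ c' ∈ Rt Γ, c' ≠ c → c' ≠ d → (sc Γ M c').card - 1 = 0) → ∀ j, j ≠ 0 → 
          (∃ u ∈ sc Γ M c, ∃ v ∈ sc Γ M c, u ≠ v ∧ ty u = 0 ∧ ty v = j) → 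
          ∃ c0 c1 u v u' v', ¬ Γ.Reachable c0 c1 ∧ sc Γ M c0 = {u, v} ∧ ty u < ty v ∧ 
            sc Γ M c1 = {u', v'} ∧ ty u' < ty v' ∧ ¬ (ty u = ty u' ∧ ty v = ty v') ∧
            (∀ c, ¬ Γ.Reachable c0 c → ¬ Γ.Reachable c1 c → (sc Γ M c).card = 1) := by
        rintro c d hc hd hcd e1 e1' e2 j hj ⟨u, hu, v, hv, hne, tu, tv⟩
        have hS := pair_eq (by omega) hu hv hne
        obtain ⟨k, hk0, hkj⟩ : ∃ k : Fin 3, k ≠ 0 ∧ k ≠ j := by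
          revert hj; clear tv; revert j; decide
        obtain ⟨l, hl, he⟩ := hE k
        obtain ⟨c', hc', hc1, u', hu', v', hv', hne', tu', tv'⟩ := ee_big he hl.symm
        have h1 : c' ≠ c := by
          rintro rfl
          rw [hS] at hu'
          simp only [Finset.mem_insert, Finset.mem_singleton] at hu'
          rcases hu' with rfl | rfl
          · exact hk0 (tu'.symm.trans tu)
          · exact hkj (tu'.symm.trans tv)
        have h2 : c' = d := by
          by_contra hcc
          exact hc1 (p1 _ (e2 _ hc' h1 hcc))
        subst h2
        have hS' := pair_eq (by omega) hu' hv' hne'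
        have hlast : ∀ x, ¬ Γ.Reachable c x → ¬ Γ.Reachable c' x → (sc Γ M x).card = 1 := by
          intro x hx1 hx2
          rw [← sc_eq (rt_reach x)]
          apply p1; apply e2 _ (rt_mem x)
          · intro hh; apply hx1; rw [← hh]; exact rt_reach x
          · intro hh; apply hx2; rw [← hh]; exact rt_reach x
        have hnr : ¬ Γ.Reachable c c' := fun hr => hcd (Rt_reach hc hc' hr)
        have tuv : ty u < ty v := by rw [tu, tv]; exact Fin.pos_iff_ne_zero.2 hj
        rcases lt_or_gt_of_ne hl with h3 | h3
        · refine ⟨c, c', u, v, v', u', hnr, hS, tuv, by rw [hS', Finset.pair_comm], by rw [tu', tv']; exact h3, ?_, hlast⟩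
          rintro ⟨_, h4⟩
          rw [tv, tu'] at h4; exact hkj h4.symm
        · refine ⟨c, c', u, v, u', v', hnr, hS, tuv, hS', by rw [tu', tv']; exact h3, ?_, hlast⟩
          rintro ⟨h4, _⟩
          rw [tu, tu'] at h4; exact hk0 h4.symm
      obtain ⟨j, hj, he⟩ := hE 0
      obtain ⟨c', hc', hc1, hh⟩ := ee_big he hj.symm
      by_cases q1 : c' = c
      · subst q1; exact main _ _ hc' hd hcd e1 e1' e2 j hj hh
      by_cases q2 : c' = d
      · subst q2; exact main _ _ hc' hc hcd.symm e1' e1 (fun x hx h1 h2 => e2 x hx h2 h1) j hj hh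
      · exact absurd (p1 _ (e2 _ hc' q1 q2)) hc1

end comb
end TC

namespace TC

def Stat.big : Stat → Prop
  | Stat.z => False
  | Stat.o => False
  | Stat.p _ => True
  | Stat.f => True

def Stat.n : Stat → ℕ
  | Stat.z => 0
  | Stat.o => 1
  | Stat.p _ => 2
  | Stat.f => 3

section comb
variable {W : Type} [Fintype W]

structure GV (Γ : SimpleGraph W) (σ : W → Stat) : Prop where
  g2 : ∀ u u', ¬ Γ.Reachable u u' → (σ u).big → (σ u').big → ∃ k k', σ u = Stat.p k ∧ σ u' = Stat.p k' ∧ k ≠ k'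
  g3 : ∀ u u' u'', ¬ Γ.Reachable u u' → ¬ Γ.Reachable u u'' → ¬ Γ.Reachable u' u'' → 
    (σ u).big → (σ u').big → (σ u'').big → False

variable {Γ : SimpleGraph W} {ty : W → Fin 3} {M : Finset W} {b1 b2 : Prop} {st1 st2 : W}

theorem mkc_sc (h1 : st1 ∈ M) (h2 : st2 ∈ M) (c : W) : MkC Γ st1 st2 c (sc Γ M c) :=
  ⟨fun _ hx => (mem_sc.1 hx).2, fun h => mem_sc.2 ⟨h1, h⟩, fun h => mem_sc.2 ⟨h2, h⟩⟩

theorem ne_of_tlt {u v : W} (h : ty u < ty v) : u ≠ v := by rintro rfl; exact lt_irrefl _ h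

theorem mk_one (h1 : st1 ∈ M) (h2 : st2 ∈ M) {c : W} (r : W) (hc : (sc Γ M c).card = 1) :
    ∃ s : Stat, ¬ s.big ∧ MkS Γ ty st1 st2 r c s (dd Γ ty M b1 b2 c) := by
  obtain ⟨x, hx⟩ := Finset.card_eq_one.1 hc
  have hd : dd Γ ty M b1 b2 c = ({x}, false) := by
    unfold dd; rw [hc, hx]; simp
  have hC := mkc_sc (Γ := Γ) h1 h2 c
  rw [hx] at hC
  rw [hd]
  by_cases hr : x = r
  · exact ⟨Stat.z, fun h => h, hC, by rw [hr]⟩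
  · exact ⟨Stat.o, fun h => h, hC, x, hr, rfl⟩

theorem tv_stat (h : TV Γ ty M b1 b2) (h1 : st1 ∈ M) (h2 : st2 ∈ M) (r : W → W) :
    ∃ σ : W → Stat, (∀ c, MkS Γ ty st1 st2 (r c) c (σ c) (dd Γ ty M b1 b2 c)) ∧ GV Γ σ := by
  rcases tv_cases h with ⟨_, _, hA⟩ | ⟨c0, u, v, hS, tuv, hrest, hb⟩ | 
    ⟨hb1, hb2, c0, w, u, v, hS, tw, tu, tv, hrest⟩ | ⟨hb1, hb2, c0, c1, u, v, u', v', hnr, hS, tuv, hS', tuv', hdiff, hrest⟩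
  · choose σ hσ1 hσ2 using fun c => mk_one (ty := ty) (b1 := b1) (b2 := b2) h1 h2 (r c) (hA c)
    exact ⟨σ, hσ2, fun u _ _ hb _ => (hσ1 u hb).elim, fun u _ _ _ _ _ hb _ _ => (hσ1 u hb).elim⟩
  · have key : ∀ c, ∃ s : Stat, (s.big → Γ.Reachable c0 c) ∧ MkS Γ ty st1 st2 (r c) c s (dd Γ ty M b1 b2 c) := by
      intro c
      by_cases hc : Γ.Reachable c0 c
      · have hC := mkc_sc (Γ := Γ) h1 h2 c
        have hS2 : sc Γ M c = {u, v} := by rw [← sc_eq hc, hS]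
        rw [hS2] at hC
        by_cases hf : fl Γ ty M b1 b2
        · refine ⟨Stat.f, fun _ => hc, ?_⟩
          have hd : dd Γ ty M b1 b2 c = ({u, v}, true) := by
            unfold dd; rw [hS2, Finset.card_pair (ne_of_tlt tuv)]; simp [hf]
          rw [hd]
          obtain ⟨_, _, he⟩ := hf
          obtain ⟨c', hc', hn1, a, ha, b, hb, hab, ta, tb⟩ := ee_big he (by decide)
          have hcc : Γ.Reachable c0 c' := by
            by_contra hh; exact hn1 (hrest c' hh)
          rw [← sc_eq hcc, hS] at ha hb
          simp only [Finset.mem_insert, Finset.mem_singleton] at ha hb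
          refine ⟨hC, u, v, ?_, ?_, Or.inl rfl⟩
          · rcases ha with rfl | rfl
            · exact ta
            · rcases hb with rfl | rfl
              · rw [ta, tb] at tuv; exact absurd tuv (by decide)
              · exact absurd rfl hab
          · rcases hb with rfl | rfl
            · rcases ha with rfl | rfl
              · exact absurd rfl hab
              · rw [ta, tb] at tuv; exact absurd tuv (by decide)
            · exact tb
        · obtain ⟨k, hk1, hk2⟩ := third_type (ty u) (ty v)
          refine ⟨Stat.p k, fun _ => hc, mkc_sc h1 h2 c, u, v, tuv, hk1, hk2, ?_⟩
          unfold dd; rw [hS2]; simp [hf]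
      · obtain ⟨s, hs1, hs2⟩ := mk_one (ty := ty) (b1 := b1) (b2 := b2) h1 h2 (r c) (hrest c hc)
        exact ⟨s, fun hh => (hs1 hh).elim, hs2⟩
    choose σ hσ1 hσ2 using key
    exact ⟨σ, hσ2, fun a b hn ha hb => (hn ((hσ1 a ha).symm.trans (hσ1 b hb))).elim,
      fun a b _ hn _ _ ha hb _ => (hn ((hσ1 a ha).symm.trans (hσ1 b hb))).elim⟩
  · have key : ∀ c, ∃ s : Stat, (s.big → Γ.Reachable c0 c) ∧ MkS Γ ty st1 st2 (r c) c s (dd Γ ty M b1 b2 c) := by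
      intro c
      by_cases hc : Γ.Reachable c0 c
      · have hC := mkc_sc (Γ := Γ) h1 h2 c
        have hS2 : sc Γ M c = {w, u, v} := by rw [← sc_eq hc, hS]
        rw [hS2] at hC
        refine ⟨Stat.f, fun _ => hc, ?_⟩
        have hd : dd Γ ty M b1 b2 c = ({w, u, v}, false) := by
          unfold dd; rw [hS2]; simp [fl, hb2]
        rw [hd]
        exact ⟨hC, u, v, tu, tv, Or.inr ⟨w, tw, rfl⟩⟩
      · obtain ⟨s, hs1, hs2⟩ := mk_one (ty := ty) (b1 := b1) (b2 := b2) h1 h2 (r c) (hrest c hc)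
        exact ⟨s, fun hh => (hs1 hh).elim, hs2⟩
    choose σ hσ1 hσ2 using key
    exact ⟨σ, hσ2, fun a b hn ha hb => (hn ((hσ1 a ha).symm.trans (hσ1 b hb))).elim,
      fun a b _ hn _ _ ha hb _ => (hn ((hσ1 a ha).symm.trans (hσ1 b hb))).elim⟩
  · obtain ⟨k, hk1, hk2⟩ := third_type (ty u) (ty v)
    obtain ⟨k', hk1', hk2'⟩ := third_type (ty u') (ty v')
    have hkk : k ≠ k' := by
      rintro rfl
      revert hk1 hk2 hk1' hk2' tuv tuv' hdiff
      generalize ty u = a; generalize ty v = b; generalize ty u' = a'; generalize ty v' = b'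
      revert a b a' b' k; decide
    have nfl : ¬ fl Γ ty M b1 b2 := fun hh => hb2 hh.1
    have key : ∀ c, ∃ s : Stat, (s.big → (Γ.Reachable c0 c ∧ s = Stat.p k) ∨ (Γ.Reachable c1 c ∧ s = Stat.p k')) ∧ 
        MkS Γ ty st1 st2 (r c) c s (dd Γ ty M b1 b2 c) := by
      intro c
      by_cases hc : Γ.Reachable c0 c
      · have hC := mkc_sc (Γ := Γ) h1 h2 c
        have hS2 : sc Γ M c = {u, v} := by rw [← sc_eq hc, hS]
        rw [hS2] at hC
        refine ⟨Stat.p k, fun _ => Or.inl ⟨hc, rfl⟩, mkc_sc h1 h2 c, u, v, tuv, hk1, hk2, ?_⟩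
        unfold dd; rw [hS2]; simp [nfl]
      by_cases hc1 : Γ.Reachable c1 c
      · have hC := mkc_sc (Γ := Γ) h1 h2 c
        have hS2 : sc Γ M c = {u', v'} := by rw [← sc_eq hc1, hS']
        rw [hS2] at hC
        refine ⟨Stat.p k', fun _ => Or.inr ⟨hc1, rfl⟩, mkc_sc h1 h2 c, u', v', tuv', hk1', hk2', ?_⟩
        unfold dd; rw [hS2]; simp [nfl]
      · obtain ⟨s, hs1, hs2⟩ := mk_one (ty := ty) (b1 := b1) (b2 := b2) h1 h2 (r c) (hrest c hc hc1)
        exact ⟨s, fun hh => (hs1 hh).elim, hs2⟩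
    choose σ hσ1 hσ2 using key
    refine ⟨σ, hσ2, fun a b hn ha hb => ?_, fun a b e hab hae hbe ha hb he => ?_⟩
    · rcases hσ1 a ha with ⟨p, q⟩ | ⟨p, q⟩ <;> rcases hσ1 b hb with ⟨p', q'⟩ | ⟨p', q'⟩
      · exact (hn (p.symm.trans p')).elim
      · exact ⟨k, k', q, q', hkk⟩
      · exact ⟨k', k, q, q', hkk.symm⟩
      · exact (hn (p.symm.trans p')).elim
    · rcases hσ1 a ha with ⟨p, _⟩ | ⟨p, _⟩ <;> rcases hσ1 b hb with ⟨p', _⟩ | ⟨p', _⟩ <;> 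
        rcases hσ1 e he with ⟨p'', _⟩ | ⟨p'', _⟩ <;>
        first
        | exact hab (p.symm.trans p')
        | exact hae (p.symm.trans p'')
        | exact hbe (p'.symm.trans p'')

theorem mks_uniq {r c : W} {s s' : Stat} {d : Finset W × Bool} (h : MkS Γ ty st1 st2 r c s d)
    (h' : MkS Γ ty st1 st2 r c s' d) : s = s' := by
  have hz : ∀ {d : Finset W × Bool}, MkS Γ ty st1 st2 r c Stat.z d → d.1.card = 1 ∧ d.2 = false ∧ d.1 = {r} := by
    rintro d ⟨_, rfl⟩; simp
  have ho : ∀ {d : Finset W × Bool}, MkS Γ ty st1 st2 r c Stat.o d → d.1.card = 1 ∧ d.2 = false ∧ d.1 ≠ {r} := by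
    rintro d ⟨_, u, hu, rfl⟩; simp [hu]
  have hp : ∀ {k} {d : Finset W × Bool}, MkS Γ ty st1 st2 r c (Stat.p k) d → d.1.card = 2 ∧ d.2 = false := by
    rintro k d ⟨_, u, v, huv, _, _, rfl⟩; exact ⟨Finset.card_pair (ne_of_tlt huv), rfl⟩
  have hf : ∀ {d : Finset W × Bool}, MkS Γ ty st1 st2 r c Stat.f d → d.1.card ≠ 1 ∧ (d.2 = true ∨ d.1.card = 3) := by
    rintro d ⟨_, u, v, tu, tv, rfl | ⟨w, tw, rfl⟩⟩
    · refine ⟨?_, Or.inl rfl⟩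
      have : u ≠ v := by rintro rfl; rw [tu] at tv; exact absurd tv (by decide)
      simp [Finset.card_pair this]
    · have h1 : u ≠ v := by rintro rfl; rw [tu] at tv; exact absurd tv (by decide)
      have h2 : w ≠ v := by rintro rfl; rw [tw] at tv; exact absurd tv (by decide)
      have h3 : w ≠ u := by rintro rfl; rw [tw] at tu; exact absurd tu (by decide)
      have : ({w, u, v} : Finset W).card = 3 := Finset.card_eq_three.2 ⟨w, u, v, h3, h2, h1, rfl⟩
      simp [this]
  have pf : ∀ {k} {d : Finset W × Bool}, MkS Γ ty st1 st2 r c (Stat.p k) d → MkS Γ ty st1 st2 r c Stat.f d → False := by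
    intro k d h1 h2
    obtain ⟨a, b⟩ := hp h1
    rcases (hf h2).2 with e | e
    · rw [b] at e; cases e
    · omega
  cases s with
  | z => cases s' with
    | z => rfl
    | o => exact absurd (hz h).2.2 (ho h').2.2
    | p k => have := (hz h).1; have := (hp h').1; omega
    | f => exact absurd (hz h).1 (hf h').1
  | o => cases s' with
    | z => exact absurd (hz h').2.2 (ho h).2.2
    | o => rfl
    | p k => have := (ho h).1; have := (hp h').1; omega
    | f => exact absurd (ho h).1 (hf h').1
  | p k => cases s' with
    | z => have := (hz h').1; have := (hp h).1; omega
    | o => have := (ho h').1; have := (hp h).1; omega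
    | p k' =>
      obtain ⟨_, u, v, tuv, e1, e2, e3⟩ := h
      obtain ⟨_, u', v', tuv', e1', e2', e3'⟩ := h'
      rw [e3] at e3'
      have e4 : ({u, v} : Finset W) = {u', v'} := congrArg Prod.fst e3'
      have hu : u ∈ ({u', v'} : Finset W) := by rw [← e4]; simp
      have hv : v ∈ ({u', v'} : Finset W) := by rw [← e4]; simp
      simp only [Finset.mem_insert, Finset.mem_singleton] at hu hv
      congr 1
      have : k ≠ ty u → k ≠ ty v → k' ≠ ty u → k' ≠ ty v → ty u < ty v → k = k' := by
        clear e1 e2 e1' e2'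
        generalize ty u = a; generalize ty v = b; revert k k' a b; decide
      refine this e1.symm e2.symm ?_ ?_ tuv
      · rcases hu with rfl | rfl
        exacts [e1'.symm, e2'.symm]
      · rcases hv with rfl | rfl
        exacts [e1'.symm, e2'.symm]
    | f => exact (pf h h').elim
  | f => cases s' with
    | z => exact absurd (hz h').1 (hf h).1
    | o => exact absurd (ho h').1 (hf h).1
    | p k => exact (pf h' h).elim
    | f => rfl

/-- distinct types within the marks -/
theorem mks_types {r c : W} {s : Stat} {d : Finset W × Bool} (h : MkS Γ ty st1 st2 r c s d)
    {x y : W} (hx : x ∈ d.1) (hy : y ∈ d.1) (ht : ty x = ty y) : x = y := by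
  cases s with
  | z => obtain ⟨_, rfl⟩ := h; simp at hx hy; rw [hx, hy]
  | o => obtain ⟨_, u, _, rfl⟩ := h; simp at hx hy; rw [hx, hy]
  | p k => 
    obtain ⟨_, u, v, huv, _, _, rfl⟩ := h
    simp at hx hy
    rcases hx with rfl | rfl <;> rcases hy with rfl | rfl <;> first | rfl | skip
    · exact absurd ht huv.ne
    · exact absurd ht huv.ne'
  | f =>
    obtain ⟨_, u, v, tu, tv, rfl | ⟨w, tw, rfl⟩⟩ := h
    · simp at hx hy
      rcases hx with rfl | rfl <;> rcases hy with rfl | rfl <;> first | rfl | (rw [tu, tv] at ht; exact absurd ht (by decide))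
    · simp at hx hy
      rcases hx with rfl | rfl | rfl <;> rcases hy with rfl | rfl | rfl <;> 
        first 
        | rfl 
        | (rw [tu, tv] at ht; exact absurd ht (by decide))
        | (rw [tw, tv] at ht; exact absurd ht (by decide))
        | (rw [tw, tu] at ht; exact absurd ht (by decide))

theorem mks_not_big {r c : W} {s : Stat} {d : Finset W × Bool} (h : MkS Γ ty st1 st2 r c s d)
    (hs : ¬ s.big) : d.1.card = 1 ∧ d.2 = false := by
  cases s with
  | z => obtain ⟨_, rfl⟩ := h; simp
  | o => obtain ⟨_, u, _, rfl⟩ := h; simp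
  | p k => exact (hs trivial).elim
  | f => exact (hs trivial).elim

theorem tv_swap {b1' b2' : Prop} (h : TV Γ ty M b1 b2) (h' : TV Γ ty M b1' b2') (a1 : ¬ b1) (a2 : b2) (a1' : b1')
    (a2' : ¬ b2') : EE Γ ty M 1 2 := by
  rcases tv_cases h with ⟨q, _⟩ | ⟨c0, u, v, hS, tuv, hrest, hb⟩ | ⟨_, q, _⟩ | ⟨_, q, _⟩
  · exact (a1 q).elim
  rotate_left
  · exact (q a2).elim
  · exact (q a2).elim
  rcases tv_cases h' with ⟨_, q, _⟩ | ⟨c1, u', v', hS', tuv', hrest', hb'⟩ | ⟨q, _⟩ | ⟨q, _⟩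
  · exact (a2' q).elim
  rotate_left
  · exact (q a1').elim
  · exact (q a1').elim
  have hb2 : ty u = 1 ∨ ty v = 1 := by
    rcases hb with ⟨q, _⟩ | ⟨_, _, q⟩
    · exact (a1 q).elim
    · exact q
  have hb2' : ty v' = 2 := by
    rcases hb' with ⟨_, _, q⟩ | ⟨q, _⟩
    · exact q
    · exact (q a1').elim
  have hr : Γ.Reachable c0 c1 := by
    by_contra hh
    have := hrest _ hh
    rw [hS', Finset.card_pair (ne_of_tlt tuv')] at this
    omega
  have m1 : ∃ x ∈ sc Γ M c0, ty x = 1 := by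
    rw [hS]
    rcases hb2 with q | q
    exacts [⟨u, by simp, q⟩, ⟨v, by simp, q⟩]
  have m2 : v' ∈ sc Γ M c0 := by rw [sc_eq hr, hS']; simp
  obtain ⟨x, hx, tx⟩ := m1
  rw [mem_sc] at hx m2
  exact ⟨x, hx.1, v', m2.1, hx.2.symm.trans m2.2, tx, hb2'⟩

theorem fl_comp (h : TV Γ ty M b1 b2) (hf : fl Γ ty M b1 b2) : ∃ c0 ∈ Rt Γ, ∀ c ∈ Rt Γ, 2 ≤ (sc Γ M c).card ↔ c = c0 := by
  rcases tv_cases h with ⟨q, _⟩ | ⟨c0, u, v, hS, tuv, hrest, hb⟩ | ⟨_, q, _⟩ | ⟨_, q, _⟩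
  · exact (hf.2.1 q).elim
  rotate_left
  · exact (q hf.1).elim
  · exact (q hf.1).elim
  refine ⟨rt Γ c0, rt_mem c0, fun c hc => ⟨fun h2 => ?_, ?_⟩⟩
  · by_contra hh
    have : ¬ Γ.Reachable c0 c := fun hr => hh (by rw [rt_eq hr, mem_Rt.1 hc])
    have := hrest _ this
    omega
  · rintro rfl
    rw [sc_eq (rt_reach c0), hS, Finset.card_pair (ne_of_tlt tuv)]

theorem tv_uniq {b1' b2' : Prop} (h : TV Γ ty M b1 b2) (h' : TV Γ ty M b1' b2')
    (hd : ∀ c, dd Γ ty M b1 b2 c = dd Γ ty M b1' b2' c) : (b1 ↔ b1') ∧ (b2 ↔ b2') := by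
  have main : ∀ {b1 b2 b1' b2' : Prop}, TV Γ ty M b1 b2 → TV Γ ty M b1' b2' →
     (∀ c, dd Γ ty M b1 b2 c = dd Γ ty M b1' b2' c) → ¬ b1 → b2 → b1' → ¬ b2' → False := by
    intro b1 b2 b1' b2' h h' hd a1 a2 a3 a4
    have hE := tv_swap h h' a1 a2 a3 a4
    obtain ⟨c0, h0, hc⟩ := fl_comp h ⟨a2, a1, hE⟩
    have := congrArg Prod.snd (hd c0)
    have h2 := (hc c0 h0).2 rfl
    simp [dd, fl, a1, a2, a3, hE] at this
    omega
  have e := h.exc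
  have e' := h'.exc
  by_cases p1 : b1 <;> by_cases p2 : b2 <;> by_cases p3 : b1' <;> by_cases p4 : b2' <;> 
    simp only [p1, p2, p3, p4, if_true, if_false] at e e' <;>
    first
    | (exfalso; omega)
    | (simp only [p1, p2, p3, p4]; done)
    | exact (main h h' hd p1 p2 p3 p4).elim
    | exact (main h' h (fun c => (hd c).symm) p3 p4 p1 p2).elim
    | simp [p1, p2, p3, p4]

theorem tv_sum (h : TV Γ ty M b1 b2) {σ : W → Stat} {r : W → W} 
    (hσ : ∀ c, MkS Γ ty st1 st2 (r c) c (σ c) (dd Γ ty M b1 b2 c)) (hc : ∀ c c', Γ.Reachable c c' → σ c = σ c') :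
    ∑ c ∈ Rt Γ, (σ c).n = (M.filter fun m => σ m ≠ Stat.z).card + (if fl Γ ty M b1 b2 then 1 else 0) := by
  have h1 : ∀ c, (σ c).n = (sc Γ (M.filter fun m => σ m ≠ Stat.z) c).card + 
      (if (dd Γ ty M b1 b2 c).2 = true then 1 else 0) := by
    intro c
    have e1 : (sc Γ (M.filter fun m => σ m ≠ Stat.z) c) = if σ c = Stat.z then ∅ else (dd Γ ty M b1 b2 c).1 := by
      ext x
      rw [mem_sc, Finset.mem_filter]
      split_ifs with hz
      · constructor
        · rintro ⟨⟨_, p⟩, q⟩; exact (p (by rw [← hc _ _ q, hz])).elim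
        · intro p; simp at p
      · change _ ↔ x ∈ sc Γ M c
        rw [mem_sc]
        exact ⟨fun ⟨⟨p, _⟩, q⟩ => ⟨p, q⟩, fun ⟨p, q⟩ => ⟨⟨p, by rw [← hc _ _ q]; exact hz⟩, q⟩⟩
    rw [e1]
    have := hσ c
    revert this
    generalize dd Γ ty M b1 b2 c = d
    intro hm
    generalize σ c = s at hm
    cases s with
    | z => obtain ⟨_, rfl⟩ := hm; simp [Stat.n]
    | o => obtain ⟨_, u, _, rfl⟩ := hm; simp [Stat.n]
    | p k => obtain ⟨_, u, v, huv, _, _, rfl⟩ := hm; simp [Stat.n, Finset.card_pair (ne_of_tlt huv)]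
    | f => 
      obtain ⟨_, u, v, tu, tv, rfl | ⟨w, tw, rfl⟩⟩ := hm
      · have : u ≠ v := by rintro rfl; rw [tu] at tv; exact absurd tv (by decide)
        simp [Stat.n, Finset.card_pair this]
      · have h1 : u ≠ v := by rintro rfl; rw [tu] at tv; exact absurd tv (by decide)
        have h2 : w ≠ v := by rintro rfl; rw [tw] at tv; exact absurd tv (by decide)
        have h3 : w ≠ u := by rintro rfl; rw [tw] at tu; exact absurd tu (by decide)
        have : ({w, u, v} : Finset W).card = 3 := Finset.card_eq_three.2 ⟨w, u, v, h3, h2, h1, rfl⟩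
        simp [Stat.n, this]
  rw [Finset.sum_congr rfl fun c _ => h1 c, Finset.sum_add_distrib, ← card_sc]
  congr 1
  split_ifs with hf
  · obtain ⟨c0, h0, hc0⟩ := fl_comp h hf
    rw [Finset.sum_eq_single c0]
    · simp [dd, hf, (hc0 c0 h0).2 rfl]
    · intro c hcR hne
      have : ¬ 2 ≤ (sc Γ M c).card := fun hh => hne ((hc0 c hcR).1 hh)
      simp [dd, this]
    · intro hh; exact (hh h0).elim
  · apply Finset.sum_eq_zero
    intro c _
    simp [dd, hf]

end comb
end TC

namespace TC

section comb
variable {W : Type} [Fintype W]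
variable {Γ : SimpleGraph W} {ty : W → Fin 3} {M : Finset W} {st1 st2 : W}

theorem EE.symm {i j : Fin 3} (h : EE Γ ty M i j) : EE Γ ty M j i := by
  obtain ⟨u, hu, v, hv, hr, e1, e2⟩ := h
  exact ⟨v, hv, u, hu, hr.symm, e2, e1⟩

theorem ee_sc {c u v : W} (hu : u ∈ sc Γ M c) (hv : v ∈ sc Γ M c) : EE Γ ty M (ty u) (ty v) := by
  rw [mem_sc] at hu hv
  exact ⟨u, hu.1, v, hv.1, hu.2.symm.trans hv.2, rfl, rfl⟩

theorem cnt0 (h : ∀ c, (sc Γ M c).card = 1) : M.card = (Rt Γ).card := by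
  rw [card_sc (Γ := Γ) M, Finset.card_eq_sum_ones]
  exact Finset.sum_congr rfl fun c _ => h c

theorem cnt1 {c0 : W} (h : ∀ c, ¬ Γ.Reachable c0 c → (sc Γ M c).card = 1) :
    M.card + 1 = (Rt Γ).card + (sc Γ M c0).card := by
  rw [card_sc (Γ := Γ) M, Finset.card_eq_sum_ones, ← Finset.add_sum_erase _ _ (rt_mem c0),
    ← Finset.add_sum_erase (Rt Γ) (fun _ => 1) (rt_mem c0), sc_eq (rt_reach c0)]
  have : ∑ x ∈ (Rt Γ).erase (rt Γ c0), (sc Γ M x).card = ∑ x ∈ (Rt Γ).erase (rt Γ c0), 1 := by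
    refine Finset.sum_congr rfl fun c hc => h c fun hr => ?_
    rw [Finset.mem_erase, mem_Rt] at hc
    exact hc.1 (by rw [rt_eq hr, hc.2])
  omega

theorem cnt2 {c0 c1 : W} (hn : ¬ Γ.Reachable c0 c1) 
    (h : ∀ c, ¬ Γ.Reachable c0 c → ¬ Γ.Reachable c1 c → (sc Γ M c).card = 1) :
    M.card + 2 = (Rt Γ).card + (sc Γ M c0).card + (sc Γ M c1).card := by
  have h1 : rt Γ c1 ∈ (Rt Γ).erase (rt Γ c0) := by
    rw [Finset.mem_erase]
    refine ⟨fun e => hn ?_, rt_mem _⟩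
    exact (rt_reach c0).symm.trans (e ▸ rt_reach c1)
  rw [card_sc (Γ := Γ) M, Finset.card_eq_sum_ones, ← Finset.add_sum_erase _ _ (rt_mem c0),
    ← Finset.add_sum_erase (Rt Γ) (fun _ => 1) (rt_mem c0), sc_eq (rt_reach c0), 
    ← Finset.add_sum_erase _ _ h1, ← Finset.add_sum_erase _ (fun _ => 1) h1, sc_eq (rt_reach c1)]
  have : ∑ x ∈ ((Rt Γ).erase (rt Γ c0)).erase (rt Γ c1), (sc Γ M x).card = 
      ∑ x ∈ ((Rt Γ).erase (rt Γ c0)).erase (rt Γ c1), 1 := by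
    refine Finset.sum_congr rfl fun c hc => ?_
    rw [Finset.mem_erase, Finset.mem_erase, mem_Rt] at hc
    exact h c (fun hr => hc.2.1 (by rw [rt_eq hr, hc.2.2])) (fun hr => hc.1 (by rw [rt_eq hr, hc.2.2]))
  omega

theorem tv_of {σ : W → Stat} {d : W → Finset W × Bool} {r : W → W}
    (hd : ∀ c c', Γ.Reachable c c' → d c = d c')
    (hm : ∀ c, MkS Γ ty st1 st2 (r c) c (σ c) (d c)) (hg : GV Γ σ) :
    ∃ (M : Finset W) (b1 b2 : Prop), TV Γ ty M b1 b2 ∧ (∀ c, dd Γ ty M b1 b2 c = d c) := by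
  set M : Finset W := Finset.univ.filter fun x => x ∈ (d x).1 with hM
  have hsc : ∀ c, sc Γ M c = (d c).1 := by
    intro c; ext x
    rw [mem_sc, hM, Finset.mem_filter]
    constructor
    · rintro ⟨⟨_, p⟩, q⟩; rw [hd c x q]; exact p
    · intro p
      have q := (hm c).1.1 x p
      exact ⟨⟨Finset.mem_univ _, by rw [← hd c x q]; exact p⟩, q⟩
  have hsmall : ∀ c, ¬ (σ c).big → (sc Γ M c).card = 1 ∧ (d c).2 = false := by
    intro c hc
    rw [hsc]
    exact mks_not_big (hm c) hc
  have hv1 : ∀ c, ∃ m ∈ M, Γ.Reachable c m := by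
    intro c
    have : (sc Γ M c).Nonempty := by
      rw [hsc]
      have := hm c
      revert this
      generalize σ c = s
      generalize d c = dc
      intro h
      cases s with
      | z => obtain ⟨_, rfl⟩ := h; simp
      | o => obtain ⟨_, u, _, rfl⟩ := h; simp
      | p k => obtain ⟨_, u, v, huv, _, _, rfl⟩ := h; simp
      | f => obtain ⟨_, u, v, tu, tv, rfl | ⟨w, tw, rfl⟩⟩ := h <;> simp
    obtain ⟨m, hm⟩ := this
    rw [mem_sc] at hm
    exact ⟨m, hm.1, hm.2⟩
  -- equality of data from flag info
  have hdd : ∀ {b1 b2 : Prop}, (∀ c, ((d c).2 = true ↔ fl Γ ty M b1 b2 ∧ 2 ≤ (sc Γ M c).card)) → 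
      ∀ c, dd Γ ty M b1 b2 c = d c := by
    intro b1 b2 hh c
    refine Prod.ext (hsc c) ?_
    unfold dd
    simp only
    rw [Bool.eq_iff_iff, decide_eq_true_iff]
    exact (hh c).symm
  have tri : ∀ {P : Fin 3 → Prop}, P 0 → P 1 → P 2 → ∀ i, P i := by
    intro P h0 h1 h2 i
    fin_cases i
    exacts [h0, h1, h2]
  by_cases hA : ∀ c, ¬ (σ c).big
  · refine ⟨M, True, True, ⟨hv1, ?_, ?_⟩, hdd fun c => ?_⟩
    · rw [cnt0 fun c => (hsmall c (hA c)).1]; simp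
    · refine tri ⟨1, by decide, ?_⟩ ⟨0, by decide, ?_⟩ ⟨0, by decide, ?_⟩ <;> simp [EF]
    · simp [(hsmall c (hA c)).2, fl]
  push Not at hA
  obtain ⟨c0, hc0⟩ := hA
  by_cases hB : ∀ c, ¬ Γ.Reachable c0 c → ¬ (σ c).big
  · have hrest : ∀ c, ¬ Γ.Reachable c0 c → (sc Γ M c).card = 1 := fun c hc => (hsmall c (hB c hc)).1
    have hcnt := cnt1 hrest
    have h0 := hm c0
    have hs0 := hsc c0
    have hflag : ∀ {b1 b2 : Prop}, ((d c0).2 = true ↔ fl Γ ty M b1 b2 ∧ 2 ≤ (sc Γ M c0).card) → 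
        ∀ c, ((d c).2 = true ↔ fl Γ ty M b1 b2 ∧ 2 ≤ (sc Γ M c).card) := by
      intro b1 b2 hh c
      by_cases hr : Γ.Reachable c0 c
      · rw [← hd c0 c hr, ← sc_eq hr]; exact hh
      · have := hsmall c (hB c hr)
        rw [this.1, this.2]; simp
    cases hσ : σ c0 with
    | z => rw [hσ] at hc0; exact hc0.elim
    | o => rw [hσ] at hc0; exact hc0.elim
    | p k =>
      rw [hσ] at h0
      obtain ⟨_, u, v, huv, hk1, hk2, e⟩ := h0
      rw [e] at hs0
      have hs0 : sc Γ M c0 = {u, v} := hs0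
      rw [hs0, Finset.card_pair (ne_of_tlt huv)] at hcnt
      have hE : EE Γ ty M (ty u) (ty v) := ee_sc (c := c0) (by rw [hs0]; simp) (by rw [hs0]; simp)
      by_cases h2 : ty v = 2
      · refine ⟨M, True, False, ⟨hv1, ?_, ?_⟩, hdd (hflag ?_)⟩
        · simp; omega
        · refine tri ⟨1, by decide, ?_⟩ ⟨0, by decide, ?_⟩ ⟨ty u, by rw [← h2]; exact huv.ne, ?_⟩
          · simp [EF]
          · simp [EF]
          · left; rw [← h2]; exact hE.symm
        · rw [e]; simp [fl]
      · have h01 : ty u = 0 ∧ ty v = 1 := by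
          revert huv h2
          generalize ty u = a; generalize ty v = b; clear * -; revert a b; decide
        refine ⟨M, False, True, ⟨hv1, ?_, ?_⟩, hdd (hflag ?_)⟩
        · simp; omega
        · refine tri ⟨2, by decide, ?_⟩ ⟨0, by decide, ?_⟩ ⟨0, by decide, ?_⟩
          · simp [EF]
          · left; rw [← h01.1, ← h01.2]; exact hE.symm
          · simp [EF]
        · rw [e]; simp only [Bool.false_eq_true, false_iff]
          rintro ⟨⟨_, _, he⟩, _⟩
          obtain ⟨c', hc', hn1, a, ha, b, hb, hab, ta, tb⟩ := ee_big he (by decide)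
          have hcc : Γ.Reachable c0 c' := by
            by_contra hh; exact hn1 (hrest c' hh)
          rw [← sc_eq hcc, hs0] at hb
          simp only [Finset.mem_insert, Finset.mem_singleton] at hb
          rcases hb with rfl | rfl
          · rw [h01.1] at tb; exact absurd tb (by decide)
          · exact h2 tb
    | f =>
      rw [hσ] at h0
      obtain ⟨_, u, v, tu, tv, e | ⟨w, tw, e⟩⟩ := h0
      · rw [e] at hs0
        have hs0 : sc Γ M c0 = {u, v} := hs0
        have huv : u ≠ v := by rintro rfl; rw [tu] at tv; exact absurd tv (by decide)
        rw [hs0, Finset.card_pair huv] at hcnt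
        have hE : EE Γ ty M (ty u) (ty v) := ee_sc (c := c0) (by rw [hs0]; simp) (by rw [hs0]; simp)
        rw [tu, tv] at hE
        refine ⟨M, False, True, ⟨hv1, ?_, ?_⟩, hdd (hflag ?_)⟩
        · simp; omega
        · exact tri ⟨2, by decide, by simp [EF]⟩ ⟨2, by decide, Or.inl hE⟩ ⟨1, by decide, Or.inl hE.symm⟩
        · rw [e, hs0, Finset.card_pair huv]; simp [fl, hE]
      · rw [e] at hs0
        have hs0 : sc Γ M c0 = {w, u, v} := hs0
        have h1 : u ≠ v := by rintro rfl; rw [tu] at tv; exact absurd tv (by decide)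
        have h2 : w ≠ v := by rintro rfl; rw [tw] at tv; exact absurd tv (by decide)
        have h3 : w ≠ u := by rintro rfl; rw [tw] at tu; exact absurd tu (by decide)
        have hc3 : ({w, u, v} : Finset W).card = 3 := Finset.card_eq_three.2 ⟨w, u, v, h3, h2, h1, rfl⟩
        rw [hs0, hc3] at hcnt
        have hE1 : EE Γ ty M (ty u) (ty v) := ee_sc (c := c0) (by rw [hs0]; simp) (by rw [hs0]; simp)
        have hE2 : EE Γ ty M (ty w) (ty v) := ee_sc (c := c0) (by rw [hs0]; simp) (by rw [hs0]; simp)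
        rw [tu, tv] at hE1
        rw [tw, tv] at hE2
        refine ⟨M, False, False, ⟨hv1, ?_, ?_⟩, hdd (hflag ?_)⟩
        · simp; omega
        · exact tri ⟨2, by decide, Or.inl hE2⟩ ⟨2, by decide, Or.inl hE1⟩ ⟨1, by decide, Or.inl hE1.symm⟩
        · rw [e]; simp [fl]
  push Not at hB
  obtain ⟨c1, hnr, hc1⟩ := hB
  obtain ⟨k, k', hk, hk', hkk⟩ := hg.g2 c0 c1 hnr hc0 hc1
  have hbs : ∀ c, ¬ Γ.Reachable c0 c → ¬ Γ.Reachable c1 c → ¬ (σ c).big := fun c h1 h2 h3 =>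
    hg.g3 c0 c1 c hnr h1 h2 hc0 hc1 h3
  have hcnt := cnt2 hnr fun c h1 h2 => (hsmall c (hbs c h1 h2)).1
  have h0 := hm c0
  have h1 := hm c1
  have hs0 := hsc c0
  have hs1 := hsc c1
  rw [hk] at h0
  rw [hk'] at h1
  obtain ⟨_, u, v, huv, hk1, hk2, e⟩ := h0
  obtain ⟨_, u', v', huv', hk1', hk2', e'⟩ := h1
  rw [e] at hs0
  rw [e'] at hs1
  have hs0 : sc Γ M c0 = {u, v} := hs0
  have hs1 : sc Γ M c1 = {u', v'} := hs1
  rw [hs0, hs1, Finset.card_pair (ne_of_tlt huv), Finset.card_pair (ne_of_tlt huv')] at hcnt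
  have hE : EE Γ ty M (ty u) (ty v) := ee_sc (c := c0) (by rw [hs0]; simp) (by rw [hs0]; simp)
  have hE' : EE Γ ty M (ty u') (ty v') := ee_sc (c := c1) (by rw [hs1]; simp) (by rw [hs1]; simp)
  refine ⟨M, False, False, ⟨hv1, ?_, ?_⟩, hdd fun c => ?_⟩
  · simp; omega
  · intro i
    have : i = ty u ∨ i = ty v ∨ i = ty u' ∨ i = ty v' := by
      revert huv huv' hk1 hk2 hk1' hk2'
      generalize ty u = a; generalize ty v = b; generalize ty u' = a'; generalize ty v' = b'
      clear hk hk'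
      revert hkk
      clear * -
      revert a b a' b' k k' i
      decide
    rcases this with rfl | rfl | rfl | rfl
    · exact ⟨_, huv.ne', Or.inl hE⟩
    · exact ⟨_, huv.ne, Or.inl hE.symm⟩
    · exact ⟨_, huv'.ne', Or.inl hE'⟩
    · exact ⟨_, huv'.ne, Or.inl hE'.symm⟩
  · have : (d c).2 = false := by
      by_cases q1 : Γ.Reachable c0 c
      · rw [← hd _ _ q1, e]
      by_cases q2 : Γ.Reachable c1 c
      · rw [← hd _ _ q2, e']
      exact (hsmall c (hbs c q1 q2)).2
    rw [this]; simp [fl]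

end comb
end TC

namespace TC

/-- vertices plus one extra leaf -/
inductive WW (V : Type) : Type
  | v : V → WW V
  | s : WW V

def WW.toOpt {V : Type} : WW V ≃ Option V where
  toFun a := match a with
    | WW.v x => some x
    | WW.s => none
  invFun a := match a with
    | some x => WW.v x
    | none => WW.s
  left_inv a := by cases a <;> rfl
  right_inv a := by cases a <;> rfl

noncomputable instance {V : Type} [Fintype V] : Fintype (WW V) := Fintype.ofEquiv _ WW.toOpt.symm

theorem card_WW {V : Type} [Fintype V] : Fintype.card (WW V) = Fintype.card V + 1 := by
  rw [Fintype.card_congr WW.toOpt, Fintype.card_option]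

theorem WW.v_inj {V : Type} : Function.Injective (WW.v : V → WW V) := fun _ _ h => by
  injection h

section setup
variable {V : Type} [Fintype V] [LinearOrder V] [LinearOrder (Sym2 V)]

noncomputable def tyW (v0 v1 v2 : V) (pr : V → V) : WW V → Fin 3
  | WW.s => 2
  | WW.v x => if x = v0 ∨ x = v1 ∨ pr x = v1 then 1 else if x = v2 ∨ pr x = v2 then 2 else 0

def piW (v0 v1 v2 : V) : WW V → V
  | WW.s => v2
  | WW.v x => if x = v0 then v1 else x

def emb (e : Sym2 V) : Sym2 (WW V) := Sym2.map WW.v e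

theorem emb_inj : Function.Injective (emb : Sym2 V → Sym2 (WW V)) := Sym2.map.injective WW.v_inj

def vr1 (v0 v1 : V) : Sym2 (WW V) := s(WW.v v0, WW.v v1)
def vr2 (v2 : V) : Sym2 (WW V) := s(WW.s, WW.v v2)

def HW (v0 v1 v2 : V) (F : Set (Sym2 V)) : Set (Sym2 (WW V)) := emb '' F ∪ {vr1 v0 v1, vr2 v2}

def GG (v0 v1 v2 : V) (F : Set (Sym2 V)) : SimpleGraph (WW V) := SimpleGraph.fromEdgeSet (HW v0 v1 v2 F)

variable {G : SimpleGraph V} {v0 v1 v2 : V} {B0 : Set (Sym2 V)} {pr : V → V} {F : Set (Sym2 V)}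

theorem hw_cases {a b : WW V} (h : s(a, b) ∈ HW v0 v1 v2 F) :
    (∃ x y, a = WW.v x ∧ b = WW.v y ∧ s(x, y) ∈ F) ∨ (a = WW.v v0 ∧ b = WW.v v1) ∨ (a = WW.v v1 ∧ b = WW.v v0) ∨
    (a = WW.s ∧ b = WW.v v2) ∨ (a = WW.v v2 ∧ b = WW.s) := by
  rcases h with ⟨e, he, h⟩ | h | h
  · left
    induction e using Sym2.ind with
    | _ x y =>
      simp only [emb, Sym2.map_mk, Sym2.eq_iff] at h
      rcases h with ⟨h1, h2⟩ | ⟨h1, h2⟩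
      · exact ⟨x, y, h1.symm, h2.symm, he⟩
      · exact ⟨y, x, h2.symm, h1.symm, by rw [Sym2.eq_swap]; exact he⟩
  · simp only [vr1, Sym2.eq_iff] at h
    tauto
  · simp only [Set.mem_singleton_iff, vr2, Sym2.eq_iff] at h
    tauto

theorem F_ne (D : Dat G v0 v1 v2 B0 pr) (hF : F ⊆ G.edgeSet \ B0) {x y : V} (h : s(x, y) ∈ F) : 
    x ≠ v0 ∧ y ≠ v0 ∧ x ≠ y := by
  have h1 := D.H0 _ (hF h).1 (hF h).2
  refine ⟨?_, ?_, G.ne_of_adj (hF h).1⟩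
  · rintro rfl; exact h1 (by simp)
  · rintro rfl; exact h1 (by simp)

theorem hw_nd (D : Dat G v0 v1 v2 B0 pr) (hF : F ⊆ G.edgeSet \ B0) {e : Sym2 (WW V)} (h : e ∈ HW v0 v1 v2 F) : 
    ¬ e.IsDiag := by
  induction e using Sym2.ind with
  | _ a b =>
    rw [Sym2.mk_isDiag_iff]
    rintro rfl
    rcases hw_cases h with ⟨x, y, rfl, h1, h2⟩ | ⟨rfl, h⟩ | ⟨rfl, h⟩ | ⟨rfl, h⟩ | ⟨rfl, h⟩
    · exact (F_ne D hF h2).2.2 (WW.v_inj h1)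
    · exact D.h01 (WW.v_inj h)
    · exact D.h01 (WW.v_inj h).symm
    · cases h
    · cases h

theorem gg_edge (D : Dat G v0 v1 v2 B0 pr) (hF : F ⊆ G.edgeSet \ B0) : (GG v0 v1 v2 F).edgeSet = HW v0 v1 v2 F := by
  unfold GG
  rw [SimpleGraph.edgeSet_fromEdgeSet, sdiff_eq_left, Set.disjoint_left]
  intro e he
  exact hw_nd D hF he

theorem gg_adj1 (D : Dat G v0 v1 v2 B0 pr) : (GG v0 v1 v2 F).Adj (WW.v v0) (WW.v v1) := by
  refine ⟨Or.inr (Or.inl rfl), fun h => D.h01 (WW.v_inj h)⟩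

theorem gg_adj2 : (GG v0 v1 v2 F).Adj WW.s (WW.v v2) := by
  refine ⟨Or.inr (Or.inr rfl), fun h => by cases h⟩

theorem gg_adjF (D : Dat G v0 v1 v2 B0 pr) (hF : F ⊆ G.edgeSet \ B0) {x y : V} (h : s(x, y) ∈ F) :
    (GG v0 v1 v2 F).Adj (WW.v x) (WW.v y) :=
  ⟨Or.inl ⟨_, h, rfl⟩, fun h' => (F_ne D hF h).2.2 (WW.v_inj h')⟩

theorem pi_v {x : V} (h : x ≠ v0) : piW v0 v1 v2 (WW.v x) = x := by simp [piW, h]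

theorem pi_v0 : piW v0 v1 v2 (WW.v v0) = v1 := by simp [piW]

theorem pi_ne (D : Dat G v0 v1 v2 B0 pr) (a : WW V) : piW v0 v1 v2 a ≠ v0 := by
  cases a with
  | s => exact D.h02.symm
  | v x => 
    by_cases h : x = v0
    · subst h; rw [pi_v0]; exact D.h01.symm
    · rw [pi_v h]; exact h

theorem pi_reach (D : Dat G v0 v1 v2 B0 pr) (a : WW V) : (GG v0 v1 v2 F).Reachable a (WW.v (piW v0 v1 v2 a)) := by
  cases a with
  | s => exact gg_adj2.reachable
  | v x => 
    by_cases h : x = v0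
    · subst h; rw [pi_v0]; exact (gg_adj1 D).reachable
    · rw [pi_v h]

theorem reach_pi (D : Dat G v0 v1 v2 B0 pr) (hF : F ⊆ G.edgeSet \ B0) {F' : Set (Sym2 V)} 
    {Γ' : SimpleGraph (WW V)} (hle : Γ' ≤ GG v0 v1 v2 F)
    (hF' : ∀ x y, s(x, y) ∈ F → Γ'.Adj (WW.v x) (WW.v y) → (SimpleGraph.fromEdgeSet F').Reachable x y)
    {a b : WW V} (h : Γ'.Reachable a b) : 
    (SimpleGraph.fromEdgeSet F').Reachable (piW v0 v1 v2 a) (piW v0 v1 v2 b) := by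
  refine closed_conn (P := fun c => (SimpleGraph.fromEdgeSet F').Reachable (piW v0 v1 v2 a) (piW v0 v1 v2 c)) 
    ?_ h (SimpleGraph.Reachable.refl _)
  intro c d hcd hc
  refine hc.trans ?_
  rcases hw_cases (hle hcd).1 with ⟨x, y, rfl, rfl, h2⟩ | ⟨rfl, rfl⟩ | ⟨rfl, rfl⟩ | ⟨rfl, rfl⟩ | ⟨rfl, rfl⟩
  · have := F_ne D hF h2
    rw [pi_v this.1, pi_v this.2.1]
    exact hF' x y h2 hcd
  · rw [pi_v0, pi_v D.h01.symm]
  · rw [pi_v0, pi_v D.h01.symm]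
  · rw [pi_v D.h02.symm]; exact SimpleGraph.Reachable.refl _
  · rw [pi_v D.h02.symm]; exact SimpleGraph.Reachable.refl _

theorem gg_reach_pi (D : Dat G v0 v1 v2 B0 pr) (hF : F ⊆ G.edgeSet \ B0) 
    {a b : WW V} (h : (GG v0 v1 v2 F).Reachable a b) : 
    (SimpleGraph.fromEdgeSet F).Reachable (piW v0 v1 v2 a) (piW v0 v1 v2 b) :=
  reach_pi D hF le_rfl (fun x y h _ => SimpleGraph.Adj.reachable ⟨h, (F_ne D hF h).2.2⟩) h

theorem gg_acyclic (D : Dat G v0 v1 v2 B0 pr) (hF : F ⊆ G.edgeSet \ B0) 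
    (hac : (SimpleGraph.fromEdgeSet F).IsAcyclic) : (GG v0 v1 v2 F).IsAcyclic := by
  rw [SimpleGraph.isAcyclic_iff_forall_adj_isBridge]
  intro a b hab
  rw [SimpleGraph.isBridge_iff]
  intro hr
  have key : ∀ {a b : WW V}, a ≠ b → (∀ x, (GG v0 v1 v2 F).Adj a x → x = b) → 
      ((GG v0 v1 v2 F) \ SimpleGraph.fromEdgeSet {s(a, b)}).Reachable a b → False := by
    intro a b hne hl hr
    have : b = a := closed_conn (P := fun y => y = a) (by
      rintro p q ⟨hpq, hn⟩ rfl
      have := hl q hpq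
      subst this
      exact (hn ⟨rfl, hne⟩).elim) hr rfl
    exact hne this.symm
  have l1 : ∀ x, (GG v0 v1 v2 F).Adj (WW.v v0) x → x = WW.v v1 := by
    intro x hx
    rcases hw_cases hx.1 with ⟨p, q, h, rfl, h2⟩ | ⟨_, h⟩ | ⟨h, _⟩ | ⟨h, _⟩ | ⟨h, _⟩
    · exact absurd (WW.v_inj h).symm (F_ne D hF h2).1
    · exact h
    · exact absurd (WW.v_inj h) D.h01
    · cases h
    · exact absurd (WW.v_inj h) D.h02
  have l2 : ∀ x, (GG v0 v1 v2 F).Adj WW.s x → x = WW.v v2 := by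
    intro x hx
    rcases hw_cases hx.1 with ⟨p, q, h, rfl, h2⟩ | ⟨h, _⟩ | ⟨h, _⟩ | ⟨_, h⟩ | ⟨h, _⟩
    · cases h
    · cases h
    · cases h
    · exact h
    · cases h
  rcases hw_cases hab.1 with ⟨x, y, rfl, rfl, h2⟩ | ⟨rfl, rfl⟩ | ⟨rfl, rfl⟩ | ⟨rfl, rfl⟩ | ⟨rfl, rfl⟩
  · have hxy := F_ne D hF h2
    rw [SimpleGraph.isAcyclic_iff_forall_adj_isBridge] at hac
    have hb := @hac x y ⟨h2, hxy.2.2⟩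
    rw [SimpleGraph.isBridge_iff] at hb
    apply hb
    have := reach_pi D hF (F' := F \ {s(x, y)}) sdiff_le (fun p q hpq h3 => by
      refine SimpleGraph.Adj.reachable ⟨⟨hpq, fun h4 => h3.2 ⟨?_, h3.ne⟩⟩, (F_ne D hF hpq).2.2⟩
      have : emb s(p, q) = emb s(x, y) := congrArg emb h4
      exact this) hr
    rw [pi_v hxy.1, pi_v hxy.2.1] at this
    refine this.mono ?_
    intro p q hpq
    exact ⟨⟨hpq.1.1, hpq.2⟩, fun h => hpq.1.2 h.1⟩
  · exact key hab.ne l1 hr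
  · refine key hab.ne' l1 ?_
    rw [Sym2.eq_swap]; exact hr.symm
  · exact key hab.ne l2 hr
  · refine key hab.ne' l2 ?_
    rw [Sym2.eq_swap]; exact hr.symm

theorem ty_v0 : tyW v0 v1 v2 pr (WW.v v0) = 1 := by simp [tyW]
theorem ty_v1 : tyW v0 v1 v2 pr (WW.v v1) = 1 := by simp [tyW]
theorem ty_v2 (D : Dat G v0 v1 v2 B0 pr) : tyW v0 v1 v2 pr (WW.v v2) = 2 := by
  simp [tyW, D.h02.symm, D.h12.symm, D.par2, D.h01]

/-- the cone vertex of given type -/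
def vv (v0 v1 v2 : V) (i : Fin 3) : V := if i = 0 then v0 else if i = 1 then v1 else v2

theorem pr_vv (D : Dat G v0 v1 v2 B0 pr) {x : V} (h0 : x ≠ v0) (h1 : x ≠ v1) (h2 : x ≠ v2) :
    pr x = vv v0 v1 v2 (tyW v0 v1 v2 pr (WW.v x)) := by
  have := D.parm x
  have := D.h01; have := D.h02; have := D.h12
  simp only [tyW, vv, h0, h1, h2, false_or]
  split_ifs with a b c d <;> simp_all

theorem gg_lc (D : Dat G v0 v1 v2 B0 pr) (hF : F ⊆ G.edgeSet \ B0) 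
    (hac : (GG v0 v1 v2 F).IsAcyclic) : 
    LC (GG v0 v1 v2 F) (tyW v0 v1 v2 pr) (WW.v v0) (WW.v v1) WW.s (WW.v v2) where
  ac := hac
  l1 := by
    refine ⟨gg_adj1 D, ?_, by rw [ty_v0, ty_v1]⟩
    intro x hx
    rcases hw_cases hx.1 with ⟨p, q, h, rfl, h2⟩ | ⟨_, h⟩ | ⟨h, _⟩ | ⟨h, _⟩ | ⟨h, _⟩
    · exact absurd (WW.v_inj h).symm (F_ne D hF h2).1
    · exact h
    · exact absurd (WW.v_inj h) D.h01
    · cases h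
    · exact absurd (WW.v_inj h) D.h02
  l2 := by
    refine ⟨gg_adj2, ?_, by rw [ty_v2 D]; rfl⟩
    intro x hx
    rcases hw_cases hx.1 with ⟨p, q, h, rfl, h2⟩ | ⟨h, _⟩ | ⟨h, _⟩ | ⟨_, h⟩ | ⟨h, _⟩
    · cases h
    · cases h
    · cases h
    · exact h
    · cases h
  t1 := ty_v0
  t2 := rfl

/-- least ordinary vertex -/
theorem mn_ex (D : Dat G v0 v1 v2 B0 pr) (F : Set (Sym2 V)) (c : WW V) : ∃ x, x ≠ v0 ∧ (GG v0 v1 v2 F).Reachable c (WW.v x) ∧ 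
    ∀ y, y ≠ v0 → (GG v0 v1 v2 F).Reachable c (WW.v y) → x ≤ y := by
  obtain ⟨x, hx, hm⟩ := Finset.exists_min_image (Finset.univ.filter fun x => x ≠ v0 ∧ (GG v0 v1 v2 F).Reachable c (WW.v x)) id
    ⟨piW v0 v1 v2 c, by simp only [Finset.mem_filter, Finset.mem_univ, true_and]; exact ⟨pi_ne D c, pi_reach D c⟩⟩
  simp only [Finset.mem_filter, Finset.mem_univ, true_and] at hx hm
  exact ⟨x, hx.1, hx.2, fun y h1 h2 => hm y ⟨h1, h2⟩⟩

noncomputable def mn (v0 v1 v2 : V) (F : Set (Sym2 V)) (c : WW V) : V :=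
  if h : ∃ x, x ≠ v0 ∧ (GG v0 v1 v2 F).Reachable c (WW.v x) ∧ 
    ∀ y, y ≠ v0 → (GG v0 v1 v2 F).Reachable c (WW.v y) → x ≤ y then h.choose else v0

theorem mn_spec (D : Dat G v0 v1 v2 B0 pr) (F : Set (Sym2 V)) (c : WW V) : mn v0 v1 v2 F c ≠ v0 ∧ 
    (GG v0 v1 v2 F).Reachable c (WW.v (mn v0 v1 v2 F c)) ∧ 
    ∀ y, y ≠ v0 → (GG v0 v1 v2 F).Reachable c (WW.v y) → mn v0 v1 v2 F c ≤ y := by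
  unfold mn
  rw [dif_pos (mn_ex D F c)]
  exact (mn_ex D F c).choose_spec

theorem mn_eq (D : Dat G v0 v1 v2 B0 pr) {c c' : WW V} (h : (GG v0 v1 v2 F).Reachable c c') :
    mn v0 v1 v2 F c = mn v0 v1 v2 F c' := by
  have a := mn_spec D F c
  have b := mn_spec D F c'
  exact le_antisymm (a.2.2 _ b.1 (h.trans b.2.1)) (b.2.2 _ a.1 (h.symm.trans a.2.1))

end setup
end TC

namespace TC

section setup
variable {V : Type} [Fintype V] [LinearOrder V] [LinearOrder (Sym2 V)]

def NM (v0 v1 v2 : V) (pr : V → V) (T : Set (Sym2 V)) (x : V) : Prop :=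
  x ≠ v0 ∧ x ≠ v1 ∧ x ≠ v2 ∧ s(x, pr x) ∈ T

noncomputable def MT (v0 v1 v2 : V) (pr : V → V) (T : Set (Sym2 V)) : Finset (WW V) :=
  Finset.univ.filter fun a => a = WW.s ∨ a = WW.v v0 ∨ ∃ x, a = WW.v x ∧ NM v0 v1 v2 pr T x

variable {G : SimpleGraph V} {v0 v1 v2 : V} {B0 : Set (Sym2 V)} {pr : V → V} {F T : Set (Sym2 V)}

theorem mem_MT {a : WW V} : a ∈ MT v0 v1 v2 pr T ↔ a = WW.s ∨ a = WW.v v0 ∨ ∃ x, a = WW.v x ∧ NM v0 v1 v2 pr T x := by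
  simp [MT]

theorem mem_MT_s : WW.s ∈ MT v0 v1 v2 pr T := mem_MT.2 (Or.inl rfl)
theorem mem_MT_0 : WW.v v0 ∈ MT v0 v1 v2 pr T := mem_MT.2 (Or.inr (Or.inl rfl))
theorem mem_MT_n {x : V} (h : NM v0 v1 v2 pr T x) : WW.v x ∈ MT v0 v1 v2 pr T := mem_MT.2 (Or.inr (Or.inr ⟨x, rfl, h⟩))

theorem b_inj (D : Dat G v0 v1 v2 B0 pr) {x y : V} (hx : x ≠ v0) (hy : y ≠ v0) (h : s(x, pr x) = s(y, pr y)) : x = y := by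
  rcases lt_trichotomy x y with h1 | h1 | h1
  · have := D.mono x y hx hy h1; rw [h] at this; exact absurd this (lt_irrefl _)
  · exact h1
  · have := D.mono y x hy hx h1; rw [h] at this; exact absurd this (lt_irrefl _)

theorem F_sub (hT : T ⊆ G.edgeSet) : T \ B0 ⊆ G.edgeSet \ B0 := fun _ h => ⟨hT h.1, h.2⟩

theorem card_edges (D : Dat G v0 v1 v2 B0 pr) (hF : F ⊆ G.edgeSet \ B0) :
    (Finset.univ.filter fun e => e ∈ (GG v0 v1 v2 F).edgeSet).card = F.ncard + 2 := by
  rw [← Set.ncard_coe_finset, Finset.coe_filter_univ]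
  have : {x | x ∈ (GG v0 v1 v2 F).edgeSet} = emb '' F ∪ {vr1 v0 v1, vr2 v2} := gg_edge D hF
  rw [this, Set.ncard_union_eq, Set.ncard_image_of_injective _ emb_inj, Set.ncard_pair]
  · intro h
    simp [vr1, vr2] at h
  · rw [Set.disjoint_left]
    rintro _ ⟨e, he, rfl⟩ h
    induction e using Sym2.ind with
    | _ x y =>
      have hh := F_ne D hF he
      rcases h with h | h
      · simp only [emb, vr1, Sym2.map_mk, Sym2.eq_iff] at h
        rcases h with ⟨h, _⟩ | ⟨_, h⟩
        · exact hh.1 (WW.v_inj h)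
        · exact hh.2.1 (WW.v_inj h)
      · simp [emb, vr2] at h

theorem card_T (D : Dat G v0 v1 v2 B0 pr) (hT : T ⊆ G.edgeSet) :
    T.ncard + 2 = (T \ B0).ncard + (MT v0 v1 v2 pr T).card + (if s(v1, v0) ∈ T then 1 else 0) + 
      (if s(v2, v0) ∈ T then 1 else 0) := by
  have e1 : T.ncard = (T \ B0).ncard + (T ∩ B0).ncard := by
    rw [← Set.ncard_union_eq (Set.disjoint_left.2 fun x h h' => h.2 h'.2), Set.diff_union_inter]
  set N : Finset V := Finset.univ.filter fun x => NM v0 v1 v2 pr T x with hN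
  have mN : ∀ x, x ∈ N ↔ NM v0 v1 v2 pr T x := by intro x; simp [hN]
  have e2 : (MT v0 v1 v2 pr T).card = N.card + 2 := by
    have : MT v0 v1 v2 pr T = insert WW.s (insert (WW.v v0) (N.image WW.v)) := by
      ext a
      rw [mem_MT, Finset.mem_insert, Finset.mem_insert, Finset.mem_image]
      simp only [mN]
      have : (∃ x, a = WW.v x ∧ NM v0 v1 v2 pr T x) ↔ ∃ x, NM v0 v1 v2 pr T x ∧ WW.v x = a := 
        ⟨fun ⟨x, h1, h2⟩ => ⟨x, h2, h1.symm⟩, fun ⟨x, h1, h2⟩ => ⟨x, h2.symm, h1⟩⟩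
      rw [this]
    rw [this, Finset.card_insert_of_notMem, Finset.card_insert_of_notMem, Finset.card_image_of_injective _ WW.v_inj]
    · rw [Finset.mem_image]
      rintro ⟨x, h1, h2⟩
      exact ((mN x).1 h1).1 (WW.v_inj h2)
    · rw [Finset.mem_insert, Finset.mem_image]
      rintro (h | ⟨x, _, h⟩) <;> cases h
  have e3 : (T ∩ B0).ncard = N.card + (if s(v1, v0) ∈ T then 1 else 0) + (if s(v2, v0) ∈ T then 1 else 0) := by
    have h1 : T ∩ B0 = (fun x => s(x, pr x)) '' {x | x ≠ v0 ∧ s(x, pr x) ∈ T} := by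
      ext e
      constructor
      · rintro ⟨h1, h2⟩
        obtain ⟨x, hx, rfl⟩ := (D.hB e).1 h2
        exact ⟨x, ⟨hx, h1⟩, rfl⟩
      · rintro ⟨x, ⟨h1, h2⟩, rfl⟩
        exact ⟨h2, (D.hB _).2 ⟨x, h1, rfl⟩⟩
    rw [h1, Set.ncard_image_of_injOn (fun x hx y hy h => b_inj D hx.1 hy.1 h)]
    have h2 : {x | x ≠ v0 ∧ s(x, pr x) ∈ T} = (↑N : Set V) ∪ ({x | x = v1 ∧ s(v1, v0) ∈ T} ∪ {x | x = v2 ∧ s(v2, v0) ∈ T}) := by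
      ext x
      simp only [Set.mem_setOf_eq, Set.mem_union, Finset.mem_coe, mN, NM]
      by_cases h1 : x = v1
      · subst h1; simp [D.par1, D.h01.symm, D.h12]
      by_cases h2 : x = v2
      · subst h2; simp [D.par2, D.h02.symm, D.h12.symm]
      simp [h1, h2]
    have hs : ∀ (a : V) (P : Prop), ({x | x = a ∧ P} : Set V).ncard = if P then 1 else 0 := by
      intro a P
      by_cases h : P <;> simp [h]
    rw [h2, Set.ncard_union_eq, Set.ncard_union_eq, hs, hs, Set.ncard_coe_finset]
    · omega
    · rw [Set.disjoint_left]
      rintro x ⟨rfl, _⟩ ⟨h, _⟩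
      exact D.h12 h
    · rw [Set.disjoint_left]
      intro x hx h
      have := (mN x).1 hx
      rcases h with ⟨rfl, _⟩ | ⟨rfl, _⟩
      · exact this.2.1 rfl
      · exact this.2.2.1 rfl
  omega

/-- reachability upstairs gives reachability in any graph containing `F` -/
theorem up_reach (D : Dat G v0 v1 v2 B0 pr) (hF : F ⊆ G.edgeSet \ B0) (hFT : F ⊆ T) 
    {a b : WW V} (h : (GG v0 v1 v2 F).Reachable a b) : 
    (SimpleGraph.fromEdgeSet T).Reachable (piW v0 v1 v2 a) (piW v0 v1 v2 b) :=
  (gg_reach_pi D hF h).mono (SimpleGraph.fromEdgeSet_mono hFT)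

theorem mark_reach (D : Dat G v0 v1 v2 B0 pr) {m : WW V} (hm : m ∈ MT v0 v1 v2 pr T) : 
    (SimpleGraph.fromEdgeSet T).Reachable (piW v0 v1 v2 m) (vv v0 v1 v2 (tyW v0 v1 v2 pr m)) := by
  rcases mem_MT.1 hm with rfl | rfl | ⟨x, rfl, h0, h1, h2, h3⟩
  · exact SimpleGraph.Reachable.refl _
  · rw [pi_v0, ty_v0]; exact SimpleGraph.Reachable.refl _
  · rw [pi_v h0, ← pr_vv D h0 h1 h2]
    exact SimpleGraph.Adj.reachable ⟨h3, (D.adj x h0).ne⟩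

/-- component without special vertices, closure -/
theorem comp_closed (D : Dat G v0 v1 v2 B0 pr) (hF : F ⊆ G.edgeSet \ B0) {T' : Set (Sym2 V)} (hT' : ∀ e ∈ T', e ∈ F ∨ e ∈ B0) {c : WW V}
    (h1 : ¬ (GG v0 v1 v2 F).Reachable c (WW.v v0)) (h2 : ¬ (GG v0 v1 v2 F).Reachable c WW.s)
    (h3 : ∀ x, x ≠ v0 → (GG v0 v1 v2 F).Reachable c (WW.v x) → s(x, pr x) ∉ T') {a b : V}
    (ha : a ≠ v0 ∧ (GG v0 v1 v2 F).Reachable c (WW.v a)) (hab : (SimpleGraph.fromEdgeSet T').Reachable a b) :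
    b ≠ v0 ∧ (GG v0 v1 v2 F).Reachable c (WW.v b) := by
  have h1' : ¬ (GG v0 v1 v2 F).Reachable c (WW.v v1) := fun h => h1 (h.trans (gg_adj1 D).symm.reachable)
  have h2' : ¬ (GG v0 v1 v2 F).Reachable c (WW.v v2) := fun h => h2 (h.trans gg_adj2.symm.reachable)
  refine closed_conn (P := fun b => b ≠ v0 ∧ (GG v0 v1 v2 F).Reachable c (WW.v b)) ?_ hab ha
  rintro p q ⟨hpq, hne⟩ ⟨hp, hr⟩
  rcases hT' _ hpq with h | h
  · exact ⟨(F_ne D hF h).2.1, hr.trans (gg_adjF D hF h).reachable⟩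
  · obtain ⟨x, hx, he⟩ := (D.hB _).1 h
    rw [Sym2.eq_iff] at he
    rcases he with ⟨rfl, rfl⟩ | ⟨rfl, rfl⟩
    · exact (h3 _ hx hr hpq).elim
    · rcases D.parm q with e | e | e
      · exact (hp e).elim
      · rw [e] at hr; exact (h1' hr).elim
      · rw [e] at hr; exact (h2' hr).elim

theorem star_mark (D : Dat G v0 v1 v2 B0 pr) {i : Fin 3} (hi : i ≠ 0) : ∃ m ∈ MT v0 v1 v2 pr T, 
    tyW v0 v1 v2 pr m = i ∧ (GG v0 v1 v2 F).Reachable (WW.v (vv v0 v1 v2 i)) m ∧ vv v0 v1 v2 i ≠ v0 := by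
  have : i = 1 ∨ i = 2 := by revert i; decide
  rcases this with rfl | rfl
  · exact ⟨_, mem_MT_0, ty_v0, (gg_adj1 D).symm.reachable, D.h01.symm⟩
  · exact ⟨_, mem_MT_s, rfl, gg_adj2.symm.reachable, D.h02.symm⟩

theorem vv_inj (D : Dat G v0 v1 v2 B0 pr) {i j : Fin 3} (h : vv v0 v1 v2 i = vv v0 v1 v2 j) : i = j := by
  have := D.h01; have := D.h02; have := D.h12
  have := D.h01.symm; have := D.h02.symm; have := D.h12.symm
  fin_cases i <;> fin_cases j <;> simp_all [vv]

theorem conn_tv (D : Dat G v0 v1 v2 B0 pr) (hT : T ⊆ G.edgeSet) (hc : (SimpleGraph.fromEdgeSet T).Connected) :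
    (∀ c, ∃ m ∈ MT v0 v1 v2 pr T, (GG v0 v1 v2 (T \ B0)).Reachable c m) ∧
    ∀ i, ∃ j, j ≠ i ∧ EF (GG v0 v1 v2 (T \ B0)) (tyW v0 v1 v2 pr) (MT v0 v1 v2 pr T) (s(v1, v0) ∈ T) (s(v2, v0) ∈ T) i j := by
  have hF : T \ B0 ⊆ G.edgeSet \ B0 := F_sub hT
  have hTT : ∀ e ∈ T, e ∈ T \ B0 ∨ e ∈ B0 := fun e he => by
    by_cases h : e ∈ B0
    exacts [Or.inr h, Or.inl ⟨he, h⟩]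
  constructor
  · intro c
    by_contra! hh
    have := comp_closed D hF hTT (c := c) (hh _ mem_MT_0) (hh _ mem_MT_s) (fun x h0 hr hx => ?_) 
      ⟨pi_ne D c, pi_reach D c⟩ (hc.preconnected (piW v0 v1 v2 c) v0)
    · exact this.1 rfl
    · apply hh (WW.v x) _ hr
      apply mem_MT_n
      refine ⟨h0, ?_, ?_, hx⟩
      · rintro rfl; exact hh _ mem_MT_0 (hr.trans (gg_adj1 D).symm.reachable)
      · rintro rfl; exact hh _ mem_MT_s (hr.trans gg_adj2.symm.reachable)
  · intro i
    by_contra! hh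
    set Γ := GG v0 v1 v2 (T \ B0) with hΓ
    set ty := tyW v0 v1 v2 pr with hty
    set M := MT v0 v1 v2 pr T with hM
    -- second form
    let Q : V → Prop := fun x => x ≠ v0 ∧ ∃ m ∈ M, Γ.Reachable (WW.v x) m ∧ ty m = i
    have hQm : ∀ x, Q x → ∀ m ∈ M, Γ.Reachable (WW.v x) m → ty m = i := by
      rintro x ⟨_, m', hm', hr', e'⟩ m hm hr
      by_contra hne
      exact hh (ty m) hne (Or.inl ⟨m', hm', m, hm, hr'.symm.trans hr, e', rfl⟩)
    have hvQ : ∀ x, x ≠ v0 → x = vv v0 v1 v2 i → Q x := by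
      rintro x hx rfl
      have hi : i ≠ 0 := by rintro rfl; exact hx rfl
      obtain ⟨m, hm, e, hr, h0⟩ := star_mark (T := T) (F := T \ B0) D hi
      exact ⟨hx, m, hm, hr, e⟩
    have hvv : ∀ t, t ≠ 0 → Q (vv v0 v1 v2 t) → t = i := by
      intro t ht hq
      obtain ⟨m, hm, e, hr, h0⟩ := star_mark (T := T) (F := T \ B0) D ht
      rw [← e]; exact hQm _ hq m hm hr
    let P : V → Prop := fun x => x = vv v0 v1 v2 i ∨ Q x
    have hPQ : ∀ x, x ≠ v0 → P x → Q x := by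
      rintro x hx (h | h)
      exacts [hvQ x hx h, h]
    have hPv : ∀ t, P (vv v0 v1 v2 t) → t = i := by
      rintro t (h | h)
      · exact vv_inj D h
      · by_cases ht : t = 0
        · subst ht; exact (h.1 rfl).elim
        · exact hvv t ht h
    have hcl : ∀ a b, (SimpleGraph.fromEdgeSet T).Adj a b → P a → P b := by
      rintro p q ⟨hpq, hne⟩ hp
      rcases hTT _ hpq with h | h
      · have hn := F_ne D hF h
        obtain ⟨_, m, hm, hr, e⟩ := hPQ p hn.1 hp
        exact Or.inr ⟨hn.2.1, m, hm, (gg_adjF D hF h).symm.reachable.trans hr, e⟩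
      · obtain ⟨x, hx, he⟩ := (D.hB _).1 h
        have hxT : s(x, pr x) ∈ T := he ▸ hpq
        -- reduce to: P x iff P (pr x)
        have key : P x ↔ P (pr x) := by
          by_cases h1 : x = v1
          · subst h1
            rw [D.par1] at hxT ⊢
            have n1 : i ≠ 1 := by rintro rfl; exact hh 0 (by decide) (Or.inr (Or.inl ⟨hxT, Or.inr ⟨rfl, rfl⟩⟩))
            have n0 : i ≠ 0 := by rintro rfl; exact hh 1 (by decide) (Or.inr (Or.inl ⟨hxT, Or.inl ⟨rfl, rfl⟩⟩))
            exact ⟨fun hp => (n1 (hPv 1 hp).symm).elim, fun hp => (n0 (hPv 0 hp).symm).elim⟩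
          by_cases h2 : x = v2
          · subst h2
            rw [D.par2] at hxT ⊢
            have n1 : i ≠ 2 := by rintro rfl; exact hh 0 (by decide) (Or.inr (Or.inr ⟨hxT, Or.inr ⟨rfl, rfl⟩⟩))
            have n0 : i ≠ 0 := by rintro rfl; exact hh 2 (by decide) (Or.inr (Or.inr ⟨hxT, Or.inl ⟨rfl, rfl⟩⟩))
            exact ⟨fun hp => (n1 (hPv 2 hp).symm).elim, fun hp => (n0 (hPv 0 hp).symm).elim⟩
          have hxM : WW.v x ∈ M := mem_MT_n ⟨hx, h1, h2, hxT⟩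
          rw [pr_vv D hx h1 h2]
          constructor
          · intro hp
            have := hQm x (hPQ x hx hp) _ hxM (SimpleGraph.Reachable.refl _)
            left; rw [← this]
          · intro hp
            exact Or.inr ⟨hx, _, hxM, SimpleGraph.Reachable.refl _, hPv _ hp⟩
        rw [Sym2.eq_iff] at he
        rcases he with ⟨rfl, rfl⟩ | ⟨rfl, rfl⟩
        · exact key.1 hp
        · exact key.2 hp
    obtain ⟨j, hj⟩ : ∃ j : Fin 3, j ≠ i := by
      revert i; intro i; intros; exact exists_ne i
    exact hj (hPv j (closed_conn hcl (hc.preconnected (vv v0 v1 v2 i) (vv v0 v1 v2 j)) (Or.inl rfl)))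

theorem tv_conn (D : Dat G v0 v1 v2 B0 pr) (hT : T ⊆ G.edgeSet) 
    (h1 : ∀ c, ∃ m ∈ MT v0 v1 v2 pr T, (GG v0 v1 v2 (T \ B0)).Reachable c m)
    (h3 : ∀ i, ∃ j, j ≠ i ∧ EF (GG v0 v1 v2 (T \ B0)) (tyW v0 v1 v2 pr) (MT v0 v1 v2 pr T) (s(v1, v0) ∈ T) (s(v2, v0) ∈ T) i j) :
    (SimpleGraph.fromEdgeSet T).Connected := by
  have hF : T \ B0 ⊆ G.edgeSet \ B0 := F_sub hT
  have hE : ∀ i j, EF (GG v0 v1 v2 (T \ B0)) (tyW v0 v1 v2 pr) (MT v0 v1 v2 pr T) (s(v1, v0) ∈ T) (s(v2, v0) ∈ T) i j →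
      (SimpleGraph.fromEdgeSet T).Reachable (vv v0 v1 v2 i) (vv v0 v1 v2 j) := by
    rintro i j (⟨u, hu, v, hv, hr, rfl, rfl⟩ | ⟨hb, h⟩ | ⟨hb, h⟩)
    · exact (mark_reach D hu).symm.trans ((up_reach D hF Set.diff_subset hr).trans (mark_reach D hv))
    · have : (SimpleGraph.fromEdgeSet T).Reachable v1 v0 := SimpleGraph.Adj.reachable ⟨hb, D.h01.symm⟩
      rcases h with ⟨rfl, rfl⟩ | ⟨rfl, rfl⟩
      exacts [this.symm, this]
    · have : (SimpleGraph.fromEdgeSet T).Reachable v2 v0 := SimpleGraph.Adj.reachable ⟨hb, D.h02.symm⟩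
      rcases h with ⟨rfl, rfl⟩ | ⟨rfl, rfl⟩
      exacts [this.symm, this]
  have hv : ∀ i, (SimpleGraph.fromEdgeSet T).Reachable (vv v0 v1 v2 i) v0 := by
    have hall : ∀ P : Fin 3 → Fin 3 → Prop, (∀ i, ∃ j, j ≠ i ∧ P i j) → (∀ i j, P i j → P j i) → 
        (∀ i j k, P i j → P j k → P i k) → ∀ i, i = 0 ∨ P i 0 := by
      intro P h1 h2 h3 i
      obtain ⟨a, ha, pa⟩ := h1 0
      obtain ⟨b, hb, pb⟩ := h1 1
      obtain ⟨c, hc, pc⟩ := h1 2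
      fin_cases a <;> fin_cases b <;> fin_cases c <;> fin_cases i <;> simp at * <;> 
        first
        | exact h2 _ _ pa
        | exact pb
        | exact pc
        | exact h3 _ _ _ pb (h2 _ _ pa)
        | exact h3 _ _ _ pc (h2 _ _ pa)
        | exact h3 _ _ _ (h2 _ _ pc) (h2 _ _ pa)
        | exact h3 _ _ _ (h2 _ _ pb) (h2 _ _ pa)
        | exact h3 _ _ _ pb pc
        | exact h3 _ _ _ pc pb
    intro i
    rcases hall (fun i j => (SimpleGraph.fromEdgeSet T).Reachable (vv v0 v1 v2 i) (vv v0 v1 v2 j)) 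
      (fun i => by obtain ⟨j, hj, he⟩ := h3 i; exact ⟨j, hj, hE i j he⟩) (fun _ _ h => h.symm) (fun _ _ _ h h' => h.trans h') i with rfl | h
    · exact SimpleGraph.Reachable.refl _
    · exact h
  apply conn_of_base v0
  intro x
  by_cases hx : x = v0
  · rw [hx]
  obtain ⟨m, hm, hr⟩ := h1 (WW.v x)
  have := up_reach D hF (T := T) Set.diff_subset hr
  rw [pi_v hx] at this
  exact this.trans ((mark_reach D hm).trans (hv _))

theorem tree_char (D : Dat G v0 v1 v2 B0 pr) (hT : T ⊆ G.edgeSet) : IsSpanningTree G T ↔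
    (GG v0 v1 v2 (T \ B0)).IsAcyclic ∧ 
    TV (GG v0 v1 v2 (T \ B0)) (tyW v0 v1 v2 pr) (MT v0 v1 v2 pr T) (s(v1, v0) ∈ T) (s(v2, v0) ∈ T) := by
  have hF : T \ B0 ⊆ G.edgeSet \ B0 := F_sub hT
  have c1 := card_T D hT
  have c2 := card_edges D hF
  constructor
  · intro h
    have hac : (GG v0 v1 v2 (T \ B0)).IsAcyclic := by
      apply gg_acyclic D hF
      exact h.2.isAcyclic.anti (SimpleGraph.fromEdgeSet_mono Set.diff_subset)
    have h' := (tree_iff G T).1 h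
    obtain ⟨q1, q3⟩ := conn_tv D hT h'.2.1
    refine ⟨hac, q1, ?_, q3⟩
    have c3 := edge_count hac
    have := h'.2.2
    rw [card_WW] at c3
    omega
  · rintro ⟨hac, h⟩
    rw [tree_iff]
    refine ⟨hT, tv_conn D hT h.v1 h.v3, ?_⟩
    have c3 := edge_count hac
    have := h.v2
    rw [card_WW] at c3
    omega

end setup
end TC

namespace TC

section swap
variable {V : Type} [Fintype V] [LinearOrder V] [LinearOrder (Sym2 V)]
variable {G : SimpleGraph V} {T : Set (Sym2 V)}

theorem no_reach (hT : IsSpanningTree G T) {p q : V} (he : s(p, q) ∈ T) :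
    ¬ (SimpleGraph.fromEdgeSet (T \ {s(p, q)})).Reachable p q := by
  intro hr
  have hac := hT.2.isAcyclic
  rw [SimpleGraph.isAcyclic_iff_forall_adj_isBridge] at hac
  have hne : p ≠ q := G.ne_of_adj (hT.1 he)
  have hb := @hac p q ⟨he, hne⟩
  rw [SimpleGraph.isBridge_iff] at hb
  apply hb
  refine hr.mono ?_
  intro a b hab
  exact ⟨⟨hab.1.1, hab.2⟩, fun h => hab.1.2 h.1⟩

theorem sides (hT : IsSpanningTree G T) {p q : V} (x : V) :
    (SimpleGraph.fromEdgeSet (T \ {s(p, q)})).Reachable x p ∨ (SimpleGraph.fromEdgeSet (T \ {s(p, q)})).Reachable x q := by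
  refine closed_conn (P := fun x => (SimpleGraph.fromEdgeSet (T \ {s(p, q)})).Reachable x p ∨
    (SimpleGraph.fromEdgeSet (T \ {s(p, q)})).Reachable x q) ?_ (hT.2.connected.preconnected p x)
    (Or.inl (SimpleGraph.Reachable.refl _))
  intro a b hab ha
  by_cases h : s(a, b) = s(p, q)
  · rw [Sym2.eq_iff] at h
    rcases h with ⟨_, rfl⟩ | ⟨_, rfl⟩
    · exact Or.inr (SimpleGraph.Reachable.refl _)
    · exact Or.inl (SimpleGraph.Reachable.refl _)
  · have hb : (SimpleGraph.fromEdgeSet (T \ {s(p, q)})).Reachable b a := 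
      (SimpleGraph.Adj.reachable ⟨⟨hab.1, h⟩, hab.2⟩ : (SimpleGraph.fromEdgeSet (T \ {s(p, q)})).Reachable a b).symm
    exact ha.imp hb.trans hb.trans

theorem swap_iff (hT : IsSpanningTree G T) {p q a b : V} (he : s(p, q) ∈ T) (hf : s(a, b) ∈ G.edgeSet) (hfT : s(a, b) ∉ T) :
    IsSpanningTree G (insert s(a, b) (T \ {s(p, q)})) ↔ 
      ¬ (SimpleGraph.fromEdgeSet (T \ {s(p, q)})).Reachable a b := by
  constructor
  · intro h hr
    have := no_reach h (Set.mem_insert _ _)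
    apply this
    have e : insert s(a, b) (T \ {s(p, q)}) \ {s(a, b)} = T \ {s(p, q)} := by
      ext x; simp only [Set.mem_diff, Set.mem_insert_iff, Set.mem_singleton_iff]
      constructor
      · rintro ⟨h | h, h'⟩
        · exact (h' h).elim
        · exact h
      · intro h; exact ⟨Or.inr h, fun h' => hfT (h' ▸ h.1)⟩
    rw [e]; exact hr
  · intro hn
    have h' := (tree_iff G T).1 hT
    rw [tree_iff]
    refine ⟨?_, ?_, ?_⟩
    · rintro x (rfl | hx)
      · exact hf
      · exact h'.1 hx.1
    · set T' := insert s(a, b) (T \ {s(p, q)}) with hT'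
      have mono : ∀ {x y}, (SimpleGraph.fromEdgeSet (T \ {s(p, q)})).Reachable x y → (SimpleGraph.fromEdgeSet T').Reachable x y :=
        fun h => h.mono (SimpleGraph.fromEdgeSet_mono (Set.subset_insert _ _))
      have hab : (SimpleGraph.fromEdgeSet T').Reachable a b := 
        SimpleGraph.Adj.reachable ⟨Set.mem_insert _ _, G.ne_of_adj hf⟩
      have hpq : (SimpleGraph.fromEdgeSet T').Reachable p q := by
        rcases sides (p := p) (q := q) hT a with h1 | h1 <;> rcases sides (p := p) (q := q) hT b with h2 | h2
        · exact (hn (h1.trans h2.symm)).elim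
        · exact (mono h1).symm.trans (hab.trans (mono h2))
        · exact (mono h2).symm.trans (hab.symm.trans (mono h1))
        · exact (hn (h1.trans h2.symm)).elim
      apply conn_of_base p
      intro x
      rcases sides (p := p) (q := q) hT x with h1 | h1
      · exact mono h1
      · exact (mono h1).trans hpq.symm
    · rw [Set.ncard_insert_of_notMem (fun h => hfT h.1), Set.ncard_diff_singleton_add_one he]
      exact h'.2.2
end swap

section setup
variable {V : Type} [Fintype V] [LinearOrder V] [LinearOrder (Sym2 V)]
variable {G : SimpleGraph V} {v0 v1 v2 : V} {B0 : Set (Sym2 V)} {pr : V → V} {F T : Set (Sym2 V)}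

theorem pass_F (D : Dat G v0 v1 v2 B0 pr) (hT : IsSpanningTree G T) {e : Sym2 V} (he : e ∈ T) (heB : e ∉ B0) :
    InternallyPassive G T e := by
  induction e using Sym2.ind with
  | _ p q =>
    refine ⟨he, ?_⟩
    by_contra hcon
    push Not at hcon
    have hx : ∀ x, x ≠ v0 → (SimpleGraph.fromEdgeSet (T \ {s(p, q)})).Reachable x (pr x) := by
      intro x hx
      by_cases hxT : s(x, pr x) ∈ T
      · refine SimpleGraph.Adj.reachable ⟨⟨hxT, ?_⟩, (D.adj x hx).ne⟩
        rintro h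
        exact heB (h ▸ (D.hB _).2 ⟨x, hx, rfl⟩)
      · by_contra hh
        exact hcon s(x, pr x) (D.adj x hx) hxT (D.bH x _ hx (hT.1 he) heB) ((swap_iff hT he (D.adj x hx) hxT).2 hh)
    have h1 := hx v1 D.h01.symm
    have h2 := hx v2 D.h02.symm
    rw [D.par1] at h1
    rw [D.par2] at h2
    have h0 : ∀ x, (SimpleGraph.fromEdgeSet (T \ {s(p, q)})).Reachable x v0 := by
      intro x
      by_cases hx0 : x = v0
      · rw [hx0]
      · have := hx x hx0
        rcases D.parm x with h | h | h
        · rw [h] at this; exact this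
        · rw [h] at this; exact this.trans h1
        · rw [h] at this; exact this.trans h2
    exact no_reach hT he ((h0 p).trans (h0 q).symm)

theorem nm_no_star (D : Dat G v0 v1 v2 B0 pr) {c : WW V} {v : V} (hv : v ≠ v0) 
    (hsc : sc (GG v0 v1 v2 (T \ B0)) (MT v0 v1 v2 pr T) c = {WW.v v}) :
    ¬ (GG v0 v1 v2 (T \ B0)).Reachable c (WW.v v0) ∧ ¬ (GG v0 v1 v2 (T \ B0)).Reachable c WW.s ∧
    ¬ (GG v0 v1 v2 (T \ B0)).Reachable c (WW.v v1) ∧ ¬ (GG v0 v1 v2 (T \ B0)).Reachable c (WW.v v2) := by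
  have a : ¬ (GG v0 v1 v2 (T \ B0)).Reachable c (WW.v v0) := by
    intro h
    have : WW.v v0 ∈ sc (GG v0 v1 v2 (T \ B0)) (MT v0 v1 v2 pr T) c := mem_sc.2 ⟨mem_MT_0, h⟩
    rw [hsc, Finset.mem_singleton] at this
    exact hv (WW.v_inj this).symm
  have b : ¬ (GG v0 v1 v2 (T \ B0)).Reachable c WW.s := by
    intro h
    have : WW.s ∈ sc (GG v0 v1 v2 (T \ B0)) (MT v0 v1 v2 pr T) c := mem_sc.2 ⟨mem_MT_s, h⟩
    rw [hsc, Finset.mem_singleton] at this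
    cases this
  exact ⟨a, b, fun h => a (h.trans (gg_adj1 D).symm.reachable), fun h => b (h.trans gg_adj2.symm.reachable)⟩

theorem nm_only (D : Dat G v0 v1 v2 B0 pr) {c : WW V} {v : V} (hv : v ≠ v0) 
    (hsc : sc (GG v0 v1 v2 (T \ B0)) (MT v0 v1 v2 pr T) c = {WW.v v}) {x : V} (hx : x ≠ v0)
    (hr : (GG v0 v1 v2 (T \ B0)).Reachable c (WW.v x)) (hxT : s(x, pr x) ∈ T) : x = v := by
  obtain ⟨_, _, c1, c2⟩ := nm_no_star D hv hsc
  have : WW.v x ∈ sc (GG v0 v1 v2 (T \ B0)) (MT v0 v1 v2 pr T) c := 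
    mem_sc.2 ⟨mem_MT_n ⟨hx, by rintro rfl; exact c1 hr, by rintro rfl; exact c2 hr, hxT⟩, hr⟩
  rw [hsc, Finset.mem_singleton] at this
  exact WW.v_inj this

theorem cc (D : Dat G v0 v1 v2 B0 pr) (hT : IsSpanningTree G T) {c : WW V} {v : V} (hv : v ≠ v0) 
    (hsc : sc (GG v0 v1 v2 (T \ B0)) (MT v0 v1 v2 pr T) c = {WW.v v}) {a b : V}
    (ha : a ≠ v0 ∧ (GG v0 v1 v2 (T \ B0)).Reachable c (WW.v a)) 
    (hab : (SimpleGraph.fromEdgeSet (T \ {s(v, pr v)})).Reachable a b) :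
    b ≠ v0 ∧ (GG v0 v1 v2 (T \ B0)).Reachable c (WW.v b) := by
  obtain ⟨d1, d2, c1, c2⟩ := nm_no_star D hv hsc
  refine comp_closed D (F_sub hT.1) (T' := T \ {s(v, pr v)}) ?_ d1 d2 ?_ ha hab
  · intro e he
    by_cases h : e ∈ B0
    · exact Or.inr h
    · exact Or.inl ⟨he.1, h⟩
  · intro x hx hr hxT
    have := nm_only D hv hsc hx hr hxT.1
    subst this
    exact hxT.2 rfl

theorem pass_b (D : Dat G v0 v1 v2 B0 pr) (hT : IsSpanningTree G T) {v : V} (hN : NM v0 v1 v2 pr T v) :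
    InternallyPassive G T s(v, pr v) ↔ 
    ¬ (sc (GG v0 v1 v2 (T \ B0)) (MT v0 v1 v2 pr T) (WW.v v) = {WW.v v} ∧ mn v0 v1 v2 (T \ B0) (WW.v v) = v) := by
  have hF : T \ B0 ⊆ G.edgeSet \ B0 := F_sub hT.1
  have hTV := ((tree_char D hT.1).1 hT).2
  obtain ⟨n0, n1, n2, nT⟩ := hN
  have hvs : WW.v v ∈ sc (GG v0 v1 v2 (T \ B0)) (MT v0 v1 v2 pr T) (WW.v v) := 
    mem_sc.2 ⟨mem_MT_n ⟨n0, n1, n2, nT⟩, SimpleGraph.Reachable.refl _⟩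
  constructor
  · rintro ⟨_, f, hfG, hfT, hlt, htree⟩ ⟨hsc, hmn⟩
    by_cases hfB : f ∈ B0
    swap
    · exact lt_asymm hlt (D.bH v f n0 hfG hfB)
    obtain ⟨u, hu, rfl⟩ := (D.hB f).1 hfB
    have huv : u < v := by
      rcases lt_trichotomy u v with h | h | h
      · exact h
      · subst h; exact (hfT nT).elim
      · exact (lt_asymm hlt (D.mono v u n0 hu h)).elim
    obtain ⟨d1, d2, c1, c2⟩ := nm_no_star D n0 hsc
    have hs := (swap_iff hT nT hfG hfT).1 htree
    have key : ∀ x, (x = v0 ∨ ¬ (GG v0 v1 v2 (T \ B0)).Reachable (WW.v v) (WW.v x)) → 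
        (SimpleGraph.fromEdgeSet (T \ {s(v, pr v)})).Reachable x (pr v) := by
      intro x hx
      rcases sides (p := v) (q := pr v) hT x with h | h
      · exfalso
        have := cc D hT n0 hsc ⟨n0, SimpleGraph.Reachable.refl _⟩ h.symm
        rcases hx with hx | hx
        · exact this.1 hx
        · exact hx this.2
      · exact h
    apply hs
    refine (key u (Or.inr fun h => ?_)).trans (key (pr u) ?_).symm
    · have := (mn_spec D (T \ B0) (WW.v v)).2.2 u hu h
      rw [hmn] at this
      exact not_le_of_gt huv this
    · rcases D.parm u with h | h | h <;> rw [h]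
      · exact Or.inl rfl
      · exact Or.inr c1
      · exact Or.inr c2
  · intro hnot
    refine ⟨nT, ?_⟩
    by_cases hsc : sc (GG v0 v1 v2 (T \ B0)) (MT v0 v1 v2 pr T) (WW.v v) = {WW.v v}
    · have hmn : mn v0 v1 v2 (T \ B0) (WW.v v) ≠ v := fun h => hnot ⟨hsc, h⟩
      obtain ⟨u0, ur, um⟩ := mn_spec D (T \ B0) (WW.v v)
      set u := mn v0 v1 v2 (T \ B0) (WW.v v) with hu
      obtain ⟨d1, d2, c1, c2⟩ := nm_no_star D n0 hsc
      have huT : s(u, pr u) ∉ T := fun h => hmn (nm_only D n0 hsc u0 ur h)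
      have hlt : u < v := lt_of_le_of_ne (um v n0 (SimpleGraph.Reachable.refl _)) hmn
      refine ⟨s(u, pr u), D.adj u u0, huT, D.mono u v u0 n0 hlt, (swap_iff hT nT (D.adj u u0) huT).2 ?_⟩
      intro hr
      have := cc D hT n0 hsc ⟨u0, ur⟩ hr
      rcases D.parm u with h | h | h <;> rw [h] at this
      · exact this.1 rfl
      · exact c1 this.2
      · exact c2 this.2
    · obtain ⟨m, hm, hmv⟩ : ∃ m ∈ sc (GG v0 v1 v2 (T \ B0)) (MT v0 v1 v2 pr T) (WW.v v), m ≠ WW.v v := by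
        by_contra hh
        push Not at hh
        exact hsc (Finset.eq_singleton_iff_unique_mem.2 ⟨hvs, hh⟩)
      rw [mem_sc] at hm
      by_contra hcon
      push Not at hcon
      set R := SimpleGraph.fromEdgeSet (T \ {s(v, pr v)}) with hR
      have hx : ∀ x, x ≠ v0 → x ≠ v → x ≤ v → R.Reachable x (pr x) := by
        intro x hx hxv hle
        by_cases hxT : s(x, pr x) ∈ T
        · refine SimpleGraph.Adj.reachable ⟨⟨hxT, ?_⟩, (D.adj x hx).ne⟩
          intro h
          exact hxv (b_inj D hx n0 h)
        · by_contra hh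
          exact hcon s(x, pr x) (D.adj x hx) hxT (D.mono x v hx n0 (lt_of_le_of_ne hle hxv)) ((swap_iff hT nT (D.adj x hx) hxT).2 hh)
      have h1 := hx v1 D.h01.symm (Ne.symm n1) (D.lt1 v n0)
      have h2 := hx v2 D.h02.symm (Ne.symm n2) (D.lt2 v n0 n1)
      rw [D.par1] at h1
      rw [D.par2] at h2
      have hvv : ∀ i, R.Reachable (vv v0 v1 v2 i) v0 := by
        intro i
        unfold vv
        split_ifs
        · exact SimpleGraph.Reachable.refl _
        · exact h1
        · exact h2
      have hall : ∀ x, R.Reachable x v0 := by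
        intro x
        by_cases hx0 : x = v0
        · rw [hx0]
        obtain ⟨m', hm', hmv', hr'⟩ : ∃ m' ∈ MT v0 v1 v2 pr T, m' ≠ WW.v v ∧ (GG v0 v1 v2 (T \ B0)).Reachable (WW.v x) m' := by
          obtain ⟨m', hm', hr'⟩ := hTV.v1 (WW.v x)
          by_cases h : m' = WW.v v
          · subst h
            exact ⟨m, hm.1, hmv, hr'.trans hm.2⟩
          · exact ⟨m', hm', h, hr'⟩
        have hm2 : m' ∈ MT v0 v1 v2 pr (T \ {s(v, pr v)}) := by
          rw [mem_MT] at hm' ⊢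
          rcases hm' with h | h | ⟨y, rfl, y0, y1, y2, yT⟩
          · exact Or.inl h
          · exact Or.inr (Or.inl h)
          · refine Or.inr (Or.inr ⟨y, rfl, y0, y1, y2, yT, ?_⟩)
            intro h
            exact hmv' (congrArg WW.v (b_inj D y0 n0 h))
        have := up_reach D hF (T := T \ {s(v, pr v)}) (fun e he => ⟨he.1, fun h => he.2 (h ▸ (D.hB _).2 ⟨v, n0, rfl⟩)⟩) hr'
        rw [pi_v hx0] at this
        exact this.trans ((mark_reach D hm2).trans (hvv _))
      exact no_reach hT nT ((hall _).trans (hall _).symm)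

theorem pass_1 (D : Dat G v0 v1 v2 B0 pr) : ¬ InternallyPassive G T s(v1, v0) := by
  rintro ⟨h, f, hfG, hfT, hlt, _⟩
  by_cases hfB : f ∈ B0
  · obtain ⟨u, hu, rfl⟩ := (D.hB f).1 hfB
    rcases (D.lt1 u hu).eq_or_lt with h' | h'
    · subst h'; rw [D.par1] at hlt; exact lt_irrefl _ hlt
    · have := D.mono v1 u D.h01.symm hu h'
      rw [D.par1] at this
      exact lt_asymm hlt this
  · have := D.bH v1 f D.h01.symm hfG hfB
    rw [D.par1] at this
    exact lt_asymm hlt this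

theorem pass_2 (D : Dat G v0 v1 v2 B0 pr) (hT : IsSpanningTree G T) : InternallyPassive G T s(v2, v0) ↔
    fl (GG v0 v1 v2 (T \ B0)) (tyW v0 v1 v2 pr) (MT v0 v1 v2 pr T) (s(v1, v0) ∈ T) (s(v2, v0) ∈ T) := by
  have hac := ((tree_char D hT.1).1 hT).1
  have hTV := ((tree_char D hT.1).1 hT).2
  have b1B : s(v1, v0) ∈ B0 := (D.hB _).2 ⟨v1, D.h01.symm, by rw [D.par1]⟩
  have b2B : s(v2, v0) ∈ B0 := (D.hB _).2 ⟨v2, D.h02.symm, by rw [D.par2]⟩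
  have a1 : s(v1, v0) ∈ G.edgeSet := by have := D.adj v1 D.h01.symm; rw [D.par1] at this; exact this
  have hne : s(v1, v0) ≠ s(v2, v0) := by
    intro h
    refine D.h12 (b_inj D D.h01.symm D.h02.symm ?_)
    rw [D.par1, D.par2]; exact h
  have hlt : s(v1, v0) < s(v2, v0) := by
    have := D.mono v1 v2 D.h01.symm D.h02.symm (lt_of_le_of_ne (D.lt1 v2 D.h02.symm) D.h12)
    rw [D.par1, D.par2] at this; exact this
  set T' := insert s(v1, v0) (T \ {s(v2, v0)}) with hT'
  have hT'G : T' ⊆ G.edgeSet := by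
    rintro x (rfl | hx)
    · exact a1
    · exact hT.1 hx.1
  have eF : T' \ B0 = T \ B0 := by
    ext e
    simp only [hT', Set.mem_diff, Set.mem_insert_iff, Set.mem_singleton_iff]
    constructor
    · rintro ⟨rfl | h, h'⟩
      · exact (h' b1B).elim
      · exact ⟨h.1, h'⟩
    · rintro ⟨h, h'⟩
      exact ⟨Or.inr ⟨h, by rintro rfl; exact h' b2B⟩, h'⟩
  have eM : MT v0 v1 v2 pr T' = MT v0 v1 v2 pr T := by
    ext a
    rw [mem_MT, mem_MT]
    have : ∀ x, NM v0 v1 v2 pr T' x ↔ NM v0 v1 v2 pr T x := by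
      intro x
      unfold NM
      refine and_congr_right fun h0 => and_congr_right fun h1 => and_congr_right fun h2 => ?_
      simp only [hT', Set.mem_diff, Set.mem_insert_iff, Set.mem_singleton_iff]
      constructor
      · rintro (h | h)
        · refine (h1 (b_inj D h0 D.h01.symm ?_)).elim
          rw [D.par1]; exact h
        · exact h.1
      · intro h
        refine Or.inr ⟨h, fun h' => h2 (b_inj D h0 D.h02.symm ?_)⟩
        rw [D.par2]; exact h'
    simp only [this]
  have m1 : s(v1, v0) ∈ T' := Set.mem_insert _ _
  have m2 : s(v2, v0) ∉ T' := by
    rintro (h | h)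
    · exact hne h.symm
    · exact h.2 rfl
  have tc := tree_char D hT'G
  rw [eF, eM] at tc
  constructor
  · rintro ⟨h2, f, hfG, hfT, hlt', htree⟩
    have hf : f = s(v1, v0) := by
      by_cases hfB : f ∈ B0
      · obtain ⟨u, hu, rfl⟩ := (D.hB f).1 hfB
        by_cases h1 : u = v1
        · rw [h1, D.par1]
        rcases (D.lt2 u hu h1).eq_or_lt with h' | h'
        · subst h'; rw [D.par2] at hlt'; exact (lt_irrefl _ hlt').elim
        · have := D.mono v2 u D.h02.symm hu h'
          rw [D.par2] at this
          exact (lt_asymm hlt' this).elim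
      · have := D.bH v2 f D.h02.symm hfG hfB
        rw [D.par2] at this
        exact (lt_asymm hlt' this).elim
    subst hf
    exact ⟨h2, hfT, tv_swap hTV (tc.1 htree).2 hfT h2 m1 m2⟩
  · rintro ⟨h2, h1, hE⟩
    refine ⟨h2, s(v1, v0), a1, h1, hlt, tc.2 ⟨hac, hTV.v1, ?_, ?_⟩⟩
    · have := hTV.v2
      rw [if_neg h1, if_pos h2] at this
      rw [if_pos m1, if_neg m2]
      exact this
    · intro i
      fin_cases i
      · exact ⟨1, by decide, Or.inr (Or.inl ⟨m1, Or.inl ⟨rfl, rfl⟩⟩)⟩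
      · exact ⟨0, by decide, Or.inr (Or.inl ⟨m1, Or.inr ⟨rfl, rfl⟩⟩)⟩
      · exact ⟨1, by decide, Or.inl hE.symm⟩

theorem mks_congr {W : Type} [Fintype W] {Γ : SimpleGraph W} {ty : W → Fin 3} {st1 st2 r c c' : W} {s : Stat} {d : Finset W × Bool}
    (h : MkS Γ ty st1 st2 r c s d) (hr : Γ.Reachable c c') : MkS Γ ty st1 st2 r c' s d :=
  ⟨⟨fun x hx => hr.symm.trans (h.1.1 x hx), fun h' => h.1.2.1 (hr.trans h'), fun h' => h.1.2.2 (hr.trans h')⟩, h.2⟩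

theorem sig_const (D : Dat G v0 v1 v2 B0 pr) {M : Finset (WW V)} {b1 b2 : Prop} {σ : WW V → Stat}
    (hσ : ∀ c, MkS (GG v0 v1 v2 F) (tyW v0 v1 v2 pr) (WW.v v0) WW.s (WW.v (mn v0 v1 v2 F c)) c (σ c)
      (dd (GG v0 v1 v2 F) (tyW v0 v1 v2 pr) M b1 b2 c)) {c c' : WW V} (h : (GG v0 v1 v2 F).Reachable c c') : σ c = σ c' := by
  have a := mks_congr (hσ c) h
  rw [mn_eq D h, dd_eq h] at a
  exact mks_uniq a (hσ c')

theorem pass_count (D : Dat G v0 v1 v2 B0 pr) (hT : IsSpanningTree G T) {σ : WW V → Stat}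
    (hσ : ∀ c, MkS (GG v0 v1 v2 (T \ B0)) (tyW v0 v1 v2 pr) (WW.v v0) WW.s (WW.v (mn v0 v1 v2 (T \ B0) c)) c (σ c)
      (dd (GG v0 v1 v2 (T \ B0)) (tyW v0 v1 v2 pr) (MT v0 v1 v2 pr T) (s(v1, v0) ∈ T) (s(v2, v0) ∈ T) c)) :
    passivity G T + 2 = (T \ B0).ncard + ∑ c ∈ Rt (GG v0 v1 v2 (T \ B0)), (σ c).n := by
  have hTV := ((tree_char D hT.1).1 hT).2
  rw [tv_sum hTV hσ (fun c c' h => sig_const D hσ h)]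
  set Γ := GG v0 v1 v2 (T \ B0) with hΓ
  set N : Finset V := Finset.univ.filter fun x => NM v0 v1 v2 pr T x ∧ σ (WW.v x) ≠ Stat.z with hN
  have mN : ∀ x, x ∈ N ↔ NM v0 v1 v2 pr T x ∧ σ (WW.v x) ≠ Stat.z := by intro x; simp [hN]
  have zc : ∀ c, σ c = Stat.z ↔ sc Γ (MT v0 v1 v2 pr T) c = {WW.v (mn v0 v1 v2 (T \ B0) c)} := by
    intro c
    constructor
    · intro h
      have := (hσ c).2
      rw [h] at this
      exact congrArg Prod.fst this
    · intro h
      refine mks_uniq (hσ c) ⟨(hσ c).1, ?_⟩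
      show dd Γ _ _ _ _ c = _
      unfold dd
      rw [h]; simp
  have hs1 : ∀ a, (a = WW.s ∨ a = WW.v v0) → σ a ≠ Stat.z := by
    intro a ha h
    rw [zc] at h
    have hm : a ∈ sc Γ (MT v0 v1 v2 pr T) a := mem_sc.2 ⟨mem_MT.2 (by tauto), SimpleGraph.Reachable.refl _⟩
    rw [h, Finset.mem_singleton] at hm
    rcases ha with rfl | rfl
    · cases hm
    · exact (mn_spec D (T \ B0) (WW.v v0)).1 (WW.v_inj hm).symm
  have e2 : ((MT v0 v1 v2 pr T).filter fun m => σ m ≠ Stat.z).card = N.card + 2 := by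
    have : (MT v0 v1 v2 pr T).filter (fun m => σ m ≠ Stat.z) = insert WW.s (insert (WW.v v0) (N.image WW.v)) := by
      ext a
      rw [Finset.mem_filter, mem_MT, Finset.mem_insert, Finset.mem_insert, Finset.mem_image]
      simp only [mN]
      constructor
      · rintro ⟨h | h | ⟨x, rfl, h⟩, h'⟩
        · exact Or.inl h
        · exact Or.inr (Or.inl h)
        · exact Or.inr (Or.inr ⟨x, ⟨h, h'⟩, rfl⟩)
      · rintro (h | h | ⟨x, ⟨h, h'⟩, rfl⟩)
        · exact ⟨Or.inl h, hs1 a (Or.inl h)⟩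
        · exact ⟨Or.inr (Or.inl h), hs1 a (Or.inr h)⟩
        · exact ⟨Or.inr (Or.inr ⟨x, rfl, h⟩), h'⟩
    rw [this, Finset.card_insert_of_notMem, Finset.card_insert_of_notMem, Finset.card_image_of_injective _ WW.v_inj]
    · rw [Finset.mem_image]
      rintro ⟨x, h1, h2⟩
      exact ((mN x).1 h1).1.1 (WW.v_inj h2)
    · rw [Finset.mem_insert, Finset.mem_image]
      rintro (h | ⟨x, _, h⟩) <;> cases h
  have b2B : s(v2, v0) ∈ B0 := (D.hB _).2 ⟨v2, D.h02.symm, by rw [D.par2]⟩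
  have passn : ∀ x, NM v0 v1 v2 pr T x → (InternallyPassive G T s(x, pr x) ↔ σ (WW.v x) ≠ Stat.z) := by
    intro x hx
    rw [pass_b D hT hx, ← hΓ, Ne, zc]
    refine not_congr ⟨?_, ?_⟩
    · rintro ⟨h1, h2⟩
      rw [h2]; exact h1
    · intro h
      have hm : WW.v x ∈ sc Γ (MT v0 v1 v2 pr T) (WW.v x) := mem_sc.2 ⟨mem_MT_n hx, SimpleGraph.Reachable.refl _⟩
      rw [h, Finset.mem_singleton] at hm
      have := WW.v_inj hm
      rw [← this] at h
      exact ⟨h, this.symm⟩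
  set L : Set (Sym2 V) := if fl Γ (tyW v0 v1 v2 pr) (MT v0 v1 v2 pr T) (s(v1, v0) ∈ T) (s(v2, v0) ∈ T) then {s(v2, v0)} else ∅ with hL
  have mL : ∀ e, e ∈ L ↔ e = s(v2, v0) ∧ fl Γ (tyW v0 v1 v2 pr) (MT v0 v1 v2 pr T) (s(v1, v0) ∈ T) (s(v2, v0) ∈ T) := by
    intro e
    rw [hL]
    split_ifs with h <;> simp [h]
  have hset : {e | InternallyPassive G T e} = (T \ B0) ∪ ((fun x => s(x, pr x)) '' (N : Set V) ∪ L) := by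
    ext e
    rw [Set.mem_setOf_eq, Set.mem_union, Set.mem_union, Set.mem_image, mL]
    constructor
    · intro he
      by_cases heB : e ∈ B0
      · right
        obtain ⟨x, hx, rfl⟩ := (D.hB e).1 heB
        by_cases h1 : x = v1
        · subst h1; rw [D.par1] at he; exact (pass_1 D he).elim
        by_cases h2 : x = v2
        · subst h2; rw [D.par2] at he ⊢; exact Or.inr ⟨rfl, (pass_2 D hT).1 he⟩
        · left
          have hx' : NM v0 v1 v2 pr T x := ⟨hx, h1, h2, he.1⟩
          exact ⟨x, (mN x).2 ⟨hx', (passn x hx').1 he⟩, rfl⟩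
      · exact Or.inl ⟨he.1, heB⟩
    · rintro (h | ⟨x, hx, rfl⟩ | ⟨rfl, h⟩)
      · exact pass_F D hT h.1 h.2
      · have := (mN x).1 hx
        exact (passn x this.1).2 this.2
      · exact (pass_2 D hT).2 h
  unfold passivity
  rw [hset, Set.ncard_union_eq, Set.ncard_union_eq, Set.ncard_image_of_injOn, Set.ncard_coe_finset, e2]
  · have : L.ncard = if fl Γ (tyW v0 v1 v2 pr) (MT v0 v1 v2 pr T) (s(v1, v0) ∈ T) (s(v2, v0) ∈ T) then 1 else 0 := by
      rw [hL]; split_ifs <;> simp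
    rw [this]
    omega
  · intro x hx y hy h
    exact b_inj D ((mN x).1 hx).1.1 ((mN y).1 hy).1.1 h
  · rw [Set.disjoint_left]
    rintro _ ⟨x, hx, rfl⟩ h
    have hx' := ((mN x).1 hx).1
    refine hx'.2.2.1 (b_inj D hx'.1 D.h02.symm ?_)
    rw [D.par2]; exact ((mL _).1 h).1
  · rw [Set.disjoint_left]
    rintro e he (⟨x, hx, rfl⟩ | h)
    · exact he.2 ((D.hB _).2 ⟨x, ((mN x).1 hx).1.1, rfl⟩)
    · rw [mL] at h; exact he.2 (h.1 ▸ b2B)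

end setup
end TC

namespace TC

section glob
variable {W : Type} [Fintype W] {Γ : SimpleGraph W} {ty : W → Fin 3} {st1 q1 st2 q2 : W} {r : W → W}

theorem wts_uniq (hΓ : Γ.IsAcyclic) {c : W} {s s' : Stat} {m : Sym2 W → ℕ} (h : WtS Γ ty st1 q1 st2 q2 c s m)
    (h' : WtS Γ ty st1 q1 st2 q2 c s' m) : s = s' := by
  obtain ⟨_, h⟩ := h
  obtain ⟨_, h'⟩ := h'
  cases s with
  | z => 
    cases s' with
    | z => rfl
    | o => simp only at h h'; omega
    | p k => have := Pair2.sum h'; simp only at h; omega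
    | f => have := Full.sum h'; simp only at h; omega
  | o => 
    cases s' with
    | z => simp only at h h'; omega
    | o => rfl
    | p k => have := Pair2.sum h'; simp only at h; omega
    | f => have := Full.sum h'; simp only at h; omega
  | p j => 
    have hj := Pair2.sum h
    cases s' with
    | z => simp only at h'; omega
    | o => simp only at h'; omega
    | p k => rw [Pair2.uniq hΓ h h']
    | f => have := Full.sum h'; omega
  | f => 
    have hj := Full.sum h
    cases s' with
    | z => simp only at h'; omega
    | o => simp only at h'; omega
    | p k => have := Pair2.sum h'; omega
    | f => rfl

theorem wts_sum {c : W} {s : Stat} {m : Sym2 W → ℕ} (h : WtS Γ ty st1 q1 st2 q2 c s m) : ∑ e, m e = s.n := by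
  obtain ⟨_, h⟩ := h
  cases s with
  | z => exact h
  | o => exact h
  | p k => exact Pair2.sum h
  | f => exact Full.sum h

theorem wts_good {c : W} {s : Stat} {m : Sym2 W → ℕ} (h : WtS Γ ty st1 q1 st2 q2 c s m) : GoodM Γ ty m := by
  have hs := wts_sum h
  obtain ⟨_, h⟩ := h
  cases s with
  | z => left; rw [hs]; simp [Stat.n]
  | o => left; rw [hs]; simp [Stat.n]
  | p k => exact Or.inr (Or.inl ⟨k, h⟩)
  | f => exact Or.inr (Or.inr h)

theorem good_wts {c : W} {m : Sym2 W → ℕ} (hc : WtC Γ st1 q1 st2 q2 c m) (h : GoodM Γ ty m) : 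
    ∃ s, WtS Γ ty st1 q1 st2 q2 c s m := by
  rcases h with h | ⟨k, h⟩ | h
  · rcases Nat.le_one_iff_eq_zero_or_eq_one.1 h with h | h
    · exact ⟨Stat.z, hc, h⟩
    · exact ⟨Stat.o, hc, h⟩
  · exact ⟨Stat.p k, hc, h⟩
  · exact ⟨Stat.f, hc, h⟩

theorem big_iff (s : Stat) : s.big ↔ 2 ≤ s.n := by
  cases s <;> simp [Stat.big, Stat.n]

theorem beta_ex (hL : LC Γ ty st1 q1 st2 q2) (hr : ∀ c, Γ.Reachable c (r c)) (hr1 : ∀ c, r c ≠ st1) (hr2 : ∀ c, r c ≠ st2) :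
    ∃ β : W → Finset W × Bool → Sym2 W → ℕ, 
      (∀ c s d, MkS Γ ty st1 st2 (r c) c s d → WtS Γ ty st1 q1 st2 q2 c s (β c d)) ∧
      (∀ c s m, WtS Γ ty st1 q1 st2 q2 c s m → ∃ d, MkS Γ ty st1 st2 (r c) c s d ∧ β c d = m) ∧
      (∀ c s s' d d', MkS Γ ty st1 st2 (r c) c s d → MkS Γ ty st1 st2 (r c) c s' d' → β c d = β c d' → d = d') := by
  have E : ∀ c s, Nonempty ({d | MkS Γ ty st1 st2 (r c) c s d} ≃ {m | WtS Γ ty st1 q1 st2 q2 c s m}) :=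
    fun c s => loc_all hL (hr c) (hr1 c) (hr2 c) s
  let e := fun c s => (E c s).some
  let β : W → Finset W × Bool → Sym2 W → ℕ := fun c d => 
    if h : ∃ s, MkS Γ ty st1 st2 (r c) c s d then (e c h.choose ⟨d, h.choose_spec⟩).1 else 0
  have hβ : ∀ c s d (h : MkS Γ ty st1 st2 (r c) c s d), β c d = (e c s ⟨d, h⟩).1 := by
    intro c s d h
    have hex : ∃ s, MkS Γ ty st1 st2 (r c) c s d := ⟨s, h⟩
    have : ∀ s' (h' : MkS Γ ty st1 st2 (r c) c s' d), (e c s' ⟨d, h'⟩).1 = (e c s ⟨d, h⟩).1 := by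
      intro s' h'
      have := mks_uniq h' h
      subst this
      rfl
    show (if h : ∃ s, MkS Γ ty st1 st2 (r c) c s d then (e c h.choose ⟨d, h.choose_spec⟩).1 else 0) = _
    rw [dif_pos hex]
    exact this _ _
  have w : ∀ c s d, MkS Γ ty st1 st2 (r c) c s d → WtS Γ ty st1 q1 st2 q2 c s (β c d) := by
    intro c s d h
    rw [hβ c s d h]
    exact (e c s ⟨d, h⟩).2
  refine ⟨β, w, ?_, ?_⟩
  · intro c s m h
    have h2 := ((e c s).symm ⟨m, h⟩).2
    refine ⟨((e c s).symm ⟨m, h⟩).1, h2, ?_⟩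
    rw [hβ c s _ h2]
    have := (e c s).apply_symm_apply ⟨m, h⟩
    exact congrArg Subtype.val this
  · intro c s s' d d' h h' heq
    have a := w c s d h
    have b := w c s' d' h'
    rw [heq] at a
    have := wts_uniq hL.ac a b
    subst this
    rw [hβ c s d h, hβ c s d' h'] at heq
    have := (e c s).injective (Subtype.ext heq)
    exact congrArg Subtype.val this

/-- mark data on a fixed forest -/
def DS (Γ : SimpleGraph W) (ty : W → Fin 3) (st1 st2 : W) (r : W → W) (σ : W → Stat) (δ : W → Finset W × Bool) : Prop :=
  (∀ c c', Γ.Reachable c c' → δ c = δ c') ∧ (∀ c, MkS Γ ty st1 st2 (r c) c (σ c) (δ c)) ∧ GV Γ σ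

/-- weights on a fixed forest -/
def YS (Γ : SimpleGraph W) (ty : W → Fin 3) (st1 q1 st2 q2 : W) (y : Sym2 W → ℕ) : Prop :=
  Gr y = Γ ∧ XH ty Γ.edgeSet y ∧ y s(st1, q1) = 2 ∧ y s(st2, q2) = 2

theorem gr_of_supp {y : Sym2 W → ℕ} (h : ∀ e, y e ≠ 0 ↔ e ∈ Γ.edgeSet) : Gr y = Γ := by
  have : {e | y e ≠ 0} = Γ.edgeSet := by ext e; exact h e
  unfold Gr
  rw [this, SimpleGraph.fromEdgeSet_edgeSet]

theorem glob (hL : LC Γ ty st1 q1 st2 q2) (hr : ∀ c, Γ.Reachable c (r c)) (hr1 : ∀ c, r c ≠ st1) (hr2 : ∀ c, r c ≠ st2) 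
    (hrc : ∀ c c', Γ.Reachable c c' → r c = r c') :
    ∃ Ψ : (W → Finset W × Bool) → Sym2 W → ℕ,
      (∀ σ δ, DS Γ ty st1 st2 r σ δ → YS Γ ty st1 q1 st2 q2 (Ψ δ) ∧ 
        ∑ e, Ψ δ e = (Finset.univ.filter fun e => e ∈ Γ.edgeSet).card + ∑ c ∈ Rt Γ, (σ c).n) ∧
      (∀ σ σ' δ δ', DS Γ ty st1 st2 r σ δ → DS Γ ty st1 st2 r σ' δ' → Ψ δ = Ψ δ' → δ = δ') ∧
      (∀ y, YS Γ ty st1 q1 st2 q2 y → ∃ σ δ, DS Γ ty st1 st2 r σ δ ∧ Ψ δ = y) := by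
  obtain ⟨β, w1, w2, w3⟩ := beta_ex hL hr hr1 hr2
  let Ψ : (W → Finset W × Bool) → Sym2 W → ℕ := fun δ e => 
    if e ∈ Γ.edgeSet then 1 + ∑ c ∈ Rt Γ, β c (δ c) e else 0
  have supp : ∀ δ e, Ψ δ e ≠ 0 ↔ e ∈ Γ.edgeSet := by
    intro δ e
    simp only [Ψ]
    split_ifs with h
    · simp [h]
    · simp [h]
  have hgr : ∀ δ, Gr (Ψ δ) = Γ := fun δ => gr_of_supp (supp δ)
  have hmm : ∀ σ δ, DS Γ ty st1 st2 r σ δ → ∀ u, MM (Ψ δ) u = β (rt Γ u) (δ (rt Γ u)) := by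
    intro σ δ hD u
    have hw := fun c => (w1 c _ _ (hD.2.1 c)).1.1
    funext e
    simp only [MM, hgr]
    have hS : ∀ z ∈ e, Γ.Reachable u z → ∑ c ∈ Rt Γ, β c (δ c) e = β (rt Γ u) (δ (rt Γ u)) e := by
      intro z hz hrz
      refine Finset.sum_eq_single_of_mem _ (rt_mem u) ?_
      intro c hc hne
      by_contra h0
      have := (hw c e h0).2 z hz
      exact hne (Rt_reach hc (rt_mem u) (this.trans (hrz.symm.trans (rt_reach u).symm)))
    split_ifs with h
    · obtain ⟨z, hz, hrz⟩ := h
      by_cases he : e ∈ Γ.edgeSet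
      · simp only [Ψ, he, if_true]
        rw [hS z hz hrz]; omega
      · simp only [Ψ, he, if_false]
        by_contra h0
        exact he (hw _ e (Ne.symm h0)).1
    · by_contra h0
      have := (hw _ e (Ne.symm h0)).2
      induction e using Sym2.ind with
      | _ a b => exact h ⟨a, by simp, (rt_reach u).symm.trans (this a (by simp))⟩
  have hwt : ∀ σ δ, DS Γ ty st1 st2 r σ δ → ∀ u, WtS Γ ty st1 q1 st2 q2 (rt Γ u) (σ (rt Γ u)) (MM (Ψ δ) u) := by
    intro σ δ hD u
    rw [hmm σ δ hD]
    exact w1 _ _ _ (hD.2.1 _)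
  have hnn : ∀ σ δ, DS Γ ty st1 st2 r σ δ → ∀ u, NN (Ψ δ) u = (σ (rt Γ u)).n := fun σ δ hD u => wts_sum (hwt σ δ hD u)
  have hrr : ∀ u u', ¬ Γ.Reachable u u' → ¬ Γ.Reachable (rt Γ u) (rt Γ u') := 
    fun u u' h h' => h ((rt_reach u).symm.trans (h'.trans (rt_reach u')))
  have hval : ∀ y : Sym2 W → ℕ, (∀ e, y e ≠ 0 → ¬ e.IsDiag) → Gr y = Γ → ∀ e, y e = if e ∈ Γ.edgeSet then 1 + MM y (rt Γ (Quot.out e).1) e else 0 := by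
    intro y nd hg e
    have h1 := gr_edge nd e
    rw [hg] at h1
    split_ifs with he
    · have h2 := h1.1 he
      have : ∃ z ∈ e, (Gr y).Reachable (rt Γ (Quot.out e).1) z := by
        refine ⟨(Quot.out e).1, Sym2.out_fst_mem e, ?_⟩
        rw [hg]; exact rt_reach _
      simp only [MM, this, if_true]
      omega
    · by_contra h; exact he (h1.2 h)
  have hext : ∀ y y' : Sym2 W → ℕ, (∀ e, y e ≠ 0 → ¬ e.IsDiag) → (∀ e, y' e ≠ 0 → ¬ e.IsDiag) → Gr y = Γ → Gr y' = Γ → 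
      (∀ c ∈ Rt Γ, MM y c = MM y' c) → y = y' := by
    intro y y' nd nd' hg hg' h
    funext e
    rw [hval y nd hg, hval y' nd' hg', h _ (rt_mem _)]
  have hnd : ∀ δ e, Ψ δ e ≠ 0 → ¬ e.IsDiag := fun δ e h => Γ.not_isDiag_of_mem_edgeSet ((supp δ e).1 h)
  refine ⟨Ψ, ?_, ?_, ?_⟩
  · intro σ δ hD
    have hx : XH ty Γ.edgeSet (Ψ δ) := by
      refine ⟨hnd δ, fun e h => (supp δ e).1 h, ?_, ?_, ?_, ?_⟩
      · rw [hgr]; exact hL.ac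
      · intro u; rw [hgr]; exact wts_good (hwt σ δ hD u)
      · intro u u' hn h1 h2
        rw [hgr] at hn ⊢
        rw [hnn σ δ hD, ← big_iff] at h1 h2
        obtain ⟨k, k', e1, e2, hk⟩ := hD.2.2.g2 _ _ (hrr u u' hn) h1 h2
        have a := (hwt σ δ hD u).2
        have b := (hwt σ δ hD u').2
        rw [e1] at a
        rw [e2] at b
        refine ⟨by rw [hnn σ δ hD, e1]; simp [Stat.n], by rw [hnn σ δ hD, e2]; simp [Stat.n], ?_⟩
        intro j hj hj'
        exact hk ((Pair2.uniq hL.ac a hj).trans (Pair2.uniq hL.ac b hj').symm)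
      · intro u u' u'' n1 n2 n3 h1 h2 h3
        rw [hgr] at n1 n2 n3
        rw [hnn σ δ hD, ← big_iff] at h1 h2 h3
        exact hD.2.2.g3 _ _ _ (hrr _ _ n1) (hrr _ _ n2) (hrr _ _ n3) h1 h2 h3
    refine ⟨⟨hgr δ, hx, ?_, ?_⟩, ?_⟩
    · have := (hwt σ δ hD st1).1.2.1 (rt_reach st1)
      simp only [MM] at this
      split_ifs at this
      omega
    · have := (hwt σ δ hD st2).1.2.2 (rt_reach st2)
      simp only [MM] at this
      split_ifs at this
      omega
    · have t := total_count (hnd δ) (by rw [hgr]; exact hL.ac)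
      have e := edge_count hL.ac
      rw [hgr] at t
      have : ∑ c ∈ Rt Γ, NN (Ψ δ) c = ∑ c ∈ Rt Γ, (σ c).n := by
        refine Finset.sum_congr rfl fun c hc => ?_
        rw [hnn σ δ hD, mem_Rt.1 hc]
      rw [this] at t
      omega
  · intro σ σ' δ δ' hD hD' heq
    funext c
    have h1 := hmm σ δ hD c
    have h2 := hmm σ' δ' hD' c
    rw [heq] at h1
    have := w3 _ _ _ _ _ (hD.2.1 (rt Γ c)) (hD'.2.1 (rt Γ c)) (h1.symm.trans h2)
    rw [← hD.1 _ _ (rt_reach c), this, hD'.1 _ _ (rt_reach c)]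
  · rintro y ⟨hg, hx, y1, y2⟩
    have hC : ∀ c, WtC Γ st1 q1 st2 q2 c (MM y c) := by
      intro c
      refine ⟨?_, ?_, ?_⟩
      · intro e he
        have := mm_reach he
        rw [hg] at this
        refine ⟨?_, this.2⟩
        rw [← hg, gr_edge hx.nd]; omega
      · intro h
        have : ∃ z ∈ s(st1, q1), (Gr y).Reachable c z := ⟨st1, by simp, by rw [hg]; exact h⟩
        simp only [MM, this, if_true]; omega
      · intro h
        have : ∃ z ∈ s(st2, q2), (Gr y).Reachable c z := ⟨st2, by simp, by rw [hg]; exact h⟩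
        simp only [MM, this, if_true]; omega
    have hS := fun c => good_wts (hC c) (by have := hx.good c; rw [hg] at this; exact this)
    choose σ0 hσ0 using hS
    have hδ := fun c => w2 c _ _ (hσ0 c)
    choose δ0 hδ0 hδ1 using hδ
    have hbig : ∀ c, (σ0 c).big ↔ 2 ≤ NN y c := by
      intro c; rw [big_iff, ← wts_sum (hσ0 c)]; rfl
    have hDS : DS Γ ty st1 st2 r (fun c => σ0 (rt Γ c)) (fun c => δ0 (rt Γ c)) := by
      refine ⟨fun c c' h => by simp only [rt_eq h], ?_, ?_, ?_⟩
      · intro c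
        have := mks_congr (hδ0 (rt Γ c)) (rt_reach c)
        rw [hrc _ _ (rt_reach c)] at this
        exact this
      · intro u u' hn h1 h2
        have h1' := (hbig _).1 h1
        have h2' := (hbig _).1 h2
        obtain ⟨a, b, cc⟩ := hx.gv2 _ _ (by rw [hg]; exact hrr u u' hn) h1' h2'
        rw [hg] at cc
        have hp : ∀ c, NN y c ≤ 2 → (σ0 c).big → ∃ k, σ0 c = Stat.p k ∧ Pair2 Γ ty k (MM y c) := by
          intro c hc hb
          have h := (hσ0 c).2
          have hs := wts_sum (hσ0 c)
          cases hh : σ0 c with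
          | z => rw [hh] at hb; exact hb.elim
          | o => rw [hh] at hb; exact hb.elim
          | p k => rw [hh] at h; exact ⟨k, rfl, h⟩
          | f => 
            rw [hh] at hs
            unfold NN at hc
            simp only [Stat.n] at hs
            omega
        obtain ⟨k, hk, pk⟩ := hp _ a h1
        obtain ⟨k', hk', pk'⟩ := hp _ b h2
        refine ⟨k, k', hk, hk', ?_⟩
        rintro rfl
        exact cc k pk pk'
      · intro u u' u'' n1 n2 n3 h1 h2 h3
        exact hx.gv3 _ _ _ (by rw [hg]; exact hrr u u' n1) (by rw [hg]; exact hrr _ _ n2) (by rw [hg]; exact hrr _ _ n3) 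
          ((hbig _).1 h1) ((hbig _).1 h2) ((hbig _).1 h3)
    refine ⟨_, _, hDS, ?_⟩
    refine hext _ _ (hnd _) hx.nd (hgr _) hg ?_
    intro c hc
    rw [hmm _ _ hDS, rt_rt, hδ1, mem_Rt.1 hc]

end glob
end TC

namespace TC

section setup
variable {V : Type} [Fintype V] [LinearOrder V] [LinearOrder (Sym2 V)]
variable {G : SimpleGraph V} {v0 v1 v2 : V} {B0 : Set (Sym2 V)} {pr : V → V} {F T : Set (Sym2 V)}

theorem emb_mem (D : Dat G v0 v1 v2 B0 pr) {e : Sym2 V} (he : e ∈ G.edgeSet \ B0) (h : emb e ∈ HW v0 v1 v2 F) : e ∈ F := by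
  induction e using Sym2.ind with
  | _ x y =>
    have hh := F_ne D (le_refl (G.edgeSet \ B0)) he
    rcases hw_cases (a := WW.v x) (b := WW.v y) h with ⟨x', y', h1, h2, h3⟩ | ⟨h1, _⟩ | ⟨_, h1⟩ | ⟨h1, _⟩ | ⟨_, h1⟩
    · rw [WW.v_inj h1, WW.v_inj h2]; exact h3
    · exact (hh.1 (WW.v_inj h1)).elim
    · exact (hh.2.1 (WW.v_inj h1)).elim
    · cases h1
    · cases h1

theorem nm_iff {x : V} (hx : x ≠ v0) : WW.v x ∈ MT v0 v1 v2 pr T ↔ NM v0 v1 v2 pr T x := by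
  constructor
  · intro h
    rcases mem_MT.1 h with h | h | ⟨y, h, h'⟩
    · cases h
    · exact (hx (WW.v_inj h)).elim
    · rw [WW.v_inj h]; exact h'
  · exact mem_MT_n

theorem tree_eq (D : Dat G v0 v1 v2 B0 pr) {T T' : Set (Sym2 V)} (hF : T \ B0 = T' \ B0) 
    (hM : MT v0 v1 v2 pr T = MT v0 v1 v2 pr T') (h1 : s(v1, v0) ∈ T ↔ s(v1, v0) ∈ T') (h2 : s(v2, v0) ∈ T ↔ s(v2, v0) ∈ T') :
    T = T' := by
  ext e
  by_cases heB : e ∈ B0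
  · obtain ⟨x, hx, rfl⟩ := (D.hB e).1 heB
    by_cases x1 : x = v1
    · subst x1; rw [D.par1]; exact h1
    by_cases x2 : x = v2
    · subst x2; rw [D.par2]; exact h2
    have a := nm_iff (v1 := v1) (v2 := v2) (pr := pr) (T := T) hx
    have b := nm_iff (v1 := v1) (v2 := v2) (pr := pr) (T := T') hx
    rw [hM] at a
    have := a.symm.trans b
    constructor
    · intro h; exact (this.1 ⟨hx, x1, x2, h⟩).2.2.2
    · intro h; exact (this.2 ⟨hx, x1, x2, h⟩).2.2.2
  · constructor
    · intro h
      have : e ∈ T \ B0 := ⟨h, heB⟩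
      rw [hF] at this; exact this.1
    · intro h
      have : e ∈ T' \ B0 := ⟨h, heB⟩
      rw [← hF] at this; exact this.1

theorem tree_make (D : Dat G v0 v1 v2 B0 pr) (hF : F ⊆ G.edgeSet \ B0) {M : Finset (WW V)} {b1 b2 : Prop}
    (hM0 : WW.v v0 ∈ M) (hMs : WW.s ∈ M) (hM1 : WW.v v1 ∉ M) (hM2 : WW.v v2 ∉ M) :
    ∃ T, T ⊆ G.edgeSet ∧ T \ B0 = F ∧ MT v0 v1 v2 pr T = M ∧ (s(v1, v0) ∈ T ↔ b1) ∧ (s(v2, v0) ∈ T ↔ b2) := by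
  set Q : V → Prop := fun x => (x = v1 ∧ b1) ∨ (x = v2 ∧ b2) ∨ (x ≠ v1 ∧ x ≠ v2 ∧ WW.v x ∈ M) with hQ
  set T : Set (Sym2 V) := F ∪ {e | ∃ x, x ≠ v0 ∧ e = s(x, pr x) ∧ Q x} with hT
  have hb : ∀ x, x ≠ v0 → (s(x, pr x) ∈ T ↔ Q x) := by
    intro x hx
    constructor
    · rintro (h | ⟨y, hy, he, q⟩)
      · exact ((hF h).2 ((D.hB _).2 ⟨x, hx, rfl⟩)).elim
      · rw [b_inj D hx hy he]; exact q
    · intro q; exact Or.inr ⟨x, hx, rfl, q⟩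
  refine ⟨T, ?_, ?_, ?_, ?_, ?_⟩
  · rintro e (h | ⟨x, hx, rfl, _⟩)
    · exact (hF h).1
    · exact D.adj x hx
  · ext e
    constructor
    · rintro ⟨h | ⟨x, hx, rfl, _⟩, hn⟩
      · exact h
      · exact (hn ((D.hB _).2 ⟨x, hx, rfl⟩)).elim
    · intro h; exact ⟨Or.inl h, (hF h).2⟩
  · ext a
    cases a with
    | s => exact ⟨fun _ => hMs, fun _ => mem_MT_s⟩
    | v x => 
      by_cases hx : x = v0
      · subst hx; exact ⟨fun _ => hM0, fun _ => mem_MT_0⟩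
      rw [nm_iff hx]
      unfold NM
      rw [hb x hx]
      constructor
      · rintro ⟨_, n1, n2, (h | h | h)⟩
        · exact (n1 h.1).elim
        · exact (n2 h.1).elim
        · exact h.2.2
      · intro h
        have n1 : x ≠ v1 := by rintro rfl; exact hM1 h
        have n2 : x ≠ v2 := by rintro rfl; exact hM2 h
        exact ⟨hx, n1, n2, Or.inr (Or.inr ⟨n1, n2, h⟩)⟩
  · have := hb v1 D.h01.symm
    rw [D.par1] at this
    rw [this]
    constructor
    · rintro (h | h | h)
      · exact h.2
      · exact (D.h12 h.1).elim
      · exact (h.1 rfl).elim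
    · intro h; exact Or.inl ⟨rfl, h⟩
  · have := hb v2 D.h02.symm
    rw [D.par2] at this
    rw [this]
    constructor
    · rintro (h | h | h)
      · exact (D.h12 h.1.symm).elim
      · exact h.2
      · exact (h.2.1 rfl).elim
    · intro h; exact Or.inr (Or.inl ⟨rfl, h⟩)

theorem tree_wt (D : Dat G v0 v1 v2 B0 pr) : ∃ Y : Set (Sym2 V) → Sym2 (WW V) → ℕ,
    (∀ T, IsSpanningTree G T → XH (tyW v0 v1 v2 pr) (HW v0 v1 v2 (G.edgeSet \ B0)) (Y T) ∧ 
      Y T (vr1 v0 v1) = 2 ∧ Y T (vr2 v2) = 2 ∧ ∑ e, Y T e = passivity G T + 4) ∧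
    (∀ T T', IsSpanningTree G T → IsSpanningTree G T' → Y T = Y T' → T = T') ∧
    (∀ y, XH (tyW v0 v1 v2 pr) (HW v0 v1 v2 (G.edgeSet \ B0)) y → y (vr1 v0 v1) = 2 → y (vr2 v2) = 2 → 
      ∃ T, IsSpanningTree G T ∧ Y T = y) := by
  have hΨ : ∀ F : Set (Sym2 V), ∃ Ψ : (WW V → Finset (WW V) × Bool) → Sym2 (WW V) → ℕ,
      (F ⊆ G.edgeSet \ B0 ∧ (GG v0 v1 v2 F).IsAcyclic) → 
      (∀ σ δ, DS (GG v0 v1 v2 F) (tyW v0 v1 v2 pr) (WW.v v0) WW.s (fun c => WW.v (mn v0 v1 v2 F c)) σ δ → 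
          YS (GG v0 v1 v2 F) (tyW v0 v1 v2 pr) (WW.v v0) (WW.v v1) WW.s (WW.v v2) (Ψ δ) ∧ 
        ∑ e, Ψ δ e = (Finset.univ.filter fun e => e ∈ (GG v0 v1 v2 F).edgeSet).card + ∑ c ∈ Rt (GG v0 v1 v2 F), (σ c).n) ∧
      (∀ σ σ' δ δ', DS (GG v0 v1 v2 F) (tyW v0 v1 v2 pr) (WW.v v0) WW.s (fun c => WW.v (mn v0 v1 v2 F c)) σ δ → 
        DS (GG v0 v1 v2 F) (tyW v0 v1 v2 pr) (WW.v v0) WW.s (fun c => WW.v (mn v0 v1 v2 F c)) σ' δ' → Ψ δ = Ψ δ' → δ = δ') ∧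
      (∀ y, YS (GG v0 v1 v2 F) (tyW v0 v1 v2 pr) (WW.v v0) (WW.v v1) WW.s (WW.v v2) y → 
        ∃ σ δ, DS (GG v0 v1 v2 F) (tyW v0 v1 v2 pr) (WW.v v0) WW.s (fun c => WW.v (mn v0 v1 v2 F c)) σ δ ∧ Ψ δ = y) := by
    intro F
    by_cases h : F ⊆ G.edgeSet \ B0 ∧ (GG v0 v1 v2 F).IsAcyclic
    · obtain ⟨Ψ, hh⟩ := glob (gg_lc D h.1 h.2) (r := fun c => WW.v (mn v0 v1 v2 F c)) (fun c => (mn_spec D F c).2.1) 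
        (fun c hc => (mn_spec D F c).1 (WW.v_inj hc)) (fun c hc => by cases hc) (fun c c' hc => congrArg WW.v (mn_eq D hc))
      exact ⟨Ψ, fun _ => hh⟩
    · exact ⟨fun _ => 0, fun h' => (h h').elim⟩
  choose Ψ hΨ using hΨ
  let δT : Set (Sym2 V) → WW V → Finset (WW V) × Bool := fun T => 
    dd (GG v0 v1 v2 (T \ B0)) (tyW v0 v1 v2 pr) (MT v0 v1 v2 pr T) (s(v1, v0) ∈ T) (s(v2, v0) ∈ T)
  have hδ : ∀ T, IsSpanningTree G T → ∃ σ, DS (GG v0 v1 v2 (T \ B0)) (tyW v0 v1 v2 pr) (WW.v v0) WW.s (fun c => WW.v (mn v0 v1 v2 (T \ B0) c)) σ (δT T) := by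
    intro T hT
    obtain ⟨σ, h1, h2⟩ := tv_stat ((tree_char D hT.1).1 hT).2 (st1 := WW.v v0) (st2 := WW.s) mem_MT_0 mem_MT_s (fun c => WW.v (mn v0 v1 v2 (T \ B0) c))
    exact ⟨σ, fun c c' h => dd_eq h, h1, h2⟩
  have hok : ∀ T, IsSpanningTree G T → T \ B0 ⊆ G.edgeSet \ B0 ∧ (GG v0 v1 v2 (T \ B0)).IsAcyclic := 
    fun T hT => ⟨F_sub hT.1, ((tree_char D hT.1).1 hT).1⟩
  refine ⟨fun T => Ψ (T \ B0) (δT T), ?_, ?_, ?_⟩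
  · intro T hT
    obtain ⟨σ, hD⟩ := hδ T hT
    obtain ⟨⟨h1, h2, h3, h4⟩, h5⟩ := (hΨ (T \ B0) (hok T hT)).1 σ _ hD
    refine ⟨⟨h2.nd, ?_, h2.ac, h2.good, h2.gv2, h2.gv3⟩, h3, h4, ?_⟩
    · intro e he
      have := h2.sub e he
      rw [gg_edge D (hok T hT).1] at this
      exact Set.union_subset_union_left _ (Set.image_mono (hok T hT).1) this
    · have pc := pass_count D hT hD.2.1
      have ce := card_edges D (hok T hT).1
      show ∑ e, Ψ (T \ B0) (δT T) e = _
      omega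
  · intro T T' hT hT' heq
    obtain ⟨σ, hD⟩ := hδ T hT
    obtain ⟨σ', hD'⟩ := hδ T' hT'
    have g1 := ((hΨ (T \ B0) (hok T hT)).1 σ _ hD).1.1
    have g2 := ((hΨ (T' \ B0) (hok T' hT')).1 σ' _ hD').1.1
    simp only at heq
    rw [heq] at g1
    have hgg : HW v0 v1 v2 (T \ B0) = HW v0 v1 v2 (T' \ B0) := by
      rw [← gg_edge D (hok T hT).1, ← gg_edge D (hok T' hT').1, ← g1, ← g2]
    have hFF : T \ B0 = T' \ B0 := by
      ext e
      constructor
      · intro h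
        refine emb_mem D ((hok T hT).1 h) ?_
        rw [← hgg]; exact Or.inl ⟨e, h, rfl⟩
      · intro h
        refine emb_mem D ((hok T' hT').1 h) ?_
        rw [hgg]; exact Or.inl ⟨e, h, rfl⟩
    rw [← hFF] at heq hD'
    have hdd := (hΨ (T \ B0) (hok T hT)).2.1 _ _ _ _ hD hD' heq
    have tv := ((tree_char D hT.1).1 hT).2
    have tv' := ((tree_char D hT'.1).1 hT').2
    have hMM : MT v0 v1 v2 pr T = MT v0 v1 v2 pr T' := by
      ext a
      have h1 := congrArg Prod.fst (congrFun hdd a)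
      simp only [δT, dd] at h1
      rw [← hFF] at h1
      have h2 : a ∈ sc (GG v0 v1 v2 (T \ B0)) (MT v0 v1 v2 pr T) a ↔ a ∈ sc (GG v0 v1 v2 (T \ B0)) (MT v0 v1 v2 pr T') a := by rw [h1]
      rw [mem_sc, mem_sc] at h2
      exact ⟨fun h => (h2.1 ⟨h, SimpleGraph.Reachable.refl _⟩).1, fun h => (h2.2 ⟨h, SimpleGraph.Reachable.refl _⟩).1⟩
    rw [← hFF, ← hMM] at tv'
    have := tv_uniq tv tv' (fun c => by
      have h1 := congrFun hdd c
      simp only [δT] at h1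
      rw [← hFF, ← hMM] at h1
      exact h1)
    exact tree_eq D hFF hMM this.1 this.2
  · intro y hy y1 y2
    set F : Set (Sym2 V) := {e | e ∈ G.edgeSet \ B0 ∧ y (emb e) ≠ 0} with hFdef
    have hF : F ⊆ G.edgeSet \ B0 := fun e h => h.1
    have hsupp : ∀ e, y e ≠ 0 ↔ e ∈ (GG v0 v1 v2 F).edgeSet := by
      intro e
      rw [gg_edge D hF]
      constructor
      · intro h
        rcases hy.sub e h with ⟨e', he', rfl⟩ | h'
        · exact Or.inl ⟨e', ⟨he', h⟩, rfl⟩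
        · exact Or.inr h'
      · rintro (⟨e', he', rfl⟩ | h | h)
        · exact he'.2
        · rw [h, y1]; decide
        · rw [Set.mem_singleton_iff.1 h, y2]; decide
    have hgr : Gr y = GG v0 v1 v2 F := gr_of_supp hsupp
    have hac : (GG v0 v1 v2 F).IsAcyclic := by rw [← hgr]; exact hy.ac
    obtain ⟨σ, δ, hD, hy'⟩ := (hΨ F ⟨hF, hac⟩).2.2 y ⟨hgr, ⟨hy.nd, fun e h => (hsupp e).1 h, hy.ac, hy.good, hy.gv2, hy.gv3⟩, y1, y2⟩
    obtain ⟨M, b1, b2, tv, hdd⟩ := tv_of hD.1 hD.2.1 hD.2.2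
    have hsc : ∀ c, sc (GG v0 v1 v2 F) M c = (δ c).1 := fun c => congrArg Prod.fst (hdd c)
    have hM0 : WW.v v0 ∈ M := by
      have := (hD.2.1 (WW.v v0)).1.2.1 (SimpleGraph.Reachable.refl _)
      rw [← hsc] at this; exact (mem_sc.1 this).1
    have hMs : WW.s ∈ M := by
      have := (hD.2.1 WW.s).1.2.2 (SimpleGraph.Reachable.refl _)
      rw [← hsc] at this; exact (mem_sc.1 this).1
    have hM1 : WW.v v1 ∉ M := by
      intro h
      have a : WW.v v1 ∈ (δ (WW.v v0)).1 := by rw [← hsc]; exact mem_sc.2 ⟨h, (gg_adj1 D).reachable⟩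
      have b : WW.v v0 ∈ (δ (WW.v v0)).1 := by rw [← hsc]; exact mem_sc.2 ⟨hM0, SimpleGraph.Reachable.refl _⟩
      exact D.h01 (WW.v_inj (mks_types (hD.2.1 (WW.v v0)) b a (by rw [ty_v0, ty_v1])))
    have hM2 : WW.v v2 ∉ M := by
      intro h
      have a : WW.v v2 ∈ (δ WW.s).1 := by rw [← hsc]; exact mem_sc.2 ⟨h, gg_adj2.reachable⟩
      have b : WW.s ∈ (δ WW.s).1 := by rw [← hsc]; exact mem_sc.2 ⟨hMs, SimpleGraph.Reachable.refl _⟩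
      have := mks_types (hD.2.1 WW.s) b a (by rw [ty_v2 D]; rfl)
      cases this
    obtain ⟨T, t1, t2, t3, t4, t5⟩ := tree_make D hF (b1 := b1) (b2 := b2) hM0 hMs hM1 hM2
    have hT : IsSpanningTree G T := by
      rw [tree_char D t1, t2, t3, propext t4, propext t5]
      exact ⟨hac, tv⟩
    refine ⟨T, hT, ?_⟩
    have : δT T = δ := by
      funext c
      simp only [δT]
      rw [t2, t3, propext t4, propext t5]
      exact hdd c
    simp only
    rw [this, t2, hy']

end setup
end TC

namespace TC

section setup
variable {V : Type} [Fintype V] [LinearOrder V] [LinearOrder (Sym2 V)]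
variable {G : SimpleGraph V} {v0 v1 v2 : V} {B0 : Set (Sym2 V)} {pr : V → V} {F T : Set (Sym2 V)}

theorem leaf_le {W : Type} [Fintype W] {ty : W → Fin 3} {Hs : Set (Sym2 W)} {y : Sym2 W → ℕ} (hy : XH ty Hs y) {st q : W}
    (hl : Leaf (Gr y) ty st q) : y s(st, q) ≤ 2 := by
  have h1 : MM y st s(st, q) = y s(st, q) - 1 := by
    have : ∃ z ∈ s(st, q), (Gr y).Reachable st z := ⟨st, by simp, SimpleGraph.Reachable.refl _⟩
    simp only [MM, this, if_true]
  have h2 : MM y st s(st, q) ≤ 1 := by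
    rcases hy.good st with h | ⟨k, a, b, hr, hlt, _, _, h⟩ | ⟨r, v, p, hi, h⟩
    · exact (Finset.single_le_sum (f := MM y st) (fun _ _ => Nat.zero_le _) (Finset.mem_univ _)).trans h
    · rw [h, m2_leaf hl hr hlt]; split_ifs <;> omega
    · rw [h, m3_leaf hy.ac hl hi]; split_ifs <;> omega
  omega

theorem gr_gg (D : Dat G v0 v1 v2 B0 pr) {y : Sym2 (WW V) → ℕ} (hy : XH (tyW v0 v1 v2 pr) (HW v0 v1 v2 (G.edgeSet \ B0)) y)
    (y1 : y (vr1 v0 v1) ≠ 0) (y2 : y (vr2 v2) ≠ 0) : ∃ F ⊆ G.edgeSet \ B0, Gr y = GG v0 v1 v2 F := by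
  have hF : {e | e ∈ G.edgeSet \ B0 ∧ y (emb e) ≠ 0} ⊆ G.edgeSet \ B0 := fun e h => h.1
  refine ⟨_, hF, gr_of_supp ?_⟩
  intro e
  rw [gg_edge D hF]
  constructor
  · intro h
    rcases hy.sub e h with ⟨e', he', rfl⟩ | h'
    · exact Or.inl ⟨e', ⟨he', h⟩, rfl⟩
    · exact Or.inr h'
  · rintro (⟨e', he', rfl⟩ | h | h)
    · exact he'.2
    · rw [h]; exact y1
    · rw [Set.mem_singleton_iff.1 h]; exact y2

theorem vr_le (D : Dat G v0 v1 v2 B0 pr) {y : Sym2 (WW V) → ℕ} (hy : XH (tyW v0 v1 v2 pr) (HW v0 v1 v2 (G.edgeSet \ B0)) y)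
    (y1 : y (vr1 v0 v1) ≠ 0) (y2 : y (vr2 v2) ≠ 0) : y (vr1 v0 v1) ≤ 2 ∧ y (vr2 v2) ≤ 2 := by
  obtain ⟨F, hF, hg⟩ := gr_gg D hy y1 y2
  have hL := gg_lc D hF (by rw [← hg]; exact hy.ac)
  have l1 := hL.l1
  have l2 := hL.l2
  rw [← hg] at l1 l2
  exact ⟨leaf_le hy l1, leaf_le hy l2⟩

theorem emb_ne (D : Dat G v0 v1 v2 B0 pr) {e : Sym2 V} (he : e ∈ G.edgeSet \ B0) : emb e ≠ vr1 v0 v1 ∧ emb e ≠ vr2 v2 := by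
  constructor
  · intro h
    exact emb_mem (F := ∅) D he (by rw [h]; exact Or.inr (Or.inl rfl))
  · intro h
    exact emb_mem (F := ∅) D he (by rw [h]; exact Or.inr (Or.inr rfl))

theorem vr_ne : vr1 v0 v1 ≠ vr2 v2 := by
  intro h
  simp [vr1, vr2] at h

theorem sum_split (D : Dat G v0 v1 v2 B0 pr) {y : Sym2 (WW V) → ℕ} (hs : ∀ e, y e ≠ 0 → e ∈ HW v0 v1 v2 (G.edgeSet \ B0)) 
    (y1 : y (vr1 v0 v1) = 2) (y2 : y (vr2 v2) = 2) : 
    ∑ e, y e = ∑ e : {e // e ∈ G.edgeSet \ B0}, y (emb e.1) + 4 := by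
  have h1 : ∑ e : {e // e ∈ G.edgeSet \ B0}, y (emb e.1) = ∑ e ∈ Finset.univ.image (fun e : {e // e ∈ G.edgeSet \ B0} => emb e.1), y e := by
    rw [Finset.sum_image]
    intro a _ b _ h
    exact Subtype.ext (emb_inj h)
  have h2 : ∑ e ∈ ({vr1 v0 v1, vr2 v2} : Finset (Sym2 (WW V))), y e = 4 := by
    rw [Finset.sum_pair vr_ne, y1, y2]
  rw [h1, ← h2, ← Finset.sum_union]
  · symm
    refine Finset.sum_subset (Finset.subset_univ _) ?_
    intro e _ he
    by_contra h0
    apply he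
    rcases hs e h0 with ⟨e', he', rfl⟩ | h
    · exact Finset.mem_union_left _ (Finset.mem_image.2 ⟨⟨e', he'⟩, Finset.mem_univ _, rfl⟩)
    · refine Finset.mem_union_right _ ?_
      simpa using h
  · rw [Finset.disjoint_left]
    intro e he h
    obtain ⟨e', _, rfl⟩ := Finset.mem_image.1 he
    have := emb_ne D e'.2
    simp only [Finset.mem_insert, Finset.mem_singleton] at h
    tauto

theorem nb_cond (D : Dat G v0 v1 v2 B0 pr) (hnc : NoColoops G) (w : WW V) : 
    ∃ w', w' ≠ w ∧ s(w, w') ∈ HW v0 v1 v2 (G.edgeSet \ B0) := by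
  cases w with
  | s => exact ⟨WW.v v2, by simp, Or.inr (Or.inr rfl)⟩
  | v x =>
    by_cases x0 : x = v0
    · subst x0
      exact ⟨WW.v v1, fun h => D.h01 (WW.v_inj h).symm, Or.inr (Or.inl rfl)⟩
    by_cases x1 : x = v1
    · subst x1
      exact ⟨WW.v v0, fun h => D.h01 (WW.v_inj h), Or.inr (Or.inl Sym2.eq_swap)⟩
    by_cases x2 : x = v2
    · subst x2
      exact ⟨WW.s, by simp, Or.inr (Or.inr Sym2.eq_swap)⟩
    obtain ⟨T, hT, hxT⟩ := hnc s(x, pr x) (D.adj x x0)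
    obtain ⟨y, hy⟩ : ∃ y, (SimpleGraph.fromEdgeSet T).Adj x y := by
      by_contra hcon
      push Not at hcon
      have := closed_conn (P := fun z => z = x) (fun a b hab ha => (hcon b (ha ▸ hab)).elim) (hT.2.connected.preconnected x v0) rfl
      exact x0 this.symm
    refine ⟨WW.v y, fun h => hy.ne (WW.v_inj h).symm, Or.inl ⟨s(x, y), ⟨hT.1 hy.1, ?_⟩, rfl⟩⟩
    intro hB
    obtain ⟨z, hz, he⟩ := (D.hB _).1 hB
    rw [Sym2.eq_iff] at he
    rcases he with ⟨rfl, rfl⟩ | ⟨h1, rfl⟩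
    · exact hxT hy.1
    · have := D.parm y
      rw [← h1] at this
      tauto

theorem cut_cond (D : Dat G v0 v1 v2 B0 pr) (hnc : NoColoops G) (k : Fin 3) (hk : k ≠ 0) : 
    ∃ a b, s(a, b) ∈ HW v0 v1 v2 (G.edgeSet \ B0) ∧ tyW v0 v1 v2 pr a = k ∧ tyW v0 v1 v2 pr b ≠ k := by
  have hvk : vv v0 v1 v2 k ≠ v0 := fun h => hk (vv_inj D (i := k) (j := 0) h)
  have htk : ∀ j : Fin 3, j ≠ 0 → tyW v0 v1 v2 pr (WW.v (vv v0 v1 v2 j)) = j := by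
    intro j hj
    fin_cases j
    · exact (hj rfl).elim
    · exact ty_v1
    · exact ty_v2 D
  have h12 : ∀ x, x = v1 ∨ x = v2 → ∃ j : Fin 3, j ≠ 0 ∧ x = vv v0 v1 v2 j := by
    rintro x (h | h)
    · exact ⟨1, by decide, h⟩
    · exact ⟨2, by decide, h⟩
  have hp : pr (vv v0 v1 v2 k) = v0 := by
    fin_cases k
    · exact (hk rfl).elim
    · exact D.par1
    · exact D.par2
  obtain ⟨T, hT, hxT⟩ := hnc s(vv v0 v1 v2 k, pr (vv v0 v1 v2 k)) (D.adj _ hvk)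
  set S : V → Prop := fun x => x ≠ v0 ∧ tyW v0 v1 v2 pr (WW.v x) = k with hS
  have hvS : S (vv v0 v1 v2 k) := ⟨hvk, htk k hk⟩
  obtain ⟨a, b, hab, ha, hb⟩ : ∃ a b, (SimpleGraph.fromEdgeSet T).Adj a b ∧ S a ∧ ¬ S b := by
    by_contra hcon
    push Not at hcon
    have := closed_conn (P := S) (fun a b hab ha => hcon a b hab ha) (hT.2.connected.preconnected (vv v0 v1 v2 k) v0) hvS
    exact this.1 rfl
  have hH : s(a, b) ∈ G.edgeSet \ B0 := by
    refine ⟨hT.1 hab.1, fun hB => ?_⟩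
    obtain ⟨z, hz, he⟩ := (D.hB _).1 hB
    rw [Sym2.eq_iff] at he
    rcases he with ⟨rfl, rfl⟩ | ⟨h1, rfl⟩
    · by_cases hh : a = v1 ∨ a = v2
      · obtain ⟨j, hj, rfl⟩ := h12 a hh
        have := ha.2
        rw [htk j hj] at this
        subst this
        exact hxT hab.1
      · push Not at hh
        have := pr_vv D ha.1 hh.1 hh.2
        rw [ha.2] at this
        rw [this] at hb
        exact hb hvS
    · have hak : ∃ j : Fin 3, j ≠ 0 ∧ a = vv v0 v1 v2 j := by
        apply h12
        have := D.parm b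
        rw [← h1] at this
        rcases this with h | h
        · exact (ha.1 h).elim
        · exact h
      obtain ⟨j, hj, haj⟩ := hak
      have hjk := ha.2
      rw [haj, htk j hj] at hjk
      subst hjk
      by_cases hh : b = v1 ∨ b = v2
      · have : pr b = v0 := by
          rcases hh with rfl | rfl
          · exact D.par1
          · exact D.par2
        exact ha.1 (h1.trans this)
      · push Not at hh
        have := pr_vv D hz hh.1 hh.2
        rw [← h1, haj] at this
        exact hb ⟨hz, (vv_inj D this).symm⟩
  have hne := F_ne D (le_refl (G.edgeSet \ B0)) hH
  exact ⟨WW.v a, WW.v b, Or.inl ⟨_, hH, rfl⟩, ha.2, fun h => hb ⟨hne.2.1, h⟩⟩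

end setup
end TC

namespace TC

section setup
variable {V : Type} [Fintype V] [LinearOrder V] [LinearOrder (Sym2 V)]
variable {G : SimpleGraph V} {v0 v1 v2 : V} {B0 : Set (Sym2 V)} {pr : V → V} {F T : Set (Sym2 V)}

theorem pass_le (hT : IsSpanningTree G T) : passivity G T + 1 ≤ Fintype.card V := by
  have h := ((tree_iff G T).1 hT).2.2
  have : passivity G T ≤ T.ncard := Set.ncard_le_ncard (fun e he => he.1) (Set.toFinite _)
  omega

theorem final (D : Dat G v0 v1 v2 B0 pr) (hnc : NoColoops G) :
    ∃ φ : Set (Sym2 V) → ({e : Sym2 V // e ∈ G.edgeSet \ B0} →₀ ℕ),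
      Set.InjOn φ {T | IsSpanningTree G T} ∧
      (∀ T, IsSpanningTree G T → ((φ T).sum fun _ n => n) = passivity G T) ∧
      (∀ T, IsSpanningTree G T → ∀ ν, ν ≤ φ T → ∃ T', IsSpanningTree G T' ∧ φ T' = ν) ∧
      (∀ T T', IsSpanningTree G T → IsSpanningTree G T' →
        (∀ T'', IsSpanningTree G T'' → φ T ≤ φ T'' → φ T'' = φ T) →
        (∀ T'', IsSpanningTree G T'' → φ T' ≤ φ T'' → φ T'' = φ T') →
        ((φ T).sum fun _ n => n) = ((φ T').sum fun _ n => n)) := by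
  obtain ⟨Y, h1, h2, h3⟩ := tree_wt D
  let φ : Set (Sym2 V) → ({e : Sym2 V // e ∈ G.edgeSet \ B0} →₀ ℕ) := fun T =>
    Finsupp.equivFunOnFinite.symm (fun e => Y T (emb e.1))
  have hφ : ∀ T e, φ T e = Y T (emb e.1) := fun T e => rfl
  have hsum : ∀ T, IsSpanningTree G T → ((φ T).sum fun _ n => n) = passivity G T := by
    intro T hT
    obtain ⟨hx, a1, a2, hs⟩ := h1 T hT
    rw [Finsupp.sum_fintype _ _ (fun _ => rfl)]
    have := sum_split D hx.sub a1 a2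
    simp only [hφ]
    omega
  have hmax : ∀ T, IsSpanningTree G T → (∀ T'', IsSpanningTree G T'' → φ T ≤ φ T'' → φ T'' = φ T) →
      passivity G T + 1 = Fintype.card V := by
    intro T hT hm
    by_contra hne
    have hle := pass_le hT
    obtain ⟨hx, a1, a2, hs⟩ := h1 T hT
    obtain ⟨a, b, hab⟩ := pure hx (by rw [card_WW, hs]; omega) (nb_cond D hnc) (cut_cond D hnc)
    have hv := vr_le D hab (by simp [a1]) (by simp [a2])
    have hmem := hab.sub s(a, b) (by simp [dl])
    simp only [Pi.add_apply, a1, a2] at hv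
    rcases hmem with ⟨e, he, hee⟩ | h | h
    · obtain ⟨n1, n2⟩ := emb_ne D he
      obtain ⟨T', hT', hY⟩ := h3 _ hab 
        (by rw [Pi.add_apply, a1, dl, if_neg (by rw [← hee]; exact n1.symm)])
        (by rw [Pi.add_apply, a2, dl, if_neg (by rw [← hee]; exact n2.symm)])
      have := hm T' hT' (by
        intro e'
        rw [hφ, hφ, hY]
        exact Nat.le_add_right _ _)
      have := DFunLike.congr_fun this ⟨e, he⟩
      rw [hφ, hφ, hY] at this
      simp [dl, hee] at this
    · have := hv.1
      rw [h, dl, if_pos rfl] at this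
      omega
    · have := hv.2
      rw [Set.mem_singleton_iff.1 h, dl, if_pos rfl] at this
      omega
  refine ⟨φ, ?_, hsum, ?_, ?_⟩
  · intro T hT T' hT' h
    apply h2 T T' hT hT'
    obtain ⟨hx, a1, a2, -⟩ := h1 T hT
    obtain ⟨hx', a1', a2', -⟩ := h1 T' hT'
    funext e
    by_cases he : e ∈ HW v0 v1 v2 (G.edgeSet \ B0)
    · rcases he with ⟨e, he, rfl⟩ | h' | h'
      · exact DFunLike.congr_fun h ⟨e, he⟩
      · rw [h', a1, a1']
      · rw [Set.mem_singleton_iff.1 h', a2, a2']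
    · have b1 : Y T e = 0 := by
        by_contra hc; exact he (hx.sub e hc)
      have b2 : Y T' e = 0 := by
        by_contra hc; exact he (hx'.sub e hc)
      rw [b1, b2]
  · intro T hT ν hν
    obtain ⟨hx, a1, a2, -⟩ := h1 T hT
    let y : Sym2 (WW V) → ℕ := fun e' => if e' = vr1 v0 v1 ∨ e' = vr2 v2 then 2 else
      if h : ∃ e : {e : Sym2 V // e ∈ G.edgeSet \ B0}, emb e.1 = e' then ν h.choose else 0
    have hye : ∀ e : {e : Sym2 V // e ∈ G.edgeSet \ B0}, y (emb e.1) = ν e := by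
      intro e
      have hn := emb_ne D e.2
      have hex : ∃ e1 : {e : Sym2 V // e ∈ G.edgeSet \ B0}, emb e1.1 = emb e.1 := ⟨e, rfl⟩
      have : hex.choose = e := Subtype.ext (emb_inj hex.choose_spec)
      simp only [y]
      rw [if_neg (by tauto), dif_pos hex, this]
    have hle : ∀ e, y e ≤ Y T e := by
      intro e
      by_cases hv : e = vr1 v0 v1 ∨ e = vr2 v2
      · have : y e = 2 := if_pos hv
        rw [this]
        rcases hv with rfl | rfl
        · rw [a1]
        · rw [a2]
      · by_cases h : ∃ e1 : {e : Sym2 V // e ∈ G.edgeSet \ B0}, emb e1.1 = e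
        · obtain ⟨e1, rfl⟩ := h
          rw [hye, ← hφ]
          exact hν e1
        · have : y e = 0 := by simp only [y]; rw [if_neg hv, dif_neg h]
          rw [this]; exact Nat.zero_le _
    obtain ⟨T', hT', hY⟩ := h3 y (hx.mono hle) (if_pos (Or.inl rfl)) (if_pos (Or.inr rfl))
    refine ⟨T', hT', ?_⟩
    ext e
    rw [hφ, hY, hye]
  · intro T T' hT hT' hm hm'
    rw [hsum T hT, hsum T' hT']
    have := hmax T hT hm
    have := hmax T' hT' hm'
    omega

end setup
end TC

section Statements

variable (G : SimpleGraph V) (v0 v1 v2 : V) (B0 : Set (Sym2 V))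

theorem statement1
    (hG : IsTriconed G v0 v1 v2)
    (hvo : VertexOrderSpec G v0 v1 v2)
    (heo : EdgeOrderSpec G v0 v1 v2)
    (hnc : NoColoops G)
    (hB0 : IsMinSpanningTree G B0) :
    ∃ φ : Set (Sym2 V) → ({e : Sym2 V // e ∈ G.edgeSet \ B0} →₀ ℕ),
      Set.InjOn φ {T | IsSpanningTree G T} ∧
      (∀ T, IsSpanningTree G T → ((φ T).sum fun _ n => n) = passivity G T) ∧
      (∀ T, IsSpanningTree G T → ∀ ν, ν ≤ φ T → ∃ T', IsSpanningTree G T' ∧ φ T' = ν) ∧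
      (∀ T T', IsSpanningTree G T → IsSpanningTree G T' →
        (∀ T'', IsSpanningTree G T'' → φ T ≤ φ T'' → φ T'' = φ T) →
        (∀ T'', IsSpanningTree G T'' → φ T' ≤ φ T'' → φ T'' = φ T') →
        ((φ T).sum fun _ n => n) = ((φ T').sum fun _ n => n)) := by
  exact TC.final (TC.mk_dat hG hvo heo hB0) hnc

end Statements
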